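/- arXiv:1705.08007 — 4 statements merged into one kernel-verified Lean document; each statement's English description precedes it below -/
import Mathlib

section
/- There exists a constant C > 0 such that for all x ∈ ℝ^N, Aψ(x) ≤ C ψ(x), where ψ(x) = 1 + |x|^γ and Aψ(x) = γ(N+γ−2)(1+|x|^α)|x|^{γ−2} + bγ|x|^{α+γ−2} − c(1+|x|^γ)|x|^β. In other words, ψ is a Lyapunov function for the operator A. -/
open Real

/-- Let `N > 2`, `α > 2`, `β > α - 2`, `c > 0`, `b ∈ ℝ`, `γ > 2` and
`ψ(x) = 1 + |x|^γ`. Then there is a constant `C > 0` such that `Aψ(x) ≤ C ψ(x)` for all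
`x ∈ ℝ^N`, where
`Aψ(x) = γ(N+γ-2)(1+|x|^α)|x|^{γ-2} + bγ|x|^{α+γ-2} - c(1+|x|^γ)|x|^β`. -/
theorem stmt0 (N : ℕ) (hN : 2 < N) (α β b c γ : ℝ) (hα : 2 < α) (hβ : α - 2 < β)
    (hc : 0 < c) (hγ : 2 < γ) :
    ∃ C : ℝ, 0 < C ∧ ∀ x : EuclideanSpace ℝ (Fin N),
      γ * ((N : ℝ) + γ - 2) * (1 + ‖x‖ ^ α) * ‖x‖ ^ (γ - 2)
        + b * γ * ‖x‖ ^ (α + γ - 2)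
        - c * (1 + ‖x‖ ^ γ) * ‖x‖ ^ β
      ≤ C * (1 + ‖x‖ ^ γ) := by
  have hN' : (2 : ℝ) < N := by exact_mod_cast hN
  obtain ⟨K, hK⟩ : ∃ K, K = γ * ((N : ℝ) + γ - 2) := ⟨_, rfl⟩
  have hKpos : 0 < K := by rw [hK]; apply mul_pos <;> linarith
  obtain ⟨M, hM⟩ : ∃ M, M = K + |b| * γ := ⟨_, rfl⟩
  have hMpos : 0 < M := by
    have : 0 ≤ |b| * γ := mul_nonneg (abs_nonneg b) (by linarith)
    linarith
  have hδ : 0 < β - (α - 2) := by linarith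
  obtain ⟨R, hR⟩ : ∃ R, R = (M / c) ^ (1 / (β - (α - 2))) := ⟨_, rfl⟩
  have hMc : 0 < M / c := div_pos hMpos hc
  have hRpos : 0 < R := by rw [hR]; exact Real.rpow_pos_of_pos hMc _
  have hRδ : R ^ (β - (α - 2)) = M / c := by
    rw [hR, ← Real.rpow_mul hMc.le, one_div_mul_cancel hδ.ne', Real.rpow_one]
  have hP : 0 < M * R ^ (α - 2) := mul_pos hMpos (Real.rpow_pos_of_pos hRpos _)
  refine ⟨K + M * R ^ (α - 2), by linarith, fun x => ?_⟩
  rw [← hK]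
  have hr : 0 ≤ ‖x‖ := norm_nonneg x
  generalize ‖x‖ = r at hr ⊢
  have key : M * r ^ (α - 2) ≤ M * R ^ (α - 2) + c * r ^ β := by
    rcases le_total r R with h | h
    · have h1 : r ^ (α - 2) ≤ R ^ (α - 2) := Real.rpow_le_rpow hr h (by linarith)
      have h2 : 0 ≤ c * r ^ β := mul_nonneg hc.le (Real.rpow_nonneg hr _)
      have := mul_le_mul_of_nonneg_left h1 hMpos.le
      linarith
    · have h1 : R ^ (β - (α - 2)) ≤ r ^ (β - (α - 2)) :=
        Real.rpow_le_rpow hRpos.le h hδ.le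
      rw [hRδ, div_le_iff₀ hc] at h1
      have h2 : r ^ β = r ^ (β - (α - 2)) * r ^ (α - 2) := by
        rw [← Real.rpow_add_of_nonneg hr hδ.le (by linarith)]
        congr 1; ring
      have := mul_le_mul_of_nonneg_right h1 (Real.rpow_nonneg hr (α - 2))
      rw [h2]
      nlinarith
  have e1 : r ^ α * r ^ (γ - 2) = r ^ (α + γ - 2) := by
    rw [← Real.rpow_add_of_nonneg hr (by linarith) (by linarith)]
    congr 1; ring
  have e2 : r ^ (α + γ - 2) = r ^ (α - 2) * r ^ γ := by
    rw [← Real.rpow_add_of_nonneg hr (by linarith) (by linarith)]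
    congr 1; ring
  have hg : 0 ≤ r ^ γ := Real.rpow_nonneg hr _
  have ha : 0 ≤ r ^ (α - 2) := Real.rpow_nonneg hr _
  have e3 : r ^ (γ - 2) ≤ 1 + r ^ γ := by
    rcases le_total r 1 with h | h
    · have := Real.rpow_le_one hr h (show 0 ≤ γ - 2 by linarith)
      linarith
    · have := Real.rpow_le_rpow_of_exponent_le h (show γ - 2 ≤ γ by linarith)
      linarith
  have s1 : K * r ^ (γ - 2) ≤ K * (1 + r ^ γ) := mul_le_mul_of_nonneg_left e3 hKpos.le
  have s2 : b * γ * (r ^ (α - 2) * r ^ γ) ≤ |b| * γ * (r ^ (α - 2) * r ^ γ) := by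
    apply mul_le_mul_of_nonneg_right _ (mul_nonneg ha hg)
    exact mul_le_mul_of_nonneg_right (le_abs_self b) (by linarith)
  have s3 := mul_le_mul_of_nonneg_right key (show 0 ≤ 1 + r ^ γ by linarith)
  have s4 : 0 ≤ M * r ^ (α - 2) := mul_nonneg hMpos.le ha
  calc K * (1 + r ^ α) * r ^ (γ - 2) + b * γ * r ^ (α + γ - 2) - c * (1 + r ^ γ) * r ^ β
      = K * r ^ (γ - 2) + K * (r ^ α * r ^ (γ - 2)) + b * γ * r ^ (α + γ - 2)
        - c * (1 + r ^ γ) * r ^ β := by ring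
    _ = K * r ^ (γ - 2) + K * (r ^ (α - 2) * r ^ γ) + b * γ * (r ^ (α - 2) * r ^ γ)
        - c * (1 + r ^ γ) * r ^ β := by rw [e1, e2]
    _ ≤ K * (1 + r ^ γ) + M * r ^ (α - 2) * (1 + r ^ γ) - c * (1 + r ^ γ) * r ^ β := by
        have : M * r ^ (α - 2) * (1 + r ^ γ) = M * r ^ (α - 2) + K * (r ^ (α - 2) * r ^ γ)
          + |b| * γ * (r ^ (α - 2) * r ^ γ) := by
            have : M * r ^ (α - 2) * (1 + r ^ γ)
              = M * r ^ (α - 2) + M * (r ^ (α - 2) * r ^ γ) := by ring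
            rw [this]
            nth_rewrite 2 [hM]
            ring
        linarith
    _ ≤ (K + M * R ^ (α - 2)) * (1 + r ^ γ) := by linarith
end

section
/- There exist λ0 > 0 and a constant C > 0 (depending on N, α, β, b, c, λ) such that for every λ ≥ λ0, every x ∈ ℝ^N and every r > 0 satisfying r^{2−N} ∫_{B(x,r)} 𝒱_λ(y) dy ≤ 1, one has r ≤ C (1+|x|)^{(α−β)/2}. Equivalently, the auxiliary function m defined by 1/m(x) = sup{ r > 0 : r^{2−N} ∫_{B(x,r)} 𝒱_λ(y) dy ≤ 1 } satisfies m(x) ≥ C' (1+|x|)^{(β−α)/2} for some constant C' > 0. -/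
open Real MeasureTheory Metric

/-- The potential `𝒱_λ` associated with the operator `A`. -/
noncomputable def pot (N : ℕ) (α β b c lam : ℝ) (x : EuclideanSpace ℝ (Fin N)) : ℝ :=
  (b ^ 2 / 4 - b * α / 2) * ‖x‖ ^ (2 * α - 2) / (1 + ‖x‖ ^ α) ^ 2
    + (b / 2) * ((N : ℝ) + α - 2) * ‖x‖ ^ (α - 2) / (1 + ‖x‖ ^ α)
    + (c * ‖x‖ ^ β + lam) / (1 + ‖x‖ ^ α)

lemma aux_absorb (p β K c : ℝ) (hp : 0 < p) (hβ : p < β) (hc : 0 < c) (hK : 0 ≤ K) :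
    ∃ M : ℝ, 0 ≤ M ∧ ∀ t : ℝ, 0 ≤ t → K * t ^ p ≤ c / 2 * t ^ β + M := by
  set T : ℝ := (2 * K / c) ^ (1 / (β - p)) with hT
  have hT0 : 0 ≤ T := by positivity
  refine ⟨K * T ^ p, by positivity, fun t ht => ?_⟩
  rcases le_total t T with h | h
  · have h1 : t ^ p ≤ T ^ p := Real.rpow_le_rpow ht h hp.le
    have h2 : 0 ≤ c / 2 * t ^ β := by positivity
    nlinarith [mul_le_mul_of_nonneg_left h1 hK]
  · have h1 : 2 * K / c ≤ t ^ (β - p) := by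
      have h2 := Real.rpow_le_rpow hT0 h (sub_pos.2 hβ).le
      rw [hT, ← Real.rpow_mul (by positivity), one_div_mul_cancel (sub_pos.2 hβ).ne',
        Real.rpow_one] at h2
      exact h2
    have h3 : t ^ β = t ^ (β - p) * t ^ p := by
      rw [← Real.rpow_add_of_nonneg ht (sub_pos.2 hβ).le hp.le]; congr 1; ring
    have h4 : K ≤ c / 2 * t ^ (β - p) := by
      rw [div_le_iff₀ hc] at h1; linarith
    have h5 : 0 ≤ t ^ p := by positivity
    have h6 : 0 ≤ K * T ^ p := by positivity
    rw [h3]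
    nlinarith [mul_le_mul_of_nonneg_right h4 h5]

lemma pot_cont (N : ℕ) (α β b c lam : ℝ) (hα : 2 < α) (hβ : α - 2 < β) :
    Continuous (pot N α β b c lam) := by
  have hpos : ∀ x : EuclideanSpace ℝ (Fin N), 1 + ‖x‖ ^ α ≠ 0 := fun x => by positivity
  have h (p : ℝ) (hp : 0 ≤ p) : Continuous (fun x : EuclideanSpace ℝ (Fin N) => ‖x‖ ^ p) :=
    continuous_norm.rpow_const (fun _ => Or.inr hp)
  have h1 := h (2 * α - 2) (by linarith)
  have h2 := h (α - 2) (by linarith)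
  have h3 := h α (by linarith)
  have h4 := h β (by linarith)
  unfold pot
  refine Continuous.add (Continuous.add ?_ ?_) ?_
  · exact (continuous_const.mul h1).div ((continuous_const.add h3).pow 2)
      (fun x => pow_ne_zero 2 (hpos x))
  · exact (continuous_const.mul h2).div (continuous_const.add h3) hpos
  · exact ((continuous_const.mul h4).add continuous_const).div (continuous_const.add h3) hpos

lemma pot_lower (N : ℕ) (α β b c : ℝ) (hα : 2 < α) (hβ : α - 2 < β) (hc : 0 < c) :
    ∃ lam0 : ℝ, 0 < lam0 ∧ ∃ k : ℝ, 0 < k ∧ ∀ lam : ℝ, lam0 ≤ lam →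
      ∀ x : EuclideanSpace ℝ (Fin N), k * (1 + ‖x‖) ^ (β - α) ≤ pot N α β b c lam x := by
  set A := b ^ 2 / 4 - b * α / 2 with hA
  set B := (b / 2) * ((N : ℝ) + α - 2) with hB
  obtain ⟨M, hM, hMt⟩ := aux_absorb (α - 2) β (|A| + |B|) c (by linarith) hβ hc (by positivity)
  refine ⟨M + c / 2, by positivity, c / 2 / 2 ^ β / 2, by positivity, fun lam hlam x => ?_⟩
  unfold pot
  rw [← hA, ← hB]
  have ht : 0 ≤ ‖x‖ := norm_nonneg x
  generalize ‖x‖ = t at ht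
  have hD : 0 < 1 + t ^ α := by positivity
  have hq : 0 ≤ t ^ (α - 2) := by positivity
  have e1 : t ^ (2 * α - 2) = t ^ (α - 2) * t ^ α := by
    rw [← Real.rpow_add_of_nonneg ht (by linarith) (by linarith)]; congr 1; ring
  have hfrac : t ^ (2 * α - 2) / (1 + t ^ α) ≤ t ^ (α - 2) := by
    rw [div_le_iff₀ hD, e1]; nlinarith
  have hfrac0 : 0 ≤ t ^ (2 * α - 2) / (1 + t ^ α) := by positivity
  have e2 : A * t ^ (2 * α - 2) / (1 + t ^ α) ^ 2 + B * t ^ (α - 2) / (1 + t ^ α)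
      + (c * t ^ β + lam) / (1 + t ^ α)
      = (A * (t ^ (2 * α - 2) / (1 + t ^ α)) + B * t ^ (α - 2) + (c * t ^ β + lam))
        / (1 + t ^ α) := by
    field_simp
  rw [e2, le_div_iff₀ hD]
  have h1 : -(|A| * t ^ (α - 2)) ≤ A * (t ^ (2 * α - 2) / (1 + t ^ α)) := by
    have := mul_le_mul_of_nonneg_left hfrac (abs_nonneg A)
    nlinarith [mul_le_mul_of_nonneg_right (neg_abs_le A) hfrac0]
  have h2 : -(|B| * t ^ (α - 2)) ≤ B * t ^ (α - 2) := by
    nlinarith [mul_le_mul_of_nonneg_right (neg_abs_le B) hq]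
  have h3 := hMt t ht
  have h4 : c / 2 * (1 + t ^ β) ≤
      A * (t ^ (2 * α - 2) / (1 + t ^ α)) + B * t ^ (α - 2) + (c * t ^ β + lam) := by
    nlinarith
  refine le_trans ?_ h4
  have hβ0 : 0 < β := by linarith
  have h5 : (1 + t) ^ β ≤ 2 ^ β * (1 + t ^ β) := by
    have ht' : 0 ≤ t ^ β := by positivity
    have h2' : (0:ℝ) < 2 ^ β := by positivity
    rcases le_total t 1 with h | h
    · have : (1 + t) ^ β ≤ 2 ^ β := Real.rpow_le_rpow (by linarith) (by linarith) hβ0.le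
      nlinarith
    · have : (1 + t) ^ β ≤ (2 * t) ^ β := Real.rpow_le_rpow (by linarith) (by linarith) hβ0.le
      rw [Real.mul_rpow (by norm_num) ht] at this
      nlinarith
  have h6 : 1 + t ^ α ≤ 2 * (1 + t) ^ α := by
    have : t ^ α ≤ (1 + t) ^ α := Real.rpow_le_rpow ht (by linarith) (by linarith)
    have := Real.one_le_rpow (x := 1 + t) (z := α) (by linarith) (by linarith)
    linarith
  have h7 : (1 + t) ^ (β - α) * (1 + t) ^ α = (1 + t) ^ β := by
    rw [← Real.rpow_add (by linarith)]; congr 1; ring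
  calc c / 2 / 2 ^ β / 2 * (1 + t) ^ (β - α) * (1 + t ^ α)
      ≤ c / 2 / 2 ^ β / 2 * (1 + t) ^ (β - α) * (2 * (1 + t) ^ α) := by gcongr
    _ = c / 2 / 2 ^ β * (1 + t) ^ β := by rw [← h7]; ring
    _ ≤ c / 2 / 2 ^ β * (2 ^ β * (1 + t ^ β)) := by gcongr
    _ = c / 2 * (1 + t ^ β) := by
      have : (2:ℝ) ^ β ≠ 0 := by positivity
      field_simp

lemma int_lower (N : ℕ) (V : EuclideanSpace ℝ (Fin N) → ℝ) (hV : Continuous V)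
    (h0 : ∀ y, 0 ≤ V y) (x z : EuclideanSpace ℝ (Fin N)) (r ρ m : ℝ) (hρ : 0 < ρ)
    (hsub : ball z ρ ⊆ ball x r) (hm : ∀ y ∈ ball z ρ, m ≤ V y) :
    m * (ρ ^ N * volume.real (ball (0 : EuclideanSpace ℝ (Fin N)) 1)) ≤ ∫ y in ball x r, V y := by
  have hint : IntegrableOn V (ball x r) :=
    (hV.continuousOn.integrableOn_compact (isCompact_closedBall x r)).mono_set ball_subset_closedBall
  have hvol : volume.real (ball z ρ) =
      ρ ^ N * volume.real (ball (0 : EuclideanSpace ℝ (Fin N)) 1) := by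
    rw [Measure.real, Measure.addHaar_ball_of_pos _ _ hρ, ENNReal.toReal_mul,
      ENNReal.toReal_ofReal (by positivity), Measure.real]
    simp
  calc m * (ρ ^ N * volume.real (ball (0 : EuclideanSpace ℝ (Fin N)) 1))
      = ∫ y in ball z ρ, m := by rw [setIntegral_const, hvol, smul_eq_mul, mul_comm]
    _ ≤ ∫ y in ball z ρ, V y := by
      refine setIntegral_mono_on ?_ (hint.mono_set hsub) measurableSet_ball hm
      exact integrableOn_const measure_ball_lt_top.ne
    _ ≤ ∫ y in ball x r, V y := by
      refine setIntegral_mono_set hint ?_ hsub.eventuallyLE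
      exact Filter.Eventually.of_forall h0

lemma exists_dir (N : ℕ) (hN : 2 < N) (x : EuclideanSpace ℝ (Fin N)) :
    ∃ u : EuclideanSpace ℝ (Fin N), ‖u‖ = 1 ∧ ∀ s : ℝ, 0 ≤ s → ‖x + s • u‖ = ‖x‖ + s := by
  by_cases hx : x = 0
  · refine ⟨EuclideanSpace.single ⟨0, by omega⟩ 1, by simp, fun s hs => ?_⟩
    subst hx
    simp [norm_smul, abs_of_nonneg hs]
  · have hn : 0 < ‖x‖ := norm_pos_iff.2 hx
    refine ⟨‖x‖⁻¹ • x, by rw [norm_smul, norm_inv, norm_norm, inv_mul_cancel₀ hn.ne'],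
      fun s hs => ?_⟩
    have : x + s • ‖x‖⁻¹ • x = (1 + s * ‖x‖⁻¹) • x := by rw [add_smul, one_smul, mul_smul]
    rw [this, norm_smul, Real.norm_of_nonneg (by positivity)]
    field_simp

/-- from `κ r² R^γ ≤ 1` to `r ≤ κ^{-1/2} R^{-γ/2}`. -/
lemma extract (κ r R γ : ℝ) (hκ : 0 < κ) (hR : 0 < R) (h : κ * r ^ 2 * R ^ γ ≤ 1) :
    r ≤ (√κ)⁻¹ * R ^ (-γ / 2) := by
  have hs : 0 < √κ := Real.sqrt_pos.2 hκ
  have hp : 0 < R ^ (γ / 2) := by positivity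
  have e : R ^ (-γ / 2) = (R ^ (γ / 2))⁻¹ := by rw [← Real.rpow_neg hR.le]; congr 1; ring
  have e2 : R ^ γ = (R ^ (γ / 2)) ^ 2 := by
    rw [← Real.rpow_natCast, ← Real.rpow_mul hR.le]; congr 1; push_cast; ring
  rw [e, ← mul_inv, ← one_div, le_div_iff₀ (by positivity)]
  refine (sq_le_one_iff_abs_le_one _).1 ?_ |> (le_abs_self _).trans
  rw [mul_pow, mul_pow, Real.sq_sqrt hκ.le, ← e2]
  linarith

/-- There exist `λ0 > 0` and `C > 0` such that for every `λ ≥ λ0`,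
every `x ∈ ℝ^N` and every `r > 0` satisfying `r^{2-N} ∫_{B(x,r)} 𝒱_λ(y) dy ≤ 1` one has
`r ≤ C (1+|x|)^{(α-β)/2}`; equivalently, the auxiliary function `m` of Shen satisfies
`m(x) ≥ C' (1+|x|)^{(β-α)/2}`. -/
theorem stmt1 (N : ℕ) (hN : 2 < N) (α β b c : ℝ) (hα : 2 < α) (hβ : α - 2 < β)
    (hc : 0 < c) :
    ∃ lam0 : ℝ, 0 < lam0 ∧ ∃ C : ℝ, 0 < C ∧ ∀ lam : ℝ, lam0 ≤ lam →
      ∀ (x : EuclideanSpace ℝ (Fin N)) (r : ℝ), 0 < r →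
        r ^ ((2 : ℝ) - (N : ℝ)) * ∫ y in ball x r, pot N α β b c lam y ≤ 1 →
        r ≤ C * (1 + ‖x‖) ^ ((α - β) / 2) := by
  obtain ⟨lam0, hlam0, k, hk, hlow⟩ := pot_lower N α β b c hα hβ hc
  refine ⟨lam0, hlam0, ?_⟩
  set ω := volume.real (ball (0 : EuclideanSpace ℝ (Fin N)) 1) with hω
  have hω0 : 0 < ω := by
    rw [hω, Measure.real]
    exact ENNReal.toReal_pos (measure_ball_pos volume _ one_pos).ne' measure_ball_lt_top.ne
  have hnn : ∀ lam, lam0 ≤ lam → ∀ y, 0 ≤ pot N α β b c lam y := fun lam hl y =>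
    le_trans (by positivity) (hlow lam hl y)
  have hpow : ∀ r : ℝ, 0 < r → r ^ ((2 : ℝ) - (N : ℝ)) * r ^ N = r ^ 2 := fun r hr => by
    rw [← Real.rpow_natCast r N, ← Real.rpow_add hr, ← Real.rpow_natCast r 2]; congr 1
    push_cast; ring
  have eγ : (α - β) / 2 = -(β - α) / 2 := by ring
  rw [eγ]
  rcases le_total 0 (β - α) with hγ | hγ
  · refine ⟨(√(k * ω / 4 ^ N))⁻¹, by positivity, fun lam hl x r hr h => ?_⟩
    apply extract _ _ _ _ (by positivity) (by positivity)
    obtain ⟨u, hu, hux⟩ := exists_dir N hN x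
    have hxz := hux (r / 2) (by positivity)
    have hdz : dist (x + (r / 2) • u) x = r / 2 := by
      rw [dist_eq_norm, add_sub_cancel_left, norm_smul, hu, Real.norm_of_nonneg (by positivity),
        mul_one]
    have key := int_lower N _ (pot_cont N α β b c lam hα hβ) (hnn lam hl) x (x + (r / 2) • u) r
      (r / 4) (k * (1 + ‖x‖) ^ (β - α)) (by positivity)
      (ball_subset_ball' (by rw [hdz]; linarith)) (fun y hy => by
        refine le_trans ?_ (hlow lam hl y)
        have h1 : ‖x + (r / 2) • u‖ - ‖y‖ ≤ dist y (x + (r / 2) • u) := by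
          rw [dist_comm, dist_eq_norm]; exact norm_sub_norm_le _ _
        have h2 := mem_ball.1 hy
        have h3 : ‖x‖ ≤ ‖y‖ := by linarith
        gcongr)
    refine le_trans (le_of_eq ?_) ((mul_le_mul_of_nonneg_left key (by positivity)).trans h)
    rw [← hpow r hr, div_pow]
    ring
  · have hg2 : 0 < 2 + (β - α) := by linarith
    set γ := β - α with hγd
    set κ := k * ω * 2 ^ γ with hκ
    have hκ0 : 0 < κ := by positivity
    refine ⟨(√κ)⁻¹ + (κ⁻¹) ^ (1 / (2 + γ)), by positivity, fun lam hl x r hr h => ?_⟩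
    have key := int_lower N _ (pot_cont N α β b c lam hα hβ) (hnn lam hl) x x r
      r (k * (1 + ‖x‖ + r) ^ γ) hr subset_rfl (fun y hy => by
        refine le_trans ?_ (hlow lam hl y)
        have h1 : ‖y‖ - ‖x‖ ≤ dist y x := by
          rw [dist_eq_norm]; exact norm_sub_norm_le _ _
        have h2 := mem_ball.1 hy
        refine mul_le_mul_of_nonneg_left ?_ hk.le
        exact Real.rpow_le_rpow_of_nonpos (by positivity) (by linarith) hγ)
    have h' := (mul_le_mul_of_nonneg_left key (by positivity)).trans h
    have h'' : k * ω * r ^ 2 * (1 + ‖x‖ + r) ^ γ ≤ 1 := by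
      refine le_trans (le_of_eq ?_) h'
      rw [← hpow r hr]; ring
    have hR : 1 ≤ 1 + ‖x‖ := by linarith [norm_nonneg x]
    generalize 1 + ‖x‖ = R at *
    have hR0 : 0 < R := by linarith
    have hRp : 1 ≤ R ^ (-γ / 2) := Real.one_le_rpow hR (by linarith)
    rw [add_mul]
    have hstep : ∀ s : ℝ, 0 < s → R + r ≤ 2 * s → κ * r ^ 2 * s ^ γ ≤ 1 := fun s hs hle => by
      refine le_trans ?_ h''
      have : (2 * s) ^ γ ≤ (R + r) ^ γ := Real.rpow_le_rpow_of_nonpos (by positivity) hle hγ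
      rw [Real.mul_rpow (by norm_num) hs.le] at this
      calc κ * r ^ 2 * s ^ γ = k * ω * r ^ 2 * (2 ^ γ * s ^ γ) := by rw [hκ]; ring
        _ ≤ _ := by gcongr
    have hp1 : 0 ≤ (κ⁻¹) ^ (1 / (2 + γ)) := by positivity
    rcases le_total r R with hrR | hrR
    · have := extract κ r R γ hκ0 hR0 (hstep R hR0 (by linarith))
      nlinarith
    · have h1 := hstep r hr (by linarith)
      have h2 : r ^ (2 + γ) ≤ κ⁻¹ := by
        rw [Real.rpow_add hr, Real.rpow_two, ← one_div, le_div_iff₀ hκ0]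
        linarith
      have h3 : r ≤ (κ⁻¹) ^ (1 / (2 + γ)) := by
        have := Real.rpow_le_rpow (by positivity) h2 (z := 1 / (2 + γ)) (by positivity)
        rwa [← Real.rpow_mul hr.le, mul_one_div_cancel hg2.ne', Real.rpow_one] at this
      have h4 : 0 ≤ (√κ)⁻¹ * R ^ (-γ / 2) := by positivity
      nlinarith
end

section
/- Assume β > α. For every 1 < p < ∞ there exists a constant C > 0, independent of u, x0 and R, such that for every x0 ∈ ℝ^N, every R ≥ 1 and every u ∈ C_c^∞(ℝ^N; ℝ): ‖Δu‖_{L^p(B(x0, R/2))} ≤ C ( ‖Ãu‖_{L^p(B(x0,R))} + ‖u‖_{L^p(B(x0,R))} ), where Ãu(x) = Δu(x) + b |x|^{α−2} (1+|x|^α)^{−1} x·∇u(x) − c |x|^β (1+|x|^α)^{−1} u(x). -/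
open Real MeasureTheory Metric
open scoped ENNReal NNReal

/-- The `i`-th partial derivative of `u` at `x`. -/
noncomputable def pd {N : ℕ} {F : Type*} [NormedAddCommGroup F] [NormedSpace ℝ F]
    (u : EuclideanSpace ℝ (Fin N) → F) (i : Fin N) (x : EuclideanSpace ℝ (Fin N)) : F :=
  fderiv ℝ u x (EuclideanSpace.single i 1)

/-- The Laplacian of `u` at `x`. -/
noncomputable def lap {N : ℕ} {F : Type*} [NormedAddCommGroup F] [NormedSpace ℝ F]
    (u : EuclideanSpace ℝ (Fin N) → F) (x : EuclideanSpace ℝ (Fin N)) : F :=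
  ∑ i, pd (pd u i) i x

/-- The operator `Ãu = Δu + b|x|^{α-2}(1+|x|^α)⁻¹ x·∇u - c|x|^β(1+|x|^α)⁻¹ u`. -/
noncomputable def opAtilde {N : ℕ} (α β b c : ℝ) (u : EuclideanSpace ℝ (Fin N) → ℝ)
    (x : EuclideanSpace ℝ (Fin N)) : ℝ :=
  lap u x + b * ‖x‖ ^ (α - 2) * (1 + ‖x‖ ^ α)⁻¹ * (∑ i, x i * pd u i x)
    - c * ‖x‖ ^ β * (1 + ‖x‖ ^ α)⁻¹ * u x

namespace S4
variable {N : ℕ}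

local notation "E" => EuclideanSpace ℝ (Fin N)

/-- truncated paraboloid power -/
noncomputable def eta (x0 : E) (R : ℝ) (k : ℕ) (x : E) : ℝ :=
  (max (1 - ‖x - x0‖ ^ 2 / R ^ 2) 0) ^ k

lemma hasDerivAt_maxpow (k : ℕ) (hk : 2 ≤ k) (t : ℝ) :
    HasDerivAt (fun t : ℝ => (max t 0) ^ k) (k * (max t 0) ^ (k - 1)) t := by
  have hk0 : k ≠ 0 := by omega
  have hk1 : k - 1 ≠ 0 := by omega
  rcases lt_trichotomy t 0 with h | h | h
  · have : (fun t : ℝ => (max t 0) ^ k) =ᶠ[nhds t] fun _ => 0 := by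
      filter_upwards [gt_mem_nhds h] with s hs
      rw [max_eq_right hs.le, zero_pow hk0]
    rw [max_eq_right h.le, zero_pow hk1, mul_zero]
    exact (hasDerivAt_const t (0:ℝ)).congr_of_eventuallyEq this
  · subst h
    simp only [max_self, zero_pow hk1, mul_zero]
    rw [hasDerivAt_iff_isLittleO_nhds_zero]
    simp only [zero_add, max_self, zero_pow hk0, sub_zero, smul_zero]
    have h1 : (fun h : ℝ => (max h 0) ^ k) =O[nhds 0] fun h : ℝ => h ^ k := by
      apply Asymptotics.IsBigO.of_bound 1
      filter_upwards with s
      rw [one_mul, norm_pow, norm_pow]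
      apply pow_le_pow_left₀ (norm_nonneg _)
      rw [Real.norm_eq_abs, Real.norm_eq_abs]
      rcases le_total s 0 with h | h
      · simp [max_eq_right h]
      · simp [max_eq_left h]
    refine h1.trans_isLittleO ?_
    have := Asymptotics.isLittleO_pow_pow (𝕜 := ℝ) (show 1 < k by omega)
    simpa using this
  · have : (fun t : ℝ => (max t 0) ^ k) =ᶠ[nhds t] fun t => t ^ k := by
      filter_upwards [lt_mem_nhds h] with s hs
      rw [max_eq_left hs.le]
    rw [max_eq_left h.le]
    exact (hasDerivAt_pow k t).congr_of_eventuallyEq this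

lemma eta_nonneg (x0 : E) (R : ℝ) (k : ℕ) (x : E) : 0 ≤ eta x0 R k x := by
  unfold eta; positivity

lemma eta_le_one (x0 : E) (R : ℝ) (k : ℕ) (x : E) : eta x0 R k x ≤ 1 := by
  unfold eta
  apply pow_le_one₀ (by positivity)
  apply max_le _ zero_le_one
  have : 0 ≤ ‖x - x0‖ ^ 2 / R ^ 2 := by positivity
  linarith

lemma eta_cont (x0 : E) (R : ℝ) (k : ℕ) : Continuous (eta x0 R k) := by
  unfold eta; fun_prop

lemma eta_zero (x0 : E) {R : ℝ} (hR : 0 < R) {k : ℕ} (hk : k ≠ 0) {x : E} (hx : R ≤ ‖x - x0‖) :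
    eta x0 R k x = 0 := by
  unfold eta
  rw [max_eq_right, zero_pow hk]
  have : 1 ≤ ‖x - x0‖ ^ 2 / R ^ 2 := by
    rw [one_le_div (by positivity)]
    gcongr
  linarith

lemma eta_supp (x0 : E) {R : ℝ} (hR : 0 < R) {k : ℕ} (hk : k ≠ 0) :
    HasCompactSupport (eta x0 R k) := by
  apply HasCompactSupport.intro (isCompact_closedBall x0 R)
  intro x hx
  apply eta_zero x0 hR hk
  rw [mem_closedBall, dist_eq_norm] at hx
  linarith

lemma eta_hasFDerivAt (x0 : E) (R : ℝ) (k : ℕ) (hk : 2 ≤ k) (x : E) :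
    HasFDerivAt (eta x0 R k)
      ((k * eta x0 R (k-1) x) • (-((R ^ 2)⁻¹ • ((2:ℕ) • innerSL ℝ (x - x0))))) x := by
  have h1 : HasFDerivAt (fun x : E => 1 - ‖x - x0‖ ^ 2 / R ^ 2)
      (-((R ^ 2)⁻¹ • ((2:ℕ) • innerSL ℝ (x - x0)))) x := by
    have := ((hasFDerivAt_id x).sub_const x0).norm_sq
    have := (this.const_mul ((R^2)⁻¹)).const_sub 1
    simp only [div_eq_inv_mul]
    simpa using this
  exact (hasDerivAt_maxpow k hk _).comp_hasFDerivAt x h1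

lemma eta_diff (x0 : E) (R : ℝ) (k : ℕ) (hk : 2 ≤ k) : Differentiable ℝ (eta x0 R k) :=
  fun x => (eta_hasFDerivAt x0 R k hk x).differentiableAt

lemma eta_pd (x0 : E) (R : ℝ) (k : ℕ) (hk : 2 ≤ k) (i : Fin N) (x : E) :
    pd (eta x0 R k) i x = -(2 * k / R ^ 2) * eta x0 R (k-1) x * (x i - x0 i) := by
  unfold pd
  rw [(eta_hasFDerivAt x0 R k hk x).fderiv]
  simp [EuclideanSpace.inner_single_right]
  ring

lemma eta_pd_cont (x0 : E) (R : ℝ) (k : ℕ) (hk : 2 ≤ k) (i : Fin N) :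
    Continuous (pd (eta x0 R k) i) := by
  have : pd (eta x0 R k) i = _ := funext (eta_pd x0 R k hk i)
  rw [this]
  have := eta_cont x0 R (k-1)
  fun_prop

lemma pd_supp {u : E → ℝ} (hu : HasCompactSupport u) (i : Fin N) : HasCompactSupport (pd u i) := by
  unfold pd
  exact hu.fderiv_apply ℝ (EuclideanSpace.single i 1)

lemma pd_smooth {u : E → ℝ} (hu : ContDiff ℝ (⊤ : ℕ∞) u) (i : Fin N) :
    ContDiff ℝ (⊤ : ℕ∞) (pd u i) := by
  unfold pd
  have h := hu.fderiv_right (m := (⊤ : ℕ∞)) (by simp)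
  exact h.clm_apply contDiff_const

lemma lap_smooth {u : E → ℝ} (hu : ContDiff ℝ (⊤ : ℕ∞) u) : ContDiff ℝ (⊤ : ℕ∞) (lap u) := by
  unfold lap
  exact ContDiff.sum fun i _ => pd_smooth (pd_smooth hu i) i

lemma lap_supp {u : E → ℝ} (hu : HasCompactSupport u) : HasCompactSupport (lap u) := by
  apply HasCompactSupport.intro hu
  intro x hx
  unfold lap
  apply Finset.sum_eq_zero
  intro i _
  have h1 : tsupport (pd (pd u i) i) ⊆ tsupport u := by
    refine (tsupport_fderiv_apply_subset ℝ _).trans ?_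
    exact tsupport_fderiv_apply_subset ℝ _
  exact image_eq_zero_of_notMem_tsupport fun h => hx (h1 h)

lemma pd_comm {u : E → ℝ} (hu : ContDiff ℝ (⊤ : ℕ∞) u) (i j : Fin N) (x : E) :
    pd (pd u i) j x = pd (pd u j) i x := by
  have hs : IsSymmSndFDerivAt ℝ u x :=
    hu.contDiffAt.isSymmSndFDerivAt (by simp; exact WithTop.coe_le_coe.2 (le_top : (2:ℕ∞) ≤ ⊤))
  have hd : DifferentiableAt ℝ (fderiv ℝ u) x :=
    (hu.fderiv_right (m := (⊤ : ℕ∞)) (by simp)).differentiable (by simp) x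
  unfold pd
  rw [fderiv_clm_apply hd (by fun_prop), fderiv_clm_apply hd (by fun_prop)]
  simp
  exact hs.eq _ _

lemma lap_pd {u : E → ℝ} (hu : ContDiff ℝ (⊤ : ℕ∞) u) (i : Fin N) (x : E) :
    lap (pd u i) x = pd (lap u) i x := by
  have h1 : pd (lap u) i x = ∑ j, pd (pd (pd u j) j) i x := by
    unfold pd lap
    rw [fderiv_fun_sum]
    · simp; rfl
    · intro j _
      exact (pd_smooth (pd_smooth hu j) j).differentiable (by simp) x
  rw [h1]
  unfold lap
  apply Finset.sum_congr rfl
  intro j _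
  rw [← pd_comm (pd_smooth hu j)]
  congr 1
  funext y
  exact pd_comm hu i j y

lemma ibp {a v : E → ℝ} (ha : Differentiable ℝ a) (hv : Differentiable ℝ v) (i : Fin N)
    (hac : Continuous (pd a i)) (hvc : Continuous (pd v i)) (hs : HasCompactSupport a) :
    ∫ y, a y * pd v i y = - ∫ y, pd a i y * v y := by
  apply integral_mul_fderiv_eq_neg_fderiv_mul_of_integrable
  · exact (hac.mul hv.continuous).integrable_of_hasCompactSupport ((pd_supp hs i).mul_right)
  · exact (ha.continuous.mul hvc).integrable_of_hasCompactSupport (hs.mul_right)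
  · exact (ha.continuous.mul hv.continuous).integrable_of_hasCompactSupport (hs.mul_right)
  · exact fun x _ => ha x
  · exact fun x _ => hv x

lemma pd_shift {v : E → ℝ} (hv : Differentiable ℝ v) (i : Fin N) (x : E) (t : ℝ) (y : E) :
    pd (fun y => v (x - t • y)) i y = - t * pd v i (x - t • y) := by
  have h1 : HasFDerivAt (fun y : E => x - t • y) (-(t • ContinuousLinearMap.id ℝ E)) y :=
    ((hasFDerivAt_id y).const_smul t).const_sub x
  have := (hv (x - t • y)).hasFDerivAt.comp y h1
  unfold pd
  have h2 : fderiv ℝ (fun y => v (x - t • y)) y = _ := this.fderiv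
  rw [h2]
  simp

lemma ibp_shift {a v : E → ℝ} (ha : Differentiable ℝ a) (hv : Differentiable ℝ v) (i : Fin N)
    (hac : Continuous (pd a i)) (hvc : Continuous (pd v i)) (hs : HasCompactSupport a)
    (x : E) (t : ℝ) :
    t * ∫ y, a y * pd v i (x - t • y) = ∫ y, pd a i y * v (x - t • y) := by
  have hd : Differentiable ℝ (fun y => v (x - t • y)) := hv.comp (by fun_prop)
  have he : pd (fun y => v (x - t • y)) i = _ := funext (pd_shift hv i x t)
  have := ibp ha hd i hac (by rw [he]; fun_prop) hs
  rw [he] at this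
  have h2 : ∫ y, a y * (-t * pd v i (x - t • y)) = -(t * ∫ y, a y * pd v i (x - t • y)) := by
    rw [← integral_const_mul, ← integral_neg]
    congr 1; funext y; ring
  rw [h2] at this
  linarith

end S4

namespace S4
variable {N : ℕ}

local notation "E" => EuclideanSpace ℝ (Fin N)

lemma fderiv_apply_sum (v : E → ℝ) (z y : E) : fderiv ℝ v z y = ∑ j, y j * pd v j z := by
  unfold pd
  conv_lhs => rw [← (EuclideanSpace.basisFun (Fin N) ℝ).sum_repr y]
  simp

lemma psi_pd (i : Fin N) (y : E) :
    pd (eta (0:E) 1 3) i y = - (y i * (6 * eta (0:E) 1 2 y)) := by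
  rw [eta_pd _ _ _ (by norm_num)]
  simp
  ring

lemma hasDerivAt_avg {v : E → ℝ} (hv : ContDiff ℝ (⊤ : ℕ∞) v) (hs : HasCompactSupport v)
    (x : E) (t : ℝ) :
    HasDerivAt (fun t : ℝ => ∫ y, (6 * eta (0:E) 1 2 y) * v (x - t • y))
      (t * ∫ y, eta (0:E) 1 3 y * lap v (x - t • y)) t := by
  have hvd : Differentiable ℝ v := hv.differentiable (by simp)
  have hc2 := eta_cont (0:E) 1 2
  have hc3 := eta_cont (0:E) 1 3
  have hpc : ∀ j, Continuous (pd v j) := fun j => (pd_smooth hv j).continuous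
  have hppc : ∀ j, Continuous (pd (pd v j) j) := fun j => (pd_smooth (pd_smooth hv j) j).continuous
  have hs2 : HasCompactSupport (eta (0:E) 1 2) := eta_supp _ one_pos (by norm_num)
  have hs3 : HasCompactSupport (eta (0:E) 1 3) := eta_supp _ one_pos (by norm_num)
  have hfc : Continuous (fderiv ℝ v) := hv.continuous_fderiv (by simp)
  obtain ⟨M, hM⟩ := (hs.fderiv (𝕜 := ℝ)).exists_bound_of_continuous hfc
  have key := hasDerivAt_integral_of_dominated_loc_of_deriv_le (μ := (volume : Measure E))
    (F := fun (t : ℝ) (y : E) => (6 * eta (0:E) 1 2 y) * v (x - t • y))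
    (F' := fun (t : ℝ) (y : E) => (6 * eta (0:E) 1 2 y) * fderiv ℝ v (x - t • y) (-y))
    (x₀ := t) (s := Set.univ) (bound := fun y => (6 * eta (0:E) 1 2 y) * (M * ‖y‖))
    Filter.univ_mem ?_ ?_ ?_ ?_ ?_ ?_
  · suffices hE : (t * ∫ y, eta (0:E) 1 3 y * lap v (x - t • y)) =
        ∫ y, (6 * eta (0:E) 1 2 y) * fderiv ℝ v (x - t • y) (-y) by
      rw [hE]; exact key.2
    have e1 : ∀ y : E, (6 * eta (0:E) 1 2 y) * fderiv ℝ v (x - t • y) (-y)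
        = ∑ j, pd (eta (0:E) 1 3) j y * pd v j (x - t • y) := by
      intro y
      rw [fderiv_apply_sum, Finset.mul_sum]
      apply Finset.sum_congr rfl
      intro j _
      rw [psi_pd]
      simp
      ring
    refine Eq.trans ?_ (integral_congr_ae (Filter.Eventually.of_forall e1)).symm
    rw [integral_finsetSum]
    · simp_rw [lap, Finset.mul_sum]
      rw [integral_finsetSum, Finset.mul_sum]
      · apply Finset.sum_congr rfl
        intro j _
        exact ibp_shift (eta_diff _ _ _ (by norm_num)) ((pd_smooth hv j).differentiable (by simp)) j
          (eta_pd_cont _ _ _ (by norm_num) j) (hppc j) hs3 x t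
      · intro j _
        have := hppc j
        exact Continuous.integrable_of_hasCompactSupport (by fun_prop) hs3.mul_right
    · intro j _
      have := hpc j
      have := eta_pd_cont (0:E) 1 3 (by norm_num) j
      exact Continuous.integrable_of_hasCompactSupport (by fun_prop) (pd_supp hs3 j).mul_right
  · filter_upwards with s
    have := hv.continuous
    exact Continuous.aestronglyMeasurable (by fun_prop)
  · have := hv.continuous
    exact Continuous.integrable_of_hasCompactSupport (by fun_prop) (hs2.mul_left.mul_right)
  · exact Continuous.aestronglyMeasurable (by fun_prop)
  · filter_upwards with y s _
    rw [norm_mul, Real.norm_of_nonneg (by have := eta_nonneg (0:E) 1 2 y; positivity)]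
    have := eta_nonneg (0:E) 1 2 y
    gcongr
    refine (ContinuousLinearMap.le_opNorm _ _).trans ?_
    rw [norm_neg]
    gcongr
    exact hM _
  · exact Continuous.integrable_of_hasCompactSupport (by fun_prop) (hs2.mul_left.mul_right)
  · filter_upwards with y s _
    have h1 : HasDerivAt (fun s : ℝ => x - s • y) (-y) s := by
      simpa using ((hasDerivAt_id s).smul_const y).const_sub x
    exact ((hvd (x - s • y)).hasFDerivAt.comp_hasDerivAt s h1).const_mul _

lemma cont_avg {a h : E → ℝ} (ha : Continuous a) (hs : HasCompactSupport a) (hh : Continuous h)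
    (hhs : HasCompactSupport h) (x : E) :
    Continuous (fun t : ℝ => ∫ y, a y * h (x - t • y)) := by
  obtain ⟨M, hM⟩ := hhs.exists_bound_of_continuous hh
  apply continuous_of_dominated (bound := fun y => ‖a y‖ * M)
  · intro t
    exact Continuous.aestronglyMeasurable (by fun_prop)
  · intro t
    filter_upwards with y
    rw [norm_mul]
    gcongr
    exact hM _
  · exact Continuous.integrable_of_hasCompactSupport (by fun_prop) hs.norm.mul_right
  · filter_upwards with y
    fun_prop

/-- representation formula for the partial derivatives -/
lemma pd_repr {u : E → ℝ} (hu : ContDiff ℝ (⊤ : ℕ∞) u) (hs : HasCompactSupport u)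
    (i : Fin N) (x : E) (s : ℝ) (hs0 : 0 < s) :
    (∫ y, 6 * eta (0:E) 1 2 y) * pd u i x =
      s⁻¹ * (∫ y, (6 * pd (eta (0:E) 1 2) i y) * u (x - s • y))
      - ∫ t in (0:ℝ)..s, ∫ y, pd (eta (0:E) 1 3) i y * lap u (x - t • y) := by
  have hv := pd_smooth hu i
  have hvs := pd_supp hs i
  have hd := fun t (_ : t ∈ Set.uIcc 0 s) => hasDerivAt_avg hv hvs x t
  have hs2 : HasCompactSupport (eta (0:E) 1 2) := eta_supp _ one_pos (by norm_num)
  have hs3 : HasCompactSupport (eta (0:E) 1 3) := eta_supp _ one_pos (by norm_num)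
  have e1 : ∀ t : ℝ, (t * ∫ y, eta (0:E) 1 3 y * lap (pd u i) (x - t • y))
      = ∫ y, pd (eta (0:E) 1 3) i y * lap u (x - t • y) := by
    intro t
    rw [← ibp_shift (eta_diff _ _ _ (by norm_num)) ((lap_smooth hu).differentiable (by simp)) i
          (eta_pd_cont _ _ _ (by norm_num) i) (pd_smooth (lap_smooth hu) i).continuous hs3 x t]
    simp_rw [lap_pd hu i]
  simp_rw [e1] at hd
  have key := intervalIntegral.integral_eq_sub_of_hasDerivAt hd
    ((cont_avg (eta_pd_cont _ _ _ (by norm_num) i) (pd_supp hs3 i) (lap_smooth hu).continuous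
      (lap_supp hs) x).intervalIntegrable _ _)
  rw [key]
  have e2 := ibp_shift (a := eta (0:E) 1 2) (eta_diff _ _ _ (by norm_num))
    (hu.differentiable (by simp)) i
    (eta_pd_cont _ _ _ (by norm_num) i) hv.continuous hs2 x s
  simp_rw [mul_assoc]
  rw [integral_const_mul, integral_const_mul, integral_const_mul, integral_const_mul, ← e2]
  simp only [zero_smul, sub_zero]
  rw [integral_mul_const]
  field_simp
  ring

/-- Minkowski-type bound for averages of translates -/
lemma avg_lintegral_bound {Y : Type*} [MeasurableSpace Y] (μ : Measure Y) [IsFiniteMeasure μ]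
    (τ : Y → E) (hτ : Measurable τ) (s : ℝ) (hτs : ∀ᵐ y ∂μ, ‖τ y‖ ≤ s) (h : E → ℝ)
    (hh : Continuous h) (x0 : E) (r : ℝ) (q : ℝ) (hq : 1 ≤ q) :
    ∫⁻ x in ball x0 r, (∫⁻ y, ‖h (x - τ y)‖ₑ ∂μ) ^ q ≤
      (μ Set.univ) ^ q * ∫⁻ x in ball x0 (r + s), ‖h x‖ₑ ^ q := by
  have hq0 : 0 < q := by linarith
  have h1 : ∀ x : E, (∫⁻ y, ‖h (x - τ y)‖ₑ ∂μ) ^ q ≤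
      (μ Set.univ) ^ (q - 1) * ∫⁻ y, ‖h (x - τ y)‖ₑ ^ q ∂μ := by
    intro x
    have hm : AEStronglyMeasurable (fun y => h (x - τ y)) μ :=
      (hh.measurable.comp (measurable_const.sub hτ)).aestronglyMeasurable
    have := eLpNorm'_le_eLpNorm'_mul_rpow_measure_univ (p := 1) (q := q) one_pos hq hm
    rw [eLpNorm'_eq_lintegral_enorm, eLpNorm'_eq_lintegral_enorm] at this
    simp only [ENNReal.rpow_one, div_one] at this
    calc _ ≤ _ := ENNReal.rpow_le_rpow this hq0.le
      _ = _ := by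
        rw [ENNReal.mul_rpow_of_nonneg _ _ hq0.le, ← ENNReal.rpow_mul, ← ENNReal.rpow_mul,
          mul_comm]
        congr 2
        · field_simp
        · rw [one_div_mul_cancel hq0.ne', ENNReal.rpow_one]
  have hmeas : Measurable (fun z : E × Y => ‖h (z.1 - τ z.2)‖ₑ ^ q) := by
    have := hh.measurable
    fun_prop
  calc ∫⁻ x in ball x0 r, (∫⁻ y, ‖h (x - τ y)‖ₑ ∂μ) ^ q
      ≤ ∫⁻ x in ball x0 r, (μ Set.univ) ^ (q - 1) * ∫⁻ y, ‖h (x - τ y)‖ₑ ^ q ∂μ :=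
        lintegral_mono h1
    _ = (μ Set.univ) ^ (q - 1) * ∫⁻ x in ball x0 r, ∫⁻ y, ‖h (x - τ y)‖ₑ ^ q ∂μ := by
        rw [lintegral_const_mul]
        exact hmeas.lintegral_prod_right'
    _ = (μ Set.univ) ^ (q - 1) * ∫⁻ y, ∫⁻ x in ball x0 r, ‖h (x - τ y)‖ₑ ^ q ∂volume ∂μ := by
        rw [lintegral_lintegral_swap]
        exact hmeas.aemeasurable
    _ ≤ (μ Set.univ) ^ (q - 1) * ∫⁻ y, (∫⁻ x in ball x0 (r + s), ‖h x‖ₑ ^ q) ∂μ := by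
        refine mul_le_mul_right ?_ _
        apply lintegral_mono_ae
        filter_upwards [hτs] with y hy
        rw [← lintegral_indicator measurableSet_ball, ← lintegral_indicator measurableSet_ball]
        rw [← lintegral_sub_right_eq_self (μ := (volume : Measure E))
          (fun x => (ball x0 (r + s)).indicator (fun x => ‖h x‖ₑ ^ q) x) (τ y)]
        apply lintegral_mono
        intro x
        by_cases hx : x ∈ ball x0 r
        · have : x - τ y ∈ ball x0 (r + s) := by
            rw [mem_ball, dist_eq_norm] at hx ⊢
            calc ‖x - τ y - x0‖ = ‖(x - x0) - τ y‖ := by congr 1; abel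
              _ ≤ ‖x - x0‖ + ‖τ y‖ := norm_sub_le _ _
              _ < r + s := by linarith
          simp only [Set.indicator_of_mem hx, Set.indicator_of_mem this]
          exact le_rfl
        · simp [Set.indicator_of_notMem hx]
    _ = _ := by
        rw [lintegral_const, mul_comm (∫⁻ x in ball x0 (r + s), ‖h x‖ₑ ^ q), ← mul_assoc]
        congr 1
        rcases eq_or_ne (μ Set.univ) 0 with h0 | h0
        · rw [h0, mul_zero, ENNReal.zero_rpow_of_pos hq0]
        conv_lhs => rw [← ENNReal.rpow_one (μ Set.univ), ← ENNReal.rpow_mul, one_mul]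
        rw [← ENNReal.rpow_add _ _ h0 (measure_ne_top _ _)]
        congr 1; ring

end S4

namespace S4
variable {N : ℕ}

local notation "E" => EuclideanSpace ℝ (Fin N)

lemma abs_coord_le (y : E) (i : Fin N) : |y i| ≤ ‖y‖ := by
  have := PiLp.norm_apply_le y i
  simpa using this

lemma avg_eLpNorm {Y : Type*} [MeasurableSpace Y] (μ : Measure Y) [IsFiniteMeasure μ]
    (τ : Y → E) (hτ : Measurable τ) (s : ℝ) (hτs : ∀ᵐ y ∂μ, ‖τ y‖ ≤ s) (h : E → ℝ)
    (hh : Continuous h) (x0 : E) (r : ℝ) (p : ℝ≥0∞) (hp : 1 ≤ p) (hp2 : p ≠ ⊤) (c : ℝ≥0∞) :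
    eLpNorm (fun x => c * ∫⁻ y, ‖h (x - τ y)‖ₑ ∂μ) p (volume.restrict (ball x0 r)) ≤
      c * μ Set.univ * eLpNorm h p (volume.restrict (ball x0 (r + s))) := by
  have hp0 : p ≠ 0 := (zero_lt_one.trans_le hp).ne'
  have hq : 1 ≤ p.toReal := by
    rw [← ENNReal.toReal_one]; exact ENNReal.toReal_mono hp2 hp
  have hq0 : 0 < p.toReal := by linarith
  rw [eLpNorm_eq_lintegral_rpow_enorm_toReal hp0 hp2, eLpNorm_eq_lintegral_rpow_enorm_toReal hp0 hp2]
  have hm : Measurable fun x : E => (∫⁻ y, ‖h (x - τ y)‖ₑ ∂μ) ^ p.toReal := by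
    apply Measurable.pow_const
    have : Measurable (fun z : E × Y => ‖h (z.1 - τ z.2)‖ₑ) := by
      have := hh.measurable
      fun_prop
    exact this.lintegral_prod_right'
  have h1 := avg_lintegral_bound μ τ hτ s hτs h hh x0 r p.toReal hq
  simp only [enorm_eq_self, ENNReal.mul_rpow_of_nonneg _ _ hq0.le]
  rw [lintegral_const_mul _ hm]
  calc _ ≤ (c ^ p.toReal * ((μ Set.univ) ^ p.toReal *
        ∫⁻ x in ball x0 (r + s), ‖h x‖ₑ ^ p.toReal)) ^ (1 / p.toReal) := by gcongr
    _ = _ := by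
      rw [ENNReal.mul_rpow_of_nonneg _ _ (by positivity),
        ENNReal.mul_rpow_of_nonneg _ _ (by positivity), ← ENNReal.rpow_mul, ← ENNReal.rpow_mul,
        mul_one_div_cancel hq0.ne', ENNReal.rpow_one, ENNReal.rpow_one, mul_assoc]

lemma ker_bound (a h : E → ℝ) (M : ℝ) (ha : ∀ y, |a y| ≤ M) (ha0 : ∀ y, 1 < ‖y‖ → a y = 0) :
    ∫⁻ y, ‖a y * h y‖ₑ ≤ ENNReal.ofReal M * ∫⁻ y in closedBall (0:E) 1, ‖h y‖ₑ := by
  rw [← lintegral_const_mul' _ _ ENNReal.ofReal_ne_top,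
    ← lintegral_indicator measurableSet_closedBall]
  apply lintegral_mono
  intro y
  by_cases hy : y ∈ closedBall (0:E) 1
  · simp only [Set.indicator_of_mem hy]
    rw [enorm_mul]
    gcongr
    rw [Real.enorm_eq_ofReal_abs]
    exact ENNReal.ofReal_le_ofReal (ha y)
  · rw [mem_closedBall_zero_iff, not_le] at hy
    simp [ha0 y hy]

lemma phi_pd_bound (i : Fin N) (y : E) : |6 * pd (eta (0:E) 1 2) i y| ≤ 24 := by
  rw [eta_pd _ _ _ le_rfl]
  rcases le_total ‖y‖ 1 with h | h
  · have h1 := (abs_coord_le y i).trans h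
    have h2 := eta_nonneg (0:E) 1 1 y
    have h3 := eta_le_one (0:E) 1 1 y
    have : |6 * (-(2 * (2:ℕ) / (1:ℝ) ^ 2) * eta (0:E) 1 (2 - 1) y * (y i - (0:E) i))|
        = 24 * (eta (0:E) 1 1 y * |y i|) := by
      simp [abs_mul, abs_of_nonneg h2]; ring
    rw [this]
    nlinarith [mul_le_mul h3 h1 (abs_nonneg _) zero_le_one]
  · rw [eta_zero _ one_pos (by norm_num) (by simpa using h)]
    norm_num

lemma psi_pd_bound (i : Fin N) (y : E) : |pd (eta (0:E) 1 3) i y| ≤ 24 := by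
  rw [psi_pd]
  rcases le_total ‖y‖ 1 with h | h
  · have h1 := (abs_coord_le y i).trans h
    have h2 := eta_nonneg (0:E) 1 2 y
    have h3 := eta_le_one (0:E) 1 2 y
    have : |-(y i * (6 * eta (0:E) 1 2 y))|
        = 6 * (eta (0:E) 1 2 y * |y i|) := by
      simp [abs_mul, abs_of_nonneg h2]; ring
    rw [this]
    nlinarith [mul_le_mul h3 h1 (abs_nonneg _) zero_le_one]
  · rw [eta_zero _ one_pos (by norm_num) (by simpa using h)]
    norm_num

lemma phi_int_pos : 0 < ∫ y, 6 * eta (0:E) 1 2 y := by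
  have hs2 : HasCompactSupport (eta (0:E) 1 2) := eta_supp _ one_pos (by norm_num)
  apply Continuous.integral_pos_of_hasCompactSupport_nonneg_nonzero (x := (0:E))
  · have := eta_cont (0:E) 1 2
    fun_prop
  · exact hs2.mul_left
  · intro y
    have := eta_nonneg (0:E) 1 2 y
    simp only [Pi.zero_apply]
    positivity
  · simp [eta]

lemma grad_est (N : ℕ) (p : ℝ≥0∞) (hp : 1 ≤ p) (hp2 : p ≠ ⊤) :
    ∃ K : ℝ, 0 < K ∧ ∀ (x0 : EuclideanSpace ℝ (Fin N)) (r s : ℝ), 0 < s →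
      ∀ u : EuclideanSpace ℝ (Fin N) → ℝ, ContDiff ℝ (⊤ : ℕ∞) u → HasCompactSupport u →
      ∀ i : Fin N, eLpNorm (pd u i) p (volume.restrict (ball x0 r)) ≤
        ENNReal.ofReal (K / s) * eLpNorm u p (volume.restrict (ball x0 (r + s))) +
        ENNReal.ofReal (K * s) * eLpNorm (lap u) p (volume.restrict (ball x0 (r + s))) := by
  set m := ∫ y, 6 * eta (0:EuclideanSpace ℝ (Fin N)) 1 2 y with hm
  have hm0 : 0 < m := phi_int_pos
  set ω := (volume : Measure (EuclideanSpace ℝ (Fin N))) (closedBall 0 1) with hω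
  have hωt : ω ≠ ⊤ := measure_closedBall_lt_top.ne
  have hω0 : ω ≠ 0 := (measure_closedBall_pos _ _ one_pos).ne'
  have hω1 : 0 < ω.toReal := ENNReal.toReal_pos hω0 hωt
  refine ⟨24 * m⁻¹ * ω.toReal, by positivity, ?_⟩
  intro x0 r s hs u hu hus i
  have hlc := (lap_smooth hu).continuous
  have huc := hu.continuous
  set μ1 : Measure (EuclideanSpace ℝ (Fin N)) := volume.restrict (closedBall 0 1) with hμ1
  have : IsFiniteMeasure μ1 := ⟨by rw [hμ1, Measure.restrict_apply_univ]; exact hωt.lt_top⟩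
  set μ2 : Measure ℝ := volume.restrict (Set.Ioc 0 s) with hμ2
  set f1 : EuclideanSpace ℝ (Fin N) → ℝ≥0∞ := fun x =>
    ENNReal.ofReal (24 * m⁻¹ / s) * ∫⁻ y, ‖u (x - s • y)‖ₑ ∂μ1 with hf1
  set f2 : EuclideanSpace ℝ (Fin N) → ℝ≥0∞ := fun x =>
    ENNReal.ofReal (24 * m⁻¹) * ∫⁻ z, ‖lap u (x - z.1 • z.2)‖ₑ ∂(μ2.prod μ1) with hf2
  have b1 : eLpNorm f1 p (volume.restrict (ball x0 r)) ≤ _ :=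
    avg_eLpNorm μ1 (fun y => s • y) (by fun_prop) s (by
      filter_upwards [ae_restrict_mem measurableSet_closedBall] with y hy
      rw [mem_closedBall_zero_iff] at hy
      rw [norm_smul, Real.norm_of_nonneg hs.le]
      nlinarith) u huc x0 r p hp hp2 _
  have b2 : eLpNorm f2 p (volume.restrict (ball x0 r)) ≤ _ :=
    avg_eLpNorm (μ2.prod μ1) (fun z => z.1 • z.2) (by fun_prop) s (by
      rw [hμ2, hμ1, Measure.prod_restrict]
      filter_upwards [ae_restrict_mem (measurableSet_Ioc.prod measurableSet_closedBall)] with z hz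
      have h1 := hz.1
      have h2 := hz.2
      rw [mem_closedBall_zero_iff] at h2
      rw [norm_smul, Real.norm_of_nonneg h1.1.le]
      nlinarith [h1.1, h1.2, norm_nonneg z.2]) (lap u) hlc x0 r p hp hp2 _
  have u1 : μ1 Set.univ = ω := by rw [hμ1, Measure.restrict_apply_univ]
  have u2 : (μ2.prod μ1) Set.univ = ENNReal.ofReal s * ω := by
    rw [← Set.univ_prod_univ, Measure.prod_prod, u1, hμ2, Measure.restrict_apply_univ]
    simp
  rw [u1] at b1
  rw [u2] at b2
  have hpt : ∀ x, ‖pd u i x‖ₑ ≤ ‖(f1 + f2) x‖ₑ := by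
    intro x
    rw [enorm_eq_self, Pi.add_apply]
    have hrep := pd_repr hu hus i x s hs
    have e : pd u i x = m⁻¹ * (s⁻¹ * (∫ y, (6 * pd (eta 0 1 2) i y) * u (x - s • y))) -
        m⁻¹ * ∫ t in (0:ℝ)..s, ∫ y, pd (eta 0 1 3) i y * lap u (x - t • y) := by
      rw [← mul_sub, ← hrep, inv_mul_cancel_left₀ hm0.ne']
    rw [e]
    refine (enorm_sub_le).trans (add_le_add ?_ ?_)
    · rw [enorm_mul, enorm_mul]
      have h1 := (enorm_integral_le_lintegral_enorm (μ := volume)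
        (fun y => (6 * pd (eta 0 1 2) i y) * u (x - s • y))).trans
        (ker_bound _ (fun y => u (x - s • y)) 24 (phi_pd_bound i) (by
          intro y hy
          rw [eta_pd _ _ _ le_rfl, eta_zero _ one_pos (by norm_num) (by simpa using hy.le)]
          simp))
      rw [Real.enorm_of_nonneg (by positivity), Real.enorm_of_nonneg (by positivity)]
      calc _ ≤ _ := mul_le_mul_right (mul_le_mul_right h1 _) _
        _ = _ := by
          rw [hf1, ← mul_assoc, ← mul_assoc, ← ENNReal.ofReal_mul (by positivity),
            ← ENNReal.ofReal_mul (by positivity)]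
          congr 2
          field_simp
    · rw [enorm_mul, Real.enorm_of_nonneg (by positivity), intervalIntegral.integral_of_le hs.le]
      have h1 : ‖∫ t in Set.Ioc (0:ℝ) s, ∫ y, pd (eta 0 1 3) i y * lap u (x - t • y)‖ₑ ≤
          ENNReal.ofReal 24 * ∫⁻ z, ‖lap u (x - z.1 • z.2)‖ₑ ∂(μ2.prod μ1) := by
        refine (enorm_integral_le_lintegral_enorm _).trans ?_
        rw [lintegral_prod _ (by
          apply Measurable.aemeasurable
          have := hlc.measurable
          fun_prop), ← lintegral_const_mul' _ _ ENNReal.ofReal_ne_top]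
        apply lintegral_mono
        intro t
        exact (enorm_integral_le_lintegral_enorm (μ := volume)
          (fun y => (pd (eta 0 1 3) i y) * lap u (x - t • y))).trans
          (ker_bound _ (fun y => lap u (x - t • y)) 24 (psi_pd_bound i) (by
            intro y hy
            rw [psi_pd, eta_zero _ one_pos (by norm_num) (by simpa using hy.le)]
            simp))
      calc _ ≤ _ := mul_le_mul_right h1 _
        _ = _ := by
          rw [hf2, ← mul_assoc, ← ENNReal.ofReal_mul (by positivity)]
          congr 2
          ring
  have m1 : Measurable f1 := by
    apply Measurable.const_mul
    have : Measurable (fun z : EuclideanSpace ℝ (Fin N) × EuclideanSpace ℝ (Fin N) =>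
      ‖u (z.1 - s • z.2)‖ₑ) := by
      have := huc.measurable
      fun_prop
    exact this.lintegral_prod_right'
  have m2 : Measurable f2 := by
    apply Measurable.const_mul
    have : Measurable (fun z : EuclideanSpace ℝ (Fin N) × (ℝ × EuclideanSpace ℝ (Fin N)) =>
      ‖lap u (z.1 - z.2.1 • z.2.2)‖ₑ) := by
      have := hlc.measurable
      fun_prop
    exact this.lintegral_prod_right'
  refine (eLpNorm_mono_enorm hpt).trans ((eLpNorm_add_le m1.aestronglyMeasurable
    m2.aestronglyMeasurable hp).trans (add_le_add (b1.trans_eq ?_) (b2.trans_eq ?_)))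
  · congr 1
    rw [← ENNReal.ofReal_toReal hωt, ← ENNReal.ofReal_mul (by positivity),
      ENNReal.toReal_ofReal (by positivity)]
    congr 1
    field_simp
  · congr 1
    rw [← ENNReal.ofReal_toReal hωt, ← ENNReal.ofReal_mul (by positivity),
      ← ENNReal.ofReal_mul (by positivity), ENNReal.toReal_ofReal (by positivity)]
    congr 1
    ring

end S4

namespace S4
variable {N : ℕ}

local notation "E" => EuclideanSpace ℝ (Fin N)

lemma pd_mul {a b : E → ℝ} {x : E} (ha : DifferentiableAt ℝ a x) (hb : DifferentiableAt ℝ b x)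
    (i : Fin N) : pd (fun x => a x * b x) i x = pd a i x * b x + a x * pd b i x := by
  unfold pd
  rw [fderiv_fun_mul ha hb]
  simp
  ring

lemma pd_comp {g : ℝ → ℝ} {g' : ℝ} {u : E → ℝ} {x : E} (hg : HasDerivAt g g' (u x))
    (hu : DifferentiableAt ℝ u x) (i : Fin N) : pd (fun x => g (u x)) i x = g' * pd u i x := by
  unfold pd
  have : fderiv ℝ (fun x => g (u x)) x = _ := (hg.comp_hasFDerivAt x hu.hasFDerivAt).fderiv
  rw [this]
  simp

lemma ibp_zero {u Ψ : E → ℝ} (hu : ContDiff ℝ (⊤ : ℕ∞) u) (hΨ : Differentiable ℝ Ψ)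
    (hc : ∀ i, Continuous (pd Ψ i)) (hs : HasCompactSupport Ψ) :
    Integrable (fun x => ∑ i, (pd (pd u i) i x * Ψ x + pd u i x * pd Ψ i x)) ∧
    ∫ x, ∑ i, (pd (pd u i) i x * Ψ x + pd u i x * pd Ψ i x) = 0 := by
  have h1 : ∀ i, Integrable (fun x => pd (pd u i) i x * Ψ x) := fun i =>
    ((pd_smooth (pd_smooth hu i) i).continuous.mul hΨ.continuous).integrable_of_hasCompactSupport
      hs.mul_left
  have h2 : ∀ i, Integrable (fun x => pd u i x * pd Ψ i x) := fun i =>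
    ((pd_smooth hu i).continuous.mul (hc i)).integrable_of_hasCompactSupport (pd_supp hs i).mul_left
  have h3 : ∀ i, Integrable (fun x => pd (pd u i) i x * Ψ x + pd u i x * pd Ψ i x) := fun i =>
    (h1 i).add (h2 i)
  refine ⟨integrable_finsetSum _ fun i _ => h3 i, ?_⟩
  rw [integral_finsetSum _ fun i _ => h3 i]
  apply Finset.sum_eq_zero
  intro i _
  rw [integral_add (h1 i) (h2 i)]
  have := ibp hΨ ((pd_smooth hu i).differentiable (by simp)) i (hc i)
    (pd_smooth (pd_smooth hu i) i).continuous hs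
  simp_rw [mul_comm (pd (pd u i) i _), mul_comm (pd u i _)]
  rw [this]
  ring

/-- regularised multiplier -/
noncomputable def mreg (P δ t : ℝ) : ℝ := (t ^ 2 + δ) ^ ((P - 2) / 2) * t

lemma mreg_deriv (P : ℝ) {δ : ℝ} (hδ : 0 < δ) (t : ℝ) :
    HasDerivAt (mreg P δ)
      ((t ^ 2 + δ) ^ ((P - 2) / 2) * ((P - 2) * (t ^ 2 / (t ^ 2 + δ)) + 1)) t := by
  have hQ : 0 < t ^ 2 + δ := by positivity
  have h1 : HasDerivAt (fun t : ℝ => t ^ 2 + δ) (2 * t) t := by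
    simpa using (hasDerivAt_pow 2 t).add_const δ
  have h2 := (h1.rpow_const (p := (P - 2) / 2) (Or.inl hQ.ne')).mul (hasDerivAt_id t)
  have h3 : HasDerivAt (mreg P δ) _ t := h2
  convert h3 using 1
  rw [Real.rpow_sub_one hQ.ne']
  simp only [id]
  field_simp

lemma mreg_deriv_lb (P : ℝ) {δ : ℝ} (hδ : 0 < δ) (t : ℝ) :
    min 1 (P - 1) * (t ^ 2 + δ) ^ ((P - 2) / 2) ≤
      (t ^ 2 + δ) ^ ((P - 2) / 2) * ((P - 2) * (t ^ 2 / (t ^ 2 + δ)) + 1) := by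
  have hQ : 0 < t ^ 2 + δ := by positivity
  rw [mul_comm]
  gcongr
  have h1 : 0 ≤ t ^ 2 / (t ^ 2 + δ) := by positivity
  have h2 : t ^ 2 / (t ^ 2 + δ) ≤ 1 := by
    rw [div_le_one hQ]; linarith
  rcases le_total P 2 with h | h
  · rw [min_eq_right (by linarith)]
    nlinarith
  · rw [min_eq_left (by linarith)]
    nlinarith

lemma mreg_abs_le (P : ℝ) {δ : ℝ} (hδ : 0 < δ) (t : ℝ) :
    |mreg P δ t| ≤ (t ^ 2 + δ) ^ ((P - 1) / 2) := by
  have hQ : 0 < t ^ 2 + δ := by positivity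
  unfold mreg
  rw [abs_mul, abs_of_pos (by positivity)]
  have h1 : |t| ≤ (t ^ 2 + δ) ^ ((1:ℝ) / 2) := by
    rw [← Real.sqrt_eq_rpow]
    exact Real.abs_le_sqrt (by linarith)
  calc _ ≤ (t ^ 2 + δ) ^ ((P - 2) / 2) * (t ^ 2 + δ) ^ ((1:ℝ) / 2) := by gcongr
    _ = _ := by rw [← Real.rpow_add hQ]; congr 1; ring

/-- pointwise Cauchy inequality -/
lemma cauchy_pt {κ C1 S Q ω e d t m' D : ℝ} (hκ : 0 < κ) (hS : 0 ≤ S) (hω : 0 ≤ ω)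
    (htQ : t ^ 2 ≤ Q) (hm' : κ * S ≤ m') (hD : |D| ≤ C1 * ω * e) :
    -(d ^ 2 * m' * (ω * e ^ 2)) + S * t * d * D ≤ C1 ^ 2 / (4 * κ) * (S * Q * ω) := by
  have h1 : S * t * d * D ≤ S * |t| * |d| * (C1 * ω * e) := by
    calc _ ≤ |S * t * d * D| := le_abs_self _
      _ = S * |t| * |d| * |D| := by rw [abs_mul, abs_mul, abs_mul, abs_of_nonneg hS]
      _ ≤ _ := by gcongr
  have h2 : d ^ 2 * (κ * S) * (ω * e ^ 2) ≤ d ^ 2 * m' * (ω * e ^ 2) := by gcongr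
  have h3 : -(κ * (e * |d|) ^ 2) + C1 * |t| * (e * |d|) ≤ C1 ^ 2 / (4 * κ) * t ^ 2 := by
    have : C1 ^ 2 / (4 * κ) * t ^ 2 - (-(κ * (e * |d|) ^ 2) + C1 * |t| * (e * |d|))
        = κ * (e * |d| - C1 * |t| / (2 * κ)) ^ 2 := by
      rw [← sq_abs t]; field_simp; ring
    have h4 : 0 ≤ κ * (e * |d| - C1 * |t| / (2 * κ)) ^ 2 := by positivity
    linarith
  have h5 : C1 ^ 2 / (4 * κ) * t ^ 2 ≤ C1 ^ 2 / (4 * κ) * Q := by gcongr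
  have h6 := mul_le_mul_of_nonneg_left (h3.trans h5) (mul_nonneg hS hω)
  have h7 : d ^ 2 = |d| ^ 2 := (sq_abs d).symm
  calc _ ≤ -(d ^ 2 * (κ * S) * (ω * e ^ 2)) + S * |t| * |d| * (C1 * ω * e) := by linarith
    _ = S * ω * (-(κ * (e * |d|) ^ 2) + C1 * |t| * (e * |d|)) := by rw [h7]; ring
    _ ≤ _ := h6
    _ = _ := by ring

/-- Young by cases -/
lemma young1 {P a x ε : ℝ} (hP : 1 < P) (ha : 0 ≤ a) (hx : 0 ≤ x) (hε : 0 < ε) :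
    a * x ^ (P - 1) ≤ ε * x ^ P + (ε⁻¹) ^ (P - 1) * a ^ P := by
  have e1 : ∀ y : ℝ, 0 ≤ y → y * y ^ (P - 1) = y ^ P := by
    intro y hy
    rcases hy.eq_or_lt with h | h
    · rw [← h, zero_mul, Real.zero_rpow (by linarith)]
    · rw [Real.rpow_sub_one h.ne']; field_simp
  rcases le_total a (ε * x) with h | h
  · have : a * x ^ (P - 1) ≤ ε * x * x ^ (P - 1) := by gcongr
    rw [mul_assoc, e1 x hx] at this
    have h2 : 0 ≤ (ε⁻¹) ^ (P - 1) * a ^ P := by positivity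
    linarith
  · have h1 : x ≤ ε⁻¹ * a := by
      rw [inv_mul_eq_div, le_div_iff₀ hε]; linarith
    have : a * x ^ (P - 1) ≤ a * (ε⁻¹ * a) ^ (P - 1) := by
      gcongr
    rw [Real.mul_rpow (by positivity) ha, mul_left_comm, e1 a ha] at this
    have h2 : 0 ≤ ε * x ^ P := by positivity
    linarith

lemma young2 {P W e ε : ℝ} {k : ℕ} (hP : 1 < P) (hW : 1 ≤ W) (he : 0 ≤ e) (he1 : e ≤ 1)
    (hε : 0 < ε) (hk : 2 * P ≤ k) (hk2 : 2 < k):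
    W ^ (P - 1) * e ^ (k - 2) ≤ ε * (W ^ P * e ^ k) + (ε⁻¹) ^ (P - 1) := by
  have hW0 : 0 < W := by linarith
  rcases he.eq_or_lt with h0 | h0
  · subst h0
    rw [zero_pow (by omega), zero_pow (by omega)]
    simp
    positivity
  have hk' : e ^ k = e ^ (k - 2) * e ^ 2 := by rw [← pow_add]; congr 1; omega
  rcases le_total 1 (ε * (W * e ^ 2)) with h | h
  · have : W ^ (P - 1) * e ^ (k - 2) * 1 ≤ W ^ (P - 1) * e ^ (k - 2) * (ε * (W * e ^ 2)) := by
      gcongr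
    have h2 : W ^ P = W ^ (P - 1) * W := by rw [Real.rpow_sub_one hW0.ne']; field_simp
    have h3 : 0 ≤ (ε⁻¹) ^ (P - 1) := by positivity
    have h4 : W ^ (P - 1) * e ^ (k - 2) * (ε * (W * e ^ 2)) = ε * (W ^ P * e ^ k) := by
      rw [h2, hk']; ring
    linarith
  · have h1 : W * e ^ 2 ≤ ε⁻¹ := by
      rw [← one_div, le_div_iff₀ hε]; linarith
    have h2 : (W * e ^ 2) ^ (P - 1) ≤ (ε⁻¹) ^ (P - 1) := by gcongr
    have h3 : W ^ (P - 1) * e ^ (k - 2) ≤ (W * e ^ 2) ^ (P - 1) := by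
      rw [Real.mul_rpow hW0.le (by positivity)]
      gcongr
      rw [← Real.rpow_natCast e (k - 2), ← Real.rpow_natCast e 2, ← Real.rpow_mul he]
      apply Real.rpow_le_rpow_of_exponent_ge h0 he1
      rw [Nat.cast_sub (by omega)]
      push_cast
      linarith
    have h4 : 0 ≤ ε * (W ^ P * e ^ k) := by positivity
    linarith

end S4

namespace S4
variable {N : ℕ}

local notation "E" => EuclideanSpace ℝ (Fin N)

/-- `lap u + F·∇u - W u` -/
noncomputable def gop (W : E → ℝ) (Fd : Fin N → E → ℝ) (u : E → ℝ) (x : E) : ℝ :=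
  lap u x + ∑ i, Fd i x * pd u i x - W x * u x

/-- the regularised energy density -/
noncomputable def Hreg (W : E → ℝ) (Fd : Fin N → E → ℝ) (C2 P : ℝ) (k : ℕ) (x0 : E) (R : ℝ)
    (u : E → ℝ) (δ : ℝ) (x : E) : ℝ :=
  W x * W x ^ (P - 1) * eta x0 R 1 x ^ k * (mreg P δ (u x) * u x)
  - N * C2 * ((u x ^ 2 + δ) ^ (P / 2) * (W x ^ (P - 1) * eta x0 R 1 x ^ (k - 2)))
  - |gop W Fd u x| * (u x ^ 2 + δ) ^ ((P - 1) / 2) * (W x ^ (P - 1) * eta x0 R 1 x ^ k)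

lemma eta_pow (x0 : E) (R : ℝ) (k : ℕ) (x : E) : eta x0 R k x = eta x0 R 1 x ^ k := by
  simp [eta]

lemma eta_pd_abs (x0 : E) {R : ℝ} (hR : 1 ≤ R) (k : ℕ) (hk : 2 ≤ k) (i : Fin N) (x : E) :
    |pd (eta x0 R k) i x| ≤ 2 * k * eta x0 R 1 x ^ (k - 1) := by
  rw [eta_pd _ _ _ hk, eta_pow x0 R (k - 1)]
  rcases le_total R ‖x - x0‖ with h | h
  · rw [eta_zero x0 (by linarith) one_ne_zero h, zero_pow (by omega)]
    simp
  · have h1 : |x i - x0 i| ≤ R := (abs_coord_le (x - x0) i).trans h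
    have h2 := eta_nonneg x0 R 1 x
    rw [abs_mul, abs_mul, abs_neg, abs_of_nonneg (by positivity),
      abs_of_nonneg (a := eta x0 R 1 x ^ (k - 1)) (by positivity)]
    calc _ ≤ 2 * k / R ^ 2 * eta x0 R 1 x ^ (k - 1) * R := by gcongr
      _ = 2 * k * eta x0 R 1 x ^ (k - 1) / R := by field_simp
      _ ≤ _ := div_le_self (by positivity) hR

lemma weight_pd {W : E → ℝ} (hWd : Differentiable ℝ W) (hW1 : ∀ x, 1 ≤ W x)
    (P : ℝ) (k : ℕ) (hk : 2 < k) (x0 : E) (R : ℝ) (i : Fin N) (x : E) :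
    pd (fun x => W x ^ (P - 1) * eta x0 R k x) i x =
      ((P - 1) * W x ^ (P - 1 - 1) * pd W i x) * eta x0 R k x
        + W x ^ (P - 1) * pd (eta x0 R k) i x := by
  have hW0 : W x ≠ 0 := by have := hW1 x; positivity
  rw [pd_mul ((hWd x).rpow_const (Or.inl hW0)) (eta_diff x0 R k hk.le x)]
  congr 2
  exact pd_comp (g := fun t => t ^ (P - 1))
    (Real.hasDerivAt_rpow_const (Or.inl hW0)) (hWd x) i

lemma weight_pd_bound {W : E → ℝ} (hWd : Differentiable ℝ W) (hW1 : ∀ x, 1 ≤ W x)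
    {L : ℝ} (hL : 0 ≤ L) (hWL : ∀ i x, |pd W i x| ≤ L * W x)
    {P : ℝ} (hP : 1 < P) {k : ℕ} (hk : 2 < k) (x0 : E) {R : ℝ} (hR : 1 ≤ R) (i : Fin N) (x : E)
    {B F : ℝ} (hF : |F| ≤ B) :
    |F * (W x ^ (P - 1) * eta x0 R k x) - pd (fun x => W x ^ (P - 1) * eta x0 R k x) i x| ≤
      (B + (P - 1) * L + 2 * k) * (W x ^ (P - 1) * eta x0 R 1 x ^ (k - 2)) * eta x0 R 1 x := by
  have hW0 : 0 < W x := by have := hW1 x; positivity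
  have h0 := eta_nonneg x0 R 1 x
  have h1 := eta_le_one x0 R 1 x
  have hB : 0 ≤ B := (abs_nonneg _).trans hF
  rw [weight_pd hWd hW1 P k hk x0 R i x]
  have hek : eta x0 R k x ≤ eta x0 R 1 x ^ (k - 1) := by
    rw [eta_pow]
    exact pow_le_pow_of_le_one h0 h1 (by omega)
  have hek0 := eta_nonneg x0 R k x
  have t1 : |F * (W x ^ (P - 1) * eta x0 R k x)| ≤
      B * (W x ^ (P - 1) * eta x0 R 1 x ^ (k - 1)) := by
    rw [abs_mul, abs_of_nonneg (a := W x ^ (P - 1) * eta x0 R k x) (by positivity)]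
    gcongr
  have t2 : |((P - 1) * W x ^ (P - 1 - 1) * pd W i x) * eta x0 R k x| ≤
      (P - 1) * L * (W x ^ (P - 1) * eta x0 R 1 x ^ (k - 1)) := by
    have hp : 0 ≤ P - 1 := by linarith
    rw [abs_mul, abs_mul, abs_of_nonneg hek0,
      abs_of_nonneg (a := (P - 1) * W x ^ (P - 1 - 1)) (by positivity)]
    calc _ ≤ (P - 1) * W x ^ (P - 1 - 1) * (L * W x) * eta x0 R 1 x ^ (k - 1) := by
          gcongr; exact hWL i x
      _ = _ := by rw [Real.rpow_sub_one hW0.ne' (P - 1)]; field_simp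
  have t3 : |W x ^ (P - 1) * pd (eta x0 R k) i x| ≤
      2 * k * (W x ^ (P - 1) * eta x0 R 1 x ^ (k - 1)) := by
    rw [abs_mul, abs_of_nonneg (a := W x ^ (P - 1)) (by positivity)]
    calc _ ≤ W x ^ (P - 1) * (2 * k * eta x0 R 1 x ^ (k - 1)) := by
          gcongr; exact eta_pd_abs x0 hR k hk.le i x
      _ = _ := by ring
  have e1 : eta x0 R 1 x ^ (k - 1) = eta x0 R 1 x ^ (k - 2) * eta x0 R 1 x := by
    rw [← pow_succ]; congr 1; omega
  calc _ ≤ |F * (W x ^ (P - 1) * eta x0 R k x)| +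
        |((P - 1) * W x ^ (P - 1 - 1) * pd W i x) * eta x0 R k x
        + W x ^ (P - 1) * pd (eta x0 R k) i x| := abs_sub _ _
    _ ≤ _ := add_le_add t1 ((abs_add_le _ _).trans (add_le_add t2 t3))
    _ = _ := by rw [e1]; ring

lemma lap_cont {u : E → ℝ} (hu : ContDiff ℝ (⊤ : ℕ∞) u) : Continuous (lap u) :=
  (lap_smooth hu).continuous

lemma gop_cont {W : E → ℝ} (hW : Continuous W) {Fd : Fin N → E → ℝ} (hF : ∀ i, Continuous (Fd i))
    {u : E → ℝ} (hu : ContDiff ℝ (⊤ : ℕ∞) u) : Continuous (gop W Fd u) := by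
  unfold gop
  have h1 := lap_cont hu
  have h2 := hu.continuous
  have h3 : ∀ i, Continuous (pd u i) := fun i => (pd_smooth hu i).continuous
  fun_prop

lemma Hreg_cont {W : E → ℝ} (hW : Continuous W) (hW1 : ∀ x, 1 ≤ W x)
    {Fd : Fin N → E → ℝ} (hF : ∀ i, Continuous (Fd i))
    {u : E → ℝ} (hu : ContDiff ℝ (⊤ : ℕ∞) u) (C2 P : ℝ) (k : ℕ) (x0 : E) (R : ℝ)
    {δ : ℝ} (hδ : 0 < δ) : Continuous (Hreg W Fd C2 P k x0 R u δ) := by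
  have h1 := gop_cont hW hF hu
  have h2 := hu.continuous
  have h3 := eta_cont x0 R 1
  have h4 : ∀ q : ℝ, Continuous (fun x => W x ^ q) := fun q =>
    hW.rpow_const fun x => Or.inl (by have := hW1 x; positivity)
  have h5 : ∀ q : ℝ, Continuous (fun x => (u x ^ 2 + δ) ^ q) := fun q =>
    Continuous.rpow_const (by fun_prop) fun x => Or.inl (by positivity)
  have h4' := h4 (P - 1)
  have h5' := h5 (P / 2)
  have h5'' := h5 ((P - 1) / 2)
  have h5''' := h5 ((P - 2) / 2)
  unfold Hreg mreg
  fun_prop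

lemma Hreg_zero (W : E → ℝ) (Fd : Fin N → E → ℝ)
    (u : E → ℝ) (C2 P : ℝ) {k : ℕ} (hk : 2 < k) {x0 : E} {R : ℝ} (hR : 0 < R)
    (δ : ℝ) {x : E} (hx : x ∉ ball x0 R) : Hreg W Fd C2 P k x0 R u δ x = 0 := by
  rw [mem_ball, dist_eq_norm, not_lt] at hx
  unfold Hreg
  rw [eta_zero x0 hR one_ne_zero hx, zero_pow (by omega), zero_pow (by omega)]
  simp

lemma Hreg_int_le {W : E → ℝ} (hWd : Differentiable ℝ W) (hWc : ∀ i, Continuous (pd W i))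
    (hW1 : ∀ x, 1 ≤ W x)
    {L : ℝ} (hL : 0 ≤ L) (hWL : ∀ i x, |pd W i x| ≤ L * W x)
    {Fd : Fin N → E → ℝ} (hF : ∀ i, Continuous (Fd i)) {B : ℝ} (hFB : ∀ i x, |Fd i x| ≤ B)
    {P : ℝ} (hP : 1 < P) {k : ℕ} (hk : 2 < k) (x0 : E) {R : ℝ} (hR : 1 ≤ R)
    {u : E → ℝ} (hu : ContDiff ℝ (⊤ : ℕ∞) u) {δ : ℝ} (hδ : 0 < δ) :
    ∫ x, Hreg W Fd ((B + (P - 1) * L + 2 * k) ^ 2 / (4 * min 1 (P - 1))) P k x0 R u δ x ≤ 0 := by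
  have hR0 : 0 < R := by linarith
  have hκ : 0 < min 1 (P - 1) := lt_min one_pos (by linarith)
  have hud : Differentiable ℝ u := hu.differentiable (by simp)
  set Φ : E → ℝ := fun x => W x ^ (P - 1) * eta x0 R k x with hΦ
  set Ψ : E → ℝ := fun x => mreg P δ (u x) * Φ x with hΨ
  have hΦd : Differentiable ℝ Φ := fun x => by
    have hW0 : W x ≠ 0 := by have := hW1 x; positivity
    exact ((hWd x).rpow_const (Or.inl hW0)).mul (eta_diff x0 R k hk.le x)
  have hmd : ∀ x, DifferentiableAt ℝ (fun x => mreg P δ (u x)) x := fun x =>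
    ((mreg_deriv P hδ (u x)).comp_hasFDerivAt x (hud x).hasFDerivAt).differentiableAt
  have hΨd : Differentiable ℝ Ψ := fun x => (hmd x).mul (hΦd x)
  have hΨpd : ∀ i x, pd Ψ i x = ((u x ^ 2 + δ) ^ ((P - 2) / 2) *
      ((P - 2) * (u x ^ 2 / (u x ^ 2 + δ)) + 1)) * pd u i x * Φ x
      + mreg P δ (u x) * pd Φ i x := by
    intro i x
    rw [hΨ, pd_mul (hmd x) (hΦd x), pd_comp (mreg_deriv P hδ (u x)) (hud x)]
  have h2 := hu.continuous
  have h3 := eta_cont x0 R k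
  have h4 : ∀ q : ℝ, Continuous (fun x => W x ^ q) := fun q =>
    hWd.continuous.rpow_const fun x => Or.inl (by have := hW1 x; positivity)
  have h5 : ∀ q : ℝ, Continuous (fun x => (u x ^ 2 + δ) ^ q) := fun q =>
    Continuous.rpow_const (by fun_prop) fun x => Or.inl (by positivity)
  have hΦpc : ∀ i, Continuous (pd Φ i) := by
    intro i
    have : pd Φ i = _ := funext (weight_pd hWd hW1 P k hk x0 R i)
    rw [this]
    have := h4 (P - 1)
    have := h4 (P - 1 - 1)
    have := hWc i
    have := eta_pd_cont x0 R k hk.le i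
    fun_prop
  have hΨc : ∀ i, Continuous (pd Ψ i) := by
    intro i
    rw [funext (hΨpd i)]
    have := h5 ((P - 2) / 2)
    have := hΦpc i
    have := hΦd.continuous
    have := (pd_smooth hu i).continuous
    have : Continuous fun x => u x ^ 2 / (u x ^ 2 + δ) :=
      Continuous.div (by fun_prop) (by fun_prop) fun x => by positivity
    unfold mreg
    fun_prop
  have hΨs : HasCompactSupport Ψ :=
    ((eta_supp x0 hR0 (by omega)).mul_left).mul_left
  obtain ⟨i1, i2⟩ := ibp_zero hu hΨd hΨc hΨs
  rw [← i2]
  apply integral_mono _ i1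
  · intro x
    have hW0 : 0 < W x := by have := hW1 x; positivity
    have he0 := eta_nonneg x0 R 1 x
    have hQ : 0 < u x ^ 2 + δ := by positivity
    have hS : 0 ≤ (u x ^ 2 + δ) ^ ((P - 2) / 2) := by positivity
    have hSQ : (u x ^ 2 + δ) ^ ((P - 2) / 2) * (u x ^ 2 + δ) = (u x ^ 2 + δ) ^ (P / 2) := by
      nth_rewrite 2 [← Real.rpow_one (u x ^ 2 + δ)]
      rw [← Real.rpow_add hQ]; congr 1; ring
    have hek : eta x0 R 1 x ^ k = eta x0 R 1 x ^ (k - 2) * eta x0 R 1 x ^ 2 := by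
      rw [← pow_add]; congr 1; omega
    have hΦx : Φ x = (W x ^ (P - 1) * eta x0 R 1 x ^ (k - 2)) * eta x0 R 1 x ^ 2 := by
      rw [hΦ]; simp only; rw [eta_pow, hek]; ring
    have hc := fun i => cauchy_pt (d := pd u i x) hκ hS
      (show 0 ≤ W x ^ (P - 1) * eta x0 R 1 x ^ (k - 2) by positivity)
      (show u x ^ 2 ≤ u x ^ 2 + δ by linarith) (mreg_deriv_lb P hδ (u x))
      (weight_pd_bound hWd hW1 hL hWL hP hk x0 hR i x (hFB i x))
    have hsum := Finset.sum_le_sum (s := Finset.univ) fun i (_ : i ∈ Finset.univ) => hc i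
    rw [Finset.sum_const, Finset.card_univ, Fintype.card_fin, nsmul_eq_mul, hSQ] at hsum
    rw [← hΦx] at hsum
    have hg : -(gop W Fd u x * mreg P δ (u x) * Φ x) ≤ |gop W Fd u x| *
        (u x ^ 2 + δ) ^ ((P - 1) / 2) * (W x ^ (P - 1) * eta x0 R 1 x ^ k) := by
      have hΦ0 : W x ^ (P - 1) * eta x0 R 1 x ^ k = Φ x := by rw [hΦx, hek]; ring
      have hΦn : 0 ≤ Φ x := by rw [hΦx]; positivity
      rw [hΦ0]
      calc _ ≤ |gop W Fd u x * mreg P δ (u x) * Φ x| := neg_le_abs _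
        _ = |gop W Fd u x| * |mreg P δ (u x)| * Φ x := by
          rw [abs_mul, abs_mul, abs_of_nonneg hΦn]
        _ ≤ _ := by
          gcongr
          exact mreg_abs_le P hδ (u x)
    have hmain : W x * W x ^ (P - 1) * eta x0 R 1 x ^ k * (mreg P δ (u x) * u x)
        = ∑ i, (pd (pd u i) i x * Ψ x + pd u i x * pd Ψ i x)
        + ∑ i, (-(pd u i x ^ 2 * ((u x ^ 2 + δ) ^ ((P - 2) / 2) *
            ((P - 2) * (u x ^ 2 / (u x ^ 2 + δ)) + 1)) * Φ x)
            + (u x ^ 2 + δ) ^ ((P - 2) / 2) * u x * pd u i x * (Fd i x * Φ x - pd Φ i x))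
        - gop W Fd u x * mreg P δ (u x) * Φ x := by
      have hlhs : W x * W x ^ (P - 1) * eta x0 R 1 x ^ k * (mreg P δ (u x) * u x)
          = (W x * u x) * mreg P δ (u x) * Φ x := by rw [hΦx, hek]; ring
      rw [hlhs]
      unfold gop lap
      rw [← Finset.sum_add_distrib]
      have : ∀ i, (pd (pd u i) i x * Ψ x + pd u i x * pd Ψ i x +
          (-(pd u i x ^ 2 * ((u x ^ 2 + δ) ^ ((P - 2) / 2) *
            ((P - 2) * (u x ^ 2 / (u x ^ 2 + δ)) + 1)) * Φ x)
            + (u x ^ 2 + δ) ^ ((P - 2) / 2) * u x * pd u i x * (Fd i x * Φ x - pd Φ i x)))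
          = (pd (pd u i) i x + Fd i x * pd u i x) * (mreg P δ (u x) * Φ x) := by
        intro i
        rw [hΨpd i x, hΨ]
        simp only [mreg]
        ring
      rw [Finset.sum_congr rfl fun i _ => this i, ← Finset.sum_mul, Finset.sum_add_distrib]
      ring
    unfold Hreg
    rw [hmain]
    simp only
    linarith
  · apply (Hreg_cont hWd.continuous hW1 hF hu _ P k x0 R hδ).integrable_of_hasCompactSupport
    apply HasCompactSupport.intro (isCompact_closedBall x0 R)
    intro x hx
    exact Hreg_zero W Fd u _ P hk hR0 δ fun h => hx (ball_subset_closedBall h)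

end S4

namespace S4
variable {N : ℕ}

local notation "E" => EuclideanSpace ℝ (Fin N)

lemma Hreg0_int_le {W : E → ℝ} (hWd : Differentiable ℝ W) (hWc : ∀ i, Continuous (pd W i))
    (hW1 : ∀ x, 1 ≤ W x)
    {L : ℝ} (hL : 0 ≤ L) (hWL : ∀ i x, |pd W i x| ≤ L * W x)
    {Fd : Fin N → E → ℝ} (hF : ∀ i, Continuous (Fd i)) {B : ℝ} (hFB : ∀ i x, |Fd i x| ≤ B)
    {P : ℝ} (hP : 1 < P) {k : ℕ} (hk : 2 < k) (x0 : E) {R : ℝ} (hR : 1 ≤ R)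
    {u : E → ℝ} (hu : ContDiff ℝ (⊤ : ℕ∞) u) :
    ∫ x in ball x0 R,
      Hreg W Fd ((B + (P - 1) * L + 2 * k) ^ 2 / (4 * min 1 (P - 1))) P k x0 R u 0 x ≤ 0 := by
  have hR0 : 0 < R := by linarith
  set C2 := (B + (P - 1) * L + 2 * k) ^ 2 / (4 * min 1 (P - 1)) with hC2
  have hκ : 0 < min 1 (P - 1) := lt_min one_pos (by linarith)
  have hC20 : 0 ≤ C2 := by positivity
  have hW := hWd.continuous
  have hg := gop_cont hW hF hu
  have hu0 := hu.continuous
  have hWr : ∀ q : ℝ, Continuous (fun x => W x ^ q) := fun q =>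
    hW.rpow_const fun x => Or.inl (by have := hW1 x; positivity)
  have hur : ∀ q : ℝ, Continuous (fun x => (u x ^ 2 + 1) ^ q) := fun q =>
    Continuous.rpow_const (by fun_prop) fun x => Or.inl (by positivity)
  let bd : E → ℝ := fun x => W x * W x ^ (P - 1) * ((u x ^ 2 + 1) ^ ((P - 1) / 2) * |u x|)
    + N * C2 * ((u x ^ 2 + 1) ^ (P / 2) * W x ^ (P - 1))
    + |gop W Fd u x| * (u x ^ 2 + 1) ^ ((P - 1) / 2) * W x ^ (P - 1)
  have hbd : Continuous bd := by
    have h1 := hWr (P - 1)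
    have h2 := hur ((P - 1) / 2)
    have h3 := hur (P / 2)
    unfold bd
    fun_prop
  have hbi : Integrable bd (volume.restrict (ball x0 R)) :=
    (hbd.continuousOn.integrableOn_compact (isCompact_closedBall x0 R)).mono_set
      ball_subset_closedBall
  let δ : ℕ → ℝ := fun n => 1 / ((n : ℝ) + 1)
  have hδ0 : ∀ n, 0 < δ n := fun n => by unfold δ; positivity
  have hδ1 : ∀ n, δ n ≤ 1 := fun n => by
    unfold δ; rw [div_le_one (by positivity)]; linarith [(Nat.cast_nonneg n : (0:ℝ) ≤ n)]
  have hδt : Filter.Tendsto δ Filter.atTop (nhds 0) := tendsto_one_div_add_atTop_nhds_zero_nat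
  have key := tendsto_integral_of_dominated_convergence (μ := volume.restrict (ball x0 R))
    (F := fun n x => Hreg W Fd C2 P k x0 R u (δ n) x) (f := Hreg W Fd C2 P k x0 R u 0) bd
    (fun n => (Hreg_cont hW hW1 hF hu C2 P k x0 R (hδ0 n)).aestronglyMeasurable) hbi
    (fun n => Filter.Eventually.of_forall fun x => by
      have e0 := eta_nonneg x0 R 1 x
      have e1 := eta_le_one x0 R 1 x
      have hx := hW1 x
      have hW0 : 0 ≤ W x := by linarith
      have d0 := hδ0 n
      have d1 := hδ1 n
      have hP0 : 0 ≤ (P - 1) / 2 := by linarith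
      have hP1 : 0 ≤ P / 2 := by linarith
      have a1 : |mreg P (δ n) (u x) * u x| ≤ (u x ^ 2 + 1) ^ ((P - 1) / 2) * |u x| := by
        rw [abs_mul]
        refine mul_le_mul_of_nonneg_right ((mreg_abs_le P d0 _).trans ?_) (abs_nonneg _)
        gcongr
      have a2 : (u x ^ 2 + δ n) ^ (P / 2) ≤ (u x ^ 2 + 1) ^ (P / 2) := by gcongr
      have a3 : (u x ^ 2 + δ n) ^ ((P - 1) / 2) ≤ (u x ^ 2 + 1) ^ ((P - 1) / 2) := by gcongr
      have hek : ∀ m : ℕ, eta x0 R 1 x ^ m ≤ 1 := fun m => pow_le_one₀ e0 e1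
      have b1 : |W x * W x ^ (P - 1) * eta x0 R 1 x ^ k * (mreg P (δ n) (u x) * u x)| ≤
          W x * W x ^ (P - 1) * ((u x ^ 2 + 1) ^ ((P - 1) / 2) * |u x|) := by
        rw [abs_mul, abs_of_nonneg (by positivity)]
        refine mul_le_mul ?_ a1 (abs_nonneg _) (by positivity)
        exact mul_le_of_le_one_right (by positivity) (hek k)
      have b2 : |N * C2 * ((u x ^ 2 + δ n) ^ (P / 2) * (W x ^ (P - 1) * eta x0 R 1 x ^ (k - 2)))|
          ≤ N * C2 * ((u x ^ 2 + 1) ^ (P / 2) * W x ^ (P - 1)) := by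
        rw [abs_of_nonneg (by positivity)]
        have := mul_le_of_le_one_right (a := W x ^ (P - 1)) (by positivity) (hek (k - 2))
        gcongr
      have b3 : |(|gop W Fd u x| * (u x ^ 2 + δ n) ^ ((P - 1) / 2) *
          (W x ^ (P - 1) * eta x0 R 1 x ^ k))|
          ≤ |gop W Fd u x| * (u x ^ 2 + 1) ^ ((P - 1) / 2) * W x ^ (P - 1) := by
        rw [abs_of_nonneg (by positivity)]
        have := mul_le_of_le_one_right (a := W x ^ (P - 1)) (by positivity) (hek k)
        gcongr
      rw [Real.norm_eq_abs]
      unfold Hreg bd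
      refine (abs_sub _ _).trans (add_le_add ((abs_sub _ _).trans (add_le_add b1 b2)) b3))
    (Filter.Eventually.of_forall fun x => by
      have c0 : ∀ q : ℝ, 0 < q → ContinuousAt (fun d : ℝ => (u x ^ 2 + d) ^ q) 0 := fun q hq =>
        ContinuousAt.rpow_const (by fun_prop) (Or.inr hq.le)
      have c1 := c0 (P / 2) (by linarith)
      have c2 := c0 ((P - 1) / 2) (by linarith)
      have c3 : ContinuousAt (fun d : ℝ => mreg P d (u x) * u x) 0 := by
        unfold mreg
        rcases eq_or_ne (u x) 0 with h | h
        · simp [h, continuousAt_const]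
        · have : ContinuousAt (fun d : ℝ => (u x ^ 2 + d) ^ ((P - 2) / 2)) 0 :=
            ContinuousAt.rpow_const (by fun_prop) (Or.inl (by simpa using h))
          fun_prop
      have c4 : ContinuousAt (fun d : ℝ => Hreg W Fd C2 P k x0 R u d x) 0 := by
        unfold Hreg
        fun_prop
      exact c4.tendsto.comp hδt)
  refine le_of_tendsto key (Filter.Eventually.of_forall fun n => ?_)
  rw [setIntegral_eq_integral_of_forall_compl_eq_zero
    fun x hx => Hreg_zero W Fd u _ P hk hR0 _ hx]
  exact Hreg_int_le hWd hWc hW1 hL hWL hF hFB hP hk x0 hR hu (hδ0 n)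

/-- pointwise inequality -/
lemma H0_pointwise (W : E → ℝ) (hW1 : ∀ x, 1 ≤ W x) (Fd : Fin N → E → ℝ)
    {P : ℝ} (hP : 1 < P) {k : ℕ} (hk : 2 < k) (hk2 : 2 * P ≤ k) (x0 : E) (R : ℝ) (u : E → ℝ)
    {C2 : ℝ} (hC2 : 0 ≤ C2) (x : E) :
    (1 / 2) * (|W x * u x| ^ P * eta x0 R 1 x ^ k) ≤ Hreg W Fd C2 P k x0 R u 0 x
      + N * C2 * (4 * (N * C2 + 1)) ^ (P - 1) * |u x| ^ P + 4 ^ (P - 1) * |gop W Fd u x| ^ P := by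
  have e0 := eta_nonneg x0 R 1 x
  have e1 := eta_le_one x0 R 1 x
  have hx := hW1 x
  have hW0 : 0 < W x := by linarith
  have hA : 0 ≤ (N : ℝ) * C2 := by positivity
  set A := (N : ℝ) * C2
  have s1 : ∀ q : ℝ, (u x ^ 2 + 0) ^ (q / 2) = |u x| ^ q := fun q => by
    rw [add_zero, ← sq_abs, ← Real.rpow_natCast, ← Real.rpow_mul (abs_nonneg _)]
    congr 1; push_cast; ring
  have s2 : mreg P 0 (u x) * u x = |u x| ^ P := by
    unfold mreg
    rcases eq_or_ne (u x) 0 with h | h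
    · simp [h, Real.zero_rpow (by linarith : P ≠ 0)]
    · rw [s1, mul_assoc, ← sq, ← sq_abs, ← Real.rpow_natCast, ← Real.rpow_add (abs_pos.2 h)]
      congr 1; push_cast; ring
  have s3 : W x * W x ^ (P - 1) = W x ^ P := by
    rw [Real.rpow_sub_one hW0.ne']; field_simp
  have s4 : |W x * u x| ^ P = W x ^ P * |u x| ^ P := by
    rw [abs_mul, abs_of_pos hW0, Real.mul_rpow hW0.le (abs_nonneg _)]
  have s5 : (|u x| * W x) ^ (P - 1) = |u x| ^ (P - 1) * W x ^ (P - 1) :=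
    Real.mul_rpow (abs_nonneg _) hW0.le
  have s6 : (|u x| * W x) ^ P = |u x| ^ P * W x ^ P :=
    Real.mul_rpow (abs_nonneg _) hW0.le
  unfold Hreg
  rw [s1, s1, s2, s3, s4]
  have y1 := young1 (ε := 1 / 4) hP (abs_nonneg (gop W Fd u x))
    (by positivity : 0 ≤ |u x| * W x) (by norm_num)
  have y2 := young2 (ε := (4 * (A + 1))⁻¹) hP hx e0 e1 (by positivity) hk2 hk
  rw [s5, s6] at y1
  rw [inv_inv] at y2
  have i4 : ((1:ℝ) / 4)⁻¹ = 4 := by norm_num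
  rw [i4] at y1
  set e := eta x0 R 1 x
  set G := |gop W Fd u x|
  set U := |u x| ^ P
  have hU : 0 ≤ U := by positivity
  set V := |u x| ^ (P - 1)
  set X := W x ^ P
  set Y := W x ^ (P - 1)
  have hek : e ^ k ≤ 1 := pow_le_one₀ e0 e1
  have ek0 : 0 ≤ e ^ k := by positivity
  have z1 := mul_le_mul_of_nonneg_right y1 ek0
  have z2 := mul_le_mul_of_nonneg_left y2 (mul_nonneg hA hU)
  have q1 : A * (4 * (A + 1))⁻¹ ≤ 1 / 4 := by
    rw [← div_eq_mul_inv, div_le_iff₀ (by positivity)]; linarith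
  have q2 := mul_le_mul_of_nonneg_right q1 (by positivity : 0 ≤ U * (X * e ^ k))
  have q3 := mul_le_mul_of_nonneg_left hek (by positivity : 0 ≤ (4:ℝ) ^ (P - 1) * G ^ P)
  linear_combination z1 + z2 + q2 + q3

end S4

namespace S4
variable {N : ℕ}

local notation "E" => EuclideanSpace ℝ (Fin N)

lemma memLp_ball {f : E → ℝ} (hf : Continuous f) (p : ℝ≥0∞) (x0 : E) (R : ℝ) :
    MemLp f p (volume.restrict (ball x0 R)) := by
  obtain ⟨M, hM⟩ := (isCompact_closedBall x0 R).exists_bound_of_continuousOn hf.continuousOn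
  have : IsFiniteMeasure (volume.restrict (ball x0 R)) :=
    ⟨by rw [Measure.restrict_apply_univ]; exact measure_ball_lt_top⟩
  refine MemLp.of_bound hf.aestronglyMeasurable M ?_
  refine (ae_restrict_iff' measurableSet_ball).2 (Filter.Eventually.of_forall fun x hx => ?_)
  exact hM x (ball_subset_closedBall hx)

lemma cont_int_ball {f : E → ℝ} (hf : Continuous f) (x0 : E) (R : ℝ) :
    IntegrableOn f (ball x0 R) :=
  (hf.continuousOn.integrableOn_compact (isCompact_closedBall x0 R)).mono_set
      ball_subset_closedBall

lemma energy {W : E → ℝ} (hWd : Differentiable ℝ W) (hWc : ∀ i, Continuous (pd W i))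
    (hW1 : ∀ x, 1 ≤ W x)
    {L : ℝ} (hL : 0 ≤ L) (hWL : ∀ i x, |pd W i x| ≤ L * W x)
    {Fd : Fin N → E → ℝ} (hF : ∀ i, Continuous (Fd i)) {B : ℝ} (hFB : ∀ i x, |Fd i x| ≤ B)
    {P : ℝ} (hP : 1 < P) :
    ∃ K : ℝ, 0 < K ∧ ∀ (x0 : E) (R : ℝ), 1 ≤ R → ∀ u : E → ℝ, ContDiff ℝ (⊤ : ℕ∞) u →
      ∫ x in ball x0 (3 * R / 4), |W x * u x| ^ P ≤
        K * ((∫ x in ball x0 R, |u x| ^ P) + ∫ x in ball x0 R, |gop W Fd u x| ^ P) := by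
  obtain ⟨k0, hk0⟩ := exists_nat_ge (2 * P)
  set k := k0 + 3 with hkdef
  have hk : 2 < k := by omega
  have hk2 : 2 * P ≤ k := by push_cast [hkdef]; linarith
  have hκ : 0 < min 1 (P - 1) := lt_min one_pos (by linarith)
  set C2 := (B + (P - 1) * L + 2 * k) ^ 2 / (4 * min 1 (P - 1)) with hC2
  have hC20 : 0 ≤ C2 := by positivity
  set K1 := N * C2 * (4 * (N * C2 + 1)) ^ (P - 1) with hK1
  have hK10 : 0 ≤ K1 := by positivity
  set K2 : ℝ := 4 ^ (P - 1) with hK2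
  have hK20 : 0 < K2 := by positivity
  refine ⟨2 * (16 / 7) ^ k * (K1 + K2), by positivity, fun x0 R hR u hu => ?_⟩
  have hR0 : 0 < R := by linarith
  have hP0 : 0 ≤ P := by linarith
  have hW := hWd.continuous
  have hg := gop_cont hW hF hu
  have hu0 := hu.continuous
  have he := eta_cont x0 R 1
  have cWu : Continuous fun x => |W x * u x| ^ P :=
    Continuous.rpow_const (by fun_prop) fun x => Or.inr hP0
  have cu : Continuous fun x => |u x| ^ P :=
    Continuous.rpow_const (by fun_prop) fun x => Or.inr hP0
  have cg : Continuous fun x => |gop W Fd u x| ^ P :=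
    Continuous.rpow_const (by fun_prop) fun x => Or.inr hP0
  have main := Hreg0_int_le hWd hWc hW1 hL hWL hF hFB hP hk x0 hR hu
  rw [← hC2] at main
  have cH : Continuous (Hreg W Fd C2 P k x0 R u 0) := by
    have h4 : Continuous (fun x => W x ^ (P - 1)) :=
      hW.rpow_const fun x => Or.inl (by have := hW1 x; positivity)
    have h5 : ∀ q : ℝ, 0 ≤ q → Continuous (fun x => (u x ^ 2 + 0) ^ q) := fun q hq =>
      Continuous.rpow_const (by fun_prop) fun x => Or.inr hq
    have h6 := h5 (P / 2) (by linarith)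
    have h7 := h5 ((P - 1) / 2) (by linarith)
    have h8 : (fun x => mreg P 0 (u x) * u x) = fun x => (u x ^ 2 + 0) ^ (P / 2) := by
      funext x
      unfold mreg
      rcases eq_or_ne (u x) 0 with h | h
      · simp [h, Real.zero_rpow (by linarith : P / 2 ≠ 0)]
      · have hq : 0 < u x ^ 2 + 0 := by positivity
        have : P / 2 = (P - 2) / 2 + 1 := by ring
        rw [this, Real.rpow_add_one hq.ne']; ring
    have h9 : Continuous (fun x => mreg P 0 (u x) * u x) := h8 ▸ h6
    unfold Hreg
    fun_prop
  have iH := cont_int_ball cH x0 R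
  have iu := cont_int_ball cu x0 R
  have ig := cont_int_ball cg x0 R
  have iWu := cont_int_ball cWu x0 R
  have iWe := cont_int_ball (f := fun x => |W x * u x| ^ P * eta x0 R 1 x ^ k) (by fun_prop) x0 R
  have step1 : ∫ x in ball x0 R, (1 / 2) * (|W x * u x| ^ P * eta x0 R 1 x ^ k) ≤
      ∫ x in ball x0 R, (Hreg W Fd C2 P k x0 R u 0 x + K1 * |u x| ^ P
        + K2 * |gop W Fd u x| ^ P) :=
    setIntegral_mono (iWe.const_mul _) ((iH.add (iu.const_mul _)).add (ig.const_mul _))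
      fun x => H0_pointwise W hW1 Fd hP hk hk2 x0 R u hC20 x
  have iHu : IntegrableOn (fun x => Hreg W Fd C2 P k x0 R u 0 x + K1 * |u x| ^ P) (ball x0 R) :=
    iH.add (iu.const_mul _)
  rw [integral_add iHu (ig.const_mul _),
    integral_add iH (iu.const_mul _), integral_const_mul, integral_const_mul,
    integral_const_mul] at step1
  have step2 : ∫ x in ball x0 (3 * R / 4), (7 / 16 : ℝ) ^ k * |W x * u x| ^ P ≤
      ∫ x in ball x0 R, |W x * u x| ^ P * eta x0 R 1 x ^ k := by
    have hsub : ball x0 (3 * R / 4) ⊆ ball x0 R := ball_subset_ball (by linarith)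
    calc _ ≤ ∫ x in ball x0 (3 * R / 4), |W x * u x| ^ P * eta x0 R 1 x ^ k := by
          refine setIntegral_mono_on ((iWu.mono_set hsub).const_mul _) (iWe.mono_set hsub)
            measurableSet_ball fun x hx => ?_
          rw [mul_comm]
          have : (7 / 16 : ℝ) ≤ eta x0 R 1 x := by
            rw [mem_ball, dist_eq_norm] at hx
            unfold eta
            rw [pow_one]
            refine le_max_of_le_left ?_
            have : ‖x - x0‖ ^ 2 / R ^ 2 ≤ 9 / 16 := by
              rw [div_le_iff₀ (by positivity)]
              have := pow_le_pow_left₀ (norm_nonneg _) hx.le 2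
              linarith [this]
            linarith
          gcongr
      _ ≤ _ := by
          refine setIntegral_mono_set iWe (Filter.Eventually.of_forall fun x => ?_)
            hsub.eventuallyLE
          have := eta_nonneg x0 R 1 x
          simp only [Pi.zero_apply]
          positivity
  rw [integral_const_mul] at step2
  have pu : 0 ≤ ∫ x in ball x0 R, |u x| ^ P := integral_nonneg fun x => by positivity
  have pg : 0 ≤ ∫ x in ball x0 R, |gop W Fd u x| ^ P := integral_nonneg fun x => by positivity
  set I1 := ∫ x in ball x0 (3 * R / 4), |W x * u x| ^ P
  set I2 := ∫ x in ball x0 R, |W x * u x| ^ P * eta x0 R 1 x ^ k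
  set Iu := ∫ x in ball x0 R, |u x| ^ P
  set Ig := ∫ x in ball x0 R, |gop W Fd u x| ^ P
  have e1 : (16 / 7 : ℝ) ^ k * ((7 / 16) ^ k * I1) = I1 := by
    rw [← mul_assoc, ← mul_pow]; norm_num
  rw [← e1, mul_assoc, mul_comm (2:ℝ), mul_assoc]
  refine mul_le_mul_of_nonneg_left ?_ (by positivity)
  have := mul_nonneg hK10 pg
  have := mul_nonneg hK20.le pu
  nlinarith

lemma energy_Lp {W : E → ℝ} (hWd : Differentiable ℝ W) (hWc : ∀ i, Continuous (pd W i))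
    (hW1 : ∀ x, 1 ≤ W x)
    {L : ℝ} (hL : 0 ≤ L) (hWL : ∀ i x, |pd W i x| ≤ L * W x)
    {Fd : Fin N → E → ℝ} (hF : ∀ i, Continuous (Fd i)) {B : ℝ} (hFB : ∀ i x, |Fd i x| ≤ B)
    {p : ℝ≥0∞} (hp : 1 < p) (hp2 : p ≠ ⊤) :
    ∃ K : ℝ, 0 < K ∧ ∀ (x0 : E) (R : ℝ), 1 ≤ R → ∀ u : E → ℝ, ContDiff ℝ (⊤ : ℕ∞) u →
      eLpNorm (fun x => W x * u x) p (volume.restrict (ball x0 (3 * R / 4))) ≤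
        ENNReal.ofReal K * (eLpNorm u p (volume.restrict (ball x0 R))
          + eLpNorm (gop W Fd u) p (volume.restrict (ball x0 R))) := by
  have hP : 1 < p.toReal := by
    rw [← ENNReal.toReal_one]; exact (ENNReal.toReal_lt_toReal (by simp) hp2).2 hp
  have hp0 : p ≠ 0 := (zero_lt_one.trans hp).ne'
  obtain ⟨K, hK, h⟩ := energy hWd hWc hW1 hL hWL hF hFB hP
  refine ⟨K ^ (p.toReal)⁻¹, by positivity, fun x0 R hR u hu => ?_⟩
  have hW := hWd.continuous
  have hg := gop_cont hW hF hu
  have hu0 := hu.continuous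
  have h1 := h x0 R hR u hu
  rw [(memLp_ball (f := fun x => W x * u x) (by fun_prop) p x0 _).eLpNorm_eq_integral_rpow_norm
      hp0 hp2,
    (memLp_ball hu0 p x0 _).eLpNorm_eq_integral_rpow_norm hp0 hp2,
    (memLp_ball hg p x0 _).eLpNorm_eq_integral_rpow_norm hp0 hp2]
  simp only [Real.norm_eq_abs]
  set P := p.toReal
  have p1 : 0 ≤ ∫ x in ball x0 (3 * R / 4), |W x * u x| ^ P := integral_nonneg fun x => by positivity
  have pu : 0 ≤ ∫ x in ball x0 R, |u x| ^ P := integral_nonneg fun x => by positivity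
  have pg : 0 ≤ ∫ x in ball x0 R, |gop W Fd u x| ^ P := integral_nonneg fun x => by positivity
  rw [← ENNReal.ofReal_add (by positivity) (by positivity), ← ENNReal.ofReal_mul (by positivity)]
  refine ENNReal.ofReal_le_ofReal ?_
  refine (Real.rpow_le_rpow p1 h1 (by positivity)).trans ?_
  rw [Real.mul_rpow hK.le (by positivity)]
  refine mul_le_mul_of_nonneg_left ?_ (by positivity)
  exact Real.rpow_add_le_add_rpow pu pg (by positivity) (inv_le_one_of_one_le₀ hP.le)

end S4

namespace S4
variable {N : ℕ}

local notation "E" => EuclideanSpace ℝ (Fin N)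

noncomputable def Wc (α β c : ℝ) (x : E) : ℝ := 1 + c * ‖x‖ ^ β * (1 + ‖x‖ ^ α)⁻¹

noncomputable def Fc (α b : ℝ) (i : Fin N) (x : E) : ℝ := b * ‖x‖ ^ (α - 2) * (1 + ‖x‖ ^ α)⁻¹ * x i

lemma opA_eq (α β b c : ℝ) (u : E → ℝ) (x : E) :
    opAtilde α β b c u x = gop (Wc α β c) (Fc α b) u x + u x := by
  unfold opAtilde gop Wc Fc
  rw [Finset.mul_sum]
  simp only [mul_assoc]
  ring

lemma Wc_ge {α β c : ℝ} (hc : 0 < c) (x : E) : 1 ≤ Wc α β c x := by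
  unfold Wc
  have : 0 ≤ c * ‖x‖ ^ β * (1 + ‖x‖ ^ α)⁻¹ := by positivity
  linarith

lemma Wc_contDiff {α β c : ℝ} (hα : 2 < α) (hβ : α < β) :
    ContDiff ℝ 1 (Wc α β c : E → ℝ) := by
  unfold Wc
  have h1 : ContDiff ℝ 1 (fun x : E => ‖x‖ ^ β) := contDiff_norm_rpow (by linarith)
  have h2 : ContDiff ℝ 1 (fun x : E => ‖x‖ ^ α) := contDiff_norm_rpow (by linarith)
  exact contDiff_const.add ((contDiff_const.mul h1).mul
    ((contDiff_const.add h2).inv fun x => by positivity))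

lemma pd_norm_rpow {q : ℝ} (hq : 1 < q) (i : Fin N) (x : E) :
    pd (fun x : E => ‖x‖ ^ q) i x = q * ‖x‖ ^ (q - 2) * x i := by
  unfold pd
  rw [(hasFDerivAt_norm_rpow x hq).fderiv]
  simp [EuclideanSpace.inner_single_right]

lemma rpow_aux {q r : ℝ} (hq : 1 < q) (hr : 0 ≤ r) : r ^ (q - 2) * r ≤ 1 + r ^ q := by
  rcases hr.eq_or_lt with h | h
  · rw [← h, mul_zero]; positivity
  have e : r ^ (q - 2) * r = r ^ (q - 1) := by
    rw [← Real.rpow_add_one h.ne']; congr 1; ring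
  rw [e]
  rcases le_total r 1 with h1 | h1
  · have := Real.rpow_le_one hr h1 (by linarith : 0 ≤ q - 1)
    have : 0 ≤ r ^ q := by positivity
    linarith
  · have := Real.rpow_le_rpow_of_exponent_le h1 (by linarith : q - 1 ≤ q)
    linarith

lemma pd_norm_rpow_le {q : ℝ} (hq : 1 < q) (i : Fin N) (x : E) :
    |pd (fun x : E => ‖x‖ ^ q) i x| ≤ q * (1 + ‖x‖ ^ q) := by
  rw [pd_norm_rpow hq, abs_mul, abs_of_nonneg (by positivity), mul_assoc]
  refine mul_le_mul_of_nonneg_left ?_ (by linarith)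
  refine le_trans ?_ (rpow_aux hq (norm_nonneg x))
  exact mul_le_mul_of_nonneg_left (abs_coord_le x i) (by positivity)

lemma Wc_pd {α β c : ℝ} (hα : 2 < α) (hβ : α < β) (hc : 0 < c) (i : Fin N) (x : E) :
    |pd (Wc α β c) i x| ≤ (c * β + α + β) * Wc α β c x := by
  have h1 : DifferentiableAt ℝ (fun x : E => ‖x‖ ^ β) x :=
    (hasFDerivAt_norm_rpow x (by linarith)).differentiableAt
  have h2 : DifferentiableAt ℝ (fun x : E => ‖x‖ ^ α) x :=
    (hasFDerivAt_norm_rpow x (by linarith)).differentiableAt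
  have hD : 0 < 1 + ‖x‖ ^ α := by positivity
  have key : pd (Wc α β c) i x = c * (pd (fun x : E => ‖x‖ ^ β) i x * (1 + ‖x‖ ^ α)⁻¹
      - ‖x‖ ^ β * ((1 + ‖x‖ ^ α)⁻¹ * (1 + ‖x‖ ^ α)⁻¹ * pd (fun x : E => ‖x‖ ^ α) i x)) := by
    have f1 := h1.hasFDerivAt
    have f2 := (h2.hasFDerivAt).const_add 1
    have f3 : HasFDerivAt (fun x : E => (1 + ‖x‖ ^ α)⁻¹) _ x :=
      (hasDerivAt_inv hD.ne').comp_hasFDerivAt x f2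
    have f4 : HasFDerivAt (Wc α β c : E → ℝ) _ x := ((f1.const_mul c).mul f3).const_add 1
    unfold pd
    rw [f4.fderiv]
    simp
    field_simp
    ring
  have a1 := pd_norm_rpow_le (by linarith : 1 < β) i x
  have a2 := pd_norm_rpow_le (by linarith : 1 < α) i x
  rw [key, abs_mul, abs_of_pos hc]
  have hβ0 : 0 ≤ ‖x‖ ^ β := by positivity
  set D := 1 + ‖x‖ ^ α with hDd
  set r := ‖x‖ ^ β
  have hD1 : D⁻¹ ≤ 1 := inv_le_one_of_one_le₀ (by
    have : 0 ≤ ‖x‖ ^ α := by positivity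
    linarith)
  have hDi : 0 < D⁻¹ := by positivity
  have b1 : |pd (fun x : E => ‖x‖ ^ β) i x * D⁻¹| ≤ β * (1 + r) * D⁻¹ := by
    rw [abs_mul, abs_of_pos hDi]; gcongr
  have b2 : |r * (D⁻¹ * D⁻¹ * pd (fun x : E => ‖x‖ ^ α) i x)| ≤ r * (D⁻¹ * α) := by
    rw [abs_mul, abs_of_nonneg hβ0]
    refine mul_le_mul_of_nonneg_left ?_ hβ0
    rw [abs_mul, abs_of_pos (by positivity)]
    calc _ ≤ D⁻¹ * D⁻¹ * (α * D) := by gcongr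
      _ = _ := by field_simp
  have b3 := (abs_sub _ _).trans (add_le_add b1 b2)
  have b4 := mul_le_mul_of_nonneg_left b3 hc.le
  refine b4.trans ?_
  unfold Wc
  have g1 : c * β * D⁻¹ ≤ c * β := mul_le_of_le_one_right (by nlinarith) hD1
  have g2 : 0 ≤ c * r * D⁻¹ := by positivity
  have g3 : 0 ≤ c * β := by nlinarith
  have g4 := mul_nonneg g3 g2
  change _ ≤ (c * β + α + β) * (1 + c * r * D⁻¹)
  nlinarith

lemma Fc_cont {α : ℝ} (b : ℝ) (hα : 2 < α) (i : Fin N) : Continuous (Fc α b i : E → ℝ) := by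
  unfold Fc
  have h1 : Continuous (fun x : E => ‖x‖ ^ (α - 2)) :=
    continuous_norm.rpow_const fun x => Or.inr (by linarith)
  have h2 : Continuous (fun x : E => (1 + ‖x‖ ^ α)⁻¹) :=
    (continuous_const.add (continuous_norm.rpow_const fun x => Or.inr (by linarith))).inv₀
      fun x => (by positivity : (0 : ℝ) < 1 + ‖x‖ ^ α).ne'
  fun_prop

lemma Fc_le {α : ℝ} (b : ℝ) (hα : 2 < α) (i : Fin N) (x : E) : |Fc α b i x| ≤ |b| := by
  unfold Fc
  have hD : 0 < 1 + ‖x‖ ^ α := by positivity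
  have h := rpow_aux (by linarith : 1 < α) (norm_nonneg x)
  have h0 : 0 ≤ ‖x‖ ^ (α - 2) := by positivity
  rw [abs_mul, abs_mul, abs_mul, abs_of_nonneg h0, abs_of_pos (inv_pos.2 hD)]
  calc _ ≤ |b| * ‖x‖ ^ (α - 2) * (1 + ‖x‖ ^ α)⁻¹ * ‖x‖ := by
        have := abs_coord_le x i
        gcongr
    _ = |b| * ((‖x‖ ^ (α - 2) * ‖x‖) / (1 + ‖x‖ ^ α)) := by ring
    _ ≤ |b| * 1 := by
        have := (div_le_one hD).2 h
        gcongr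
    _ = _ := mul_one _

lemma energy_conc {α β c : ℝ} (b : ℝ) (hα : 2 < α) (hβ : α < β) (hc : 0 < c)
    {p : ℝ≥0∞} (hp : 1 < p) (hp2 : p ≠ ⊤) :
    ∃ K : ℝ, 0 < K ∧ ∀ (x0 : E) (R : ℝ), 1 ≤ R → ∀ u : E → ℝ, ContDiff ℝ (⊤ : ℕ∞) u →
      eLpNorm (fun x => Wc α β c x * u x) p (volume.restrict (ball x0 (3 * R / 4))) ≤
        ENNReal.ofReal K * (eLpNorm (fun x => opAtilde α β b c u x) p (volume.restrict (ball x0 R))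
          + eLpNorm u p (volume.restrict (ball x0 R))) := by
  have hC : ContDiff ℝ 1 (Wc α β c : E → ℝ) := Wc_contDiff hα hβ
  have hWd := hC.differentiable one_ne_zero
  have hWc : ∀ i, Continuous (pd (Wc α β c : E → ℝ) i) := fun i =>
    (hC.continuous_fderiv one_ne_zero).clm_apply continuous_const
  obtain ⟨K, hK, h⟩ := energy_Lp hWd hWc (Wc_ge hc)
    (L := c * β + α + β) (by nlinarith) (Wc_pd hα hβ hc) (Fc_cont b hα) (Fc_le b hα) hp hp2
  refine ⟨K * 2, by positivity, fun x0 R hR u hu => (h x0 R hR u hu).trans ?_⟩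
  have hg := gop_cont hWd.continuous (Fc_cont b hα) hu
  have e : gop (Wc α β c) (Fc α b) u = (fun x => opAtilde α β b c u x) - u := by
    funext x
    simp [opA_eq]
  have hA : Continuous (fun x => opAtilde α β b c u x) := by
    simp only [opA_eq]
    exact hg.add hu.continuous
  have := eLpNorm_sub_le (p := p) (hA.aestronglyMeasurable (μ := volume.restrict (ball x0 R)))
    hu.continuous.aestronglyMeasurable hp.le
  rw [← e] at this
  rw [ENNReal.ofReal_mul hK.le, mul_assoc]
  refine mul_le_mul_right ?_ _
  set a := eLpNorm (fun x => opAtilde α β b c u x) p (volume.restrict (ball x0 R))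
  set d := eLpNorm u p (volume.restrict (ball x0 R))
  calc _ ≤ d + (a + d) := by gcongr
    _ ≤ (d + (a + d)) + a := le_self_add
    _ = _ := by rw [ENNReal.ofReal_ofNat]; ring

end S4

namespace S4
variable {N : ℕ}

local notation "E" => EuclideanSpace ℝ (Fin N)

lemma absorb {A : ℝ → ℝ} (hA0 : ∀ r, 0 ≤ A r) {ρ K0 M U T : ℝ} (hK0 : 0 ≤ K0) (hM : 0 ≤ M)
    (hU : 0 ≤ U) (hT : ∀ r, r ≤ ρ → A r ≤ T)
    (h : ∀ r s, 0 < s → r + s ≤ ρ → A r ≤ K0 + M * (s * A (r + s) + U / s)) :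
    A (ρ - 1 / 4) ≤ 8 * (K0 + 2 * (M + 1) * M * U) := by
  let Sset : Set ℝ := (fun σ : ℝ => σ * A (ρ - σ)) '' Set.Ioc 0 (1 / 4)
  have hT0 : 0 ≤ T := (hA0 ρ).trans (hT ρ le_rfl)
  have hbdd : BddAbove Sset := by
    refine ⟨T, ?_⟩
    rintro _ ⟨σ, ⟨h0, h1⟩, rfl⟩
    have h2 := hT (ρ - σ) (by linarith)
    have h3 := hA0 (ρ - σ)
    have : σ * A (ρ - σ) ≤ 1 * T := by
      refine mul_le_mul ?_ h2 h3 zero_le_one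
      linarith
    simpa using this
  have hne : Sset.Nonempty := ⟨_, 1 / 4, ⟨by norm_num, le_rfl⟩, rfl⟩
  have hmem : ∀ σ : ℝ, 0 < σ → σ ≤ 1 / 4 → σ * A (ρ - σ) ≤ sSup Sset := fun σ h0 h1 =>
    le_csSup hbdd ⟨σ, ⟨h0, h1⟩, rfl⟩
  have hS0 : 0 ≤ sSup Sset := by
    have := hmem (1 / 4) (by norm_num) le_rfl
    have := hA0 (ρ - 1 / 4)
    linarith
  set S := sSup Sset with hS
  set θ : ℝ := 1 / (2 * (M + 1)) with hθ
  have hθ0 : 0 < θ := by positivity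
  have hθ1 : θ ≤ 1 / 2 := by
    rw [hθ, div_le_div_iff₀ (by positivity) (by norm_num)]; linarith
  have hMθ : M * θ ≤ 1 / 2 := by
    rw [hθ, mul_one_div, div_le_div_iff₀ (by positivity) (by norm_num)]; linarith
  have hle : S ≤ K0 + 2 * (M + 1) * M * U + S / 2 := by
    refine csSup_le hne ?_
    rintro _ ⟨σ, ⟨h0, h1⟩, rfl⟩
    have hs : 0 < θ * σ := by positivity
    have q := h (ρ - σ) (θ * σ) hs (by nlinarith)
    have e : ρ - σ + θ * σ = ρ - (1 - θ) * σ := by ring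
    rw [e] at q
    have hσ' : 0 < (1 - θ) * σ := mul_pos (by linarith) h0
    have m := hmem ((1 - θ) * σ) hσ' (by nlinarith)
    set A' := A (ρ - (1 - θ) * σ)
    have hA' : 0 ≤ A' := hA0 _
    have m2 : σ * A' ≤ 2 * S := by
      have : (1 / 2) * (σ * A') ≤ (1 - θ) * σ * A' := by
        rw [mul_assoc]
        exact mul_le_mul_of_nonneg_right (by linarith) (by positivity)
      linarith
    have q2 := mul_le_mul_of_nonneg_left q h0.le
    have e2 : σ * (K0 + M * (θ * σ * A' + U / (θ * σ)))
        = σ * K0 + σ * ((M * θ) * (σ * A')) + 2 * (M + 1) * M * U := by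
      have : U / (θ * σ) * σ = 2 * (M + 1) * U := by
        rw [hθ]; field_simp
      linear_combination M * this
    rw [e2] at q2
    refine q2.trans ?_
    have t1 : σ * K0 ≤ K0 := mul_le_of_le_one_left hK0 (by linarith)
    have t2 : M * θ * (σ * A') ≤ 1 / 2 * (2 * S) := mul_le_mul hMθ m2 (by positivity) (by norm_num)
    have t3 : σ * ((M * θ) * (σ * A')) ≤ 1 / 4 * (1 / 2 * (2 * S)) :=
      mul_le_mul h1 t2 (by positivity) (by norm_num)
    linarith
  have := hmem (1 / 4) (by norm_num) le_rfl
  linarith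

lemma lap_step {α β c : ℝ} (b : ℝ) (hα : 2 < α) (hβ : α < β) (hc : 0 < c)
    {p : ℝ≥0∞} (hp : 1 ≤ p) (u : E → ℝ) (hu : ContDiff ℝ (⊤ : ℕ∞) u) (x0 : E) (r : ℝ) :
    eLpNorm (lap u) p (volume.restrict (ball x0 r)) ≤
      eLpNorm (fun x => opAtilde α β b c u x) p (volume.restrict (ball x0 r))
      + eLpNorm (fun x => Wc α β c x * u x) p (volume.restrict (ball x0 r))
      + ∑ i, ENNReal.ofReal |b| * eLpNorm (pd u i) p (volume.restrict (ball x0 r)) := by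
  have hC : ContDiff ℝ 1 (Wc α β c : E → ℝ) := Wc_contDiff hα hβ
  have hW := hC.continuous
  have hg := gop_cont hW (Fc_cont b hα) hu
  have hu0 := hu.continuous
  have hA : Continuous (fun x => opAtilde α β b c u x) := by
    simp only [opA_eq]
    exact hg.add hu.continuous
  have hpd : ∀ i, Continuous (pd u i) := fun i => (pd_smooth hu i).continuous
  have hFc : ∀ i, Continuous (fun x => Fc α b i x * pd u i x) := fun i =>
    (Fc_cont b hα i).mul (hpd i)
  set μ := volume.restrict (ball x0 r)
  have e : lap u = ((fun x => opAtilde α β b c u x) + fun x => (Wc α β c x - 1) * u x)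
      - ∑ i, fun x => Fc α b i x * pd u i x := by
    funext x
    simp only [opA_eq, gop, Pi.add_apply, Pi.sub_apply, Finset.sum_apply]
    ring
  have c1 : Continuous fun x => (Wc α β c x - 1) * u x := by fun_prop
  have c2 : Continuous (∑ i, fun x => Fc α b i x * pd u i x) :=
    (continuous_finsetSum Finset.univ fun i _ => hFc i).congr fun x => by simp
  rw [e]
  refine (eLpNorm_sub_le (hA.add c1).aestronglyMeasurable c2.aestronglyMeasurable hp).trans ?_
  refine add_le_add ((eLpNorm_add_le hA.aestronglyMeasurable c1.aestronglyMeasurable hp).trans ?_) ?_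
  · refine add_le_add le_rfl (eLpNorm_mono fun x => ?_)
    rw [norm_mul, norm_mul]
    have := Wc_ge (α := α) (β := β) hc x
    refine mul_le_mul_of_nonneg_right ?_ (norm_nonneg _)
    rw [Real.norm_eq_abs, Real.norm_eq_abs, abs_of_nonneg (by linarith), abs_of_nonneg (by linarith)]
    linarith
  · refine (eLpNorm_sum_le (fun i _ => (hFc i).aestronglyMeasurable) hp).trans ?_
    refine Finset.sum_le_sum fun i _ => ?_
    refine eLpNorm_le_mul_eLpNorm_of_ae_le_mul (Filter.Eventually.of_forall fun x => ?_) p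
    rw [norm_mul]
    exact mul_le_mul_of_nonneg_right (Fc_le b hα i x) (norm_nonneg _)

end S4

theorem stmt4 (N : ℕ) (hN : 2 < N) (α β b c : ℝ) (hα : 2 < α) (hβ : α < β) (hc : 0 < c)
    (p : ℝ≥0∞) (hp1 : 1 < p) (hp2 : p ≠ ⊤) :
    ∃ C : ℝ≥0, 0 < C ∧ ∀ (x0 : EuclideanSpace ℝ (Fin N)) (R : ℝ), 1 ≤ R →
      ∀ u : EuclideanSpace ℝ (Fin N) → ℝ, ContDiff ℝ (⊤ : ℕ∞) u → HasCompactSupport u →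
        eLpNorm (fun x => lap u x) p (volume.restrict (ball x0 (R / 2))) ≤
          (C : ℝ≥0∞) * (eLpNorm (fun x => opAtilde α β b c u x) p (volume.restrict (ball x0 R))
            + eLpNorm u p (volume.restrict (ball x0 R))) := by
  obtain ⟨K, hK, hgrad⟩ := S4.grad_est N p hp1.le hp2
  obtain ⟨K', hK', hen⟩ := S4.energy_conc (N := N) b hα hβ hc hp1 hp2
  set M : ℝ := N * (|b| * K) with hM
  have hM0 : 0 ≤ M := by positivity
  have hCpos : 0 < 8 * (1 + K' + 2 * (M + 1) * M) := by positivity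
  refine ⟨Real.toNNReal (8 * (1 + K' + 2 * (M + 1) * M)), Real.toNNReal_pos.2 hCpos,
    fun x0 R hR u hu hcs => ?_⟩
  have hgop := S4.gop_cont (S4.Wc_contDiff (c := c) hα hβ).continuous (S4.Fc_cont b hα) hu
  have hA : Continuous (fun x => opAtilde α β b c u x) := by
    simp only [S4.opA_eq]
    exact hgop.add hu.continuous
  have hWu : Continuous (fun x => S4.Wc α β c x * u x) :=
    (S4.Wc_contDiff hα hβ).continuous.mul hu.continuous
  have fA := (S4.memLp_ball hA p x0 R).eLpNorm_ne_top
  have fu := (S4.memLp_ball hu.continuous p x0 R).eLpNorm_ne_top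
  have fW := (S4.memLp_ball hWu p x0 (3 * R / 4)).eLpNorm_ne_top
  have fl : ∀ r, eLpNorm (lap u) p (volume.restrict (ball x0 r)) ≠ ⊤ := fun r =>
    (S4.memLp_ball (S4.lap_cont hu) p x0 r).eLpNorm_ne_top
  have henR := hen x0 R hR u hu
  have mono : ∀ (f : EuclideanSpace ℝ (Fin N) → ℝ) (r r' : ℝ), r ≤ r' →
      eLpNorm f p (volume.restrict (ball x0 r)) ≤ eLpNorm f p (volume.restrict (ball x0 r')) :=
    fun f r r' h => eLpNorm_mono_measure f (Measure.restrict_mono (ball_subset_ball h) le_rfl)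
  have stepE : ∀ r s : ℝ, 0 < s → r + s ≤ R / 2 + 1 / 4 →
      eLpNorm (lap u) p (volume.restrict (ball x0 r)) ≤
      eLpNorm (fun x => opAtilde α β b c u x) p (volume.restrict (ball x0 R))
      + eLpNorm (fun x => S4.Wc α β c x * u x) p (volume.restrict (ball x0 (3 * R / 4)))
      + N * (ENNReal.ofReal |b| * (ENNReal.ofReal (K / s) * eLpNorm u p (volume.restrict (ball x0 R))
        + ENNReal.ofReal (K * s) * eLpNorm (lap u) p (volume.restrict (ball x0 (r + s))))) := by
    intro r s hs hrs
    refine (S4.lap_step b hα hβ hc hp1.le u hu x0 r).trans ?_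
    refine add_le_add (add_le_add (mono _ _ _ (by linarith)) (mono _ _ _ (by linarith))) ?_
    refine (Finset.sum_le_card_nsmul _ _ (ENNReal.ofReal |b| * (ENNReal.ofReal (K / s) *
      eLpNorm u p (volume.restrict (ball x0 R)) + ENNReal.ofReal (K * s) *
      eLpNorm (lap u) p (volume.restrict (ball x0 (r + s))))) fun i _ => ?_).trans ?_
    · refine mul_le_mul_right ((hgrad x0 r s hs u hu hcs i).trans ?_) _
      exact add_le_add (mul_le_mul_right (mono _ _ _ (by linarith)) _) le_rfl
    · simp
  set F := eLpNorm (fun x => opAtilde α β b c u x) p (volume.restrict (ball x0 R)) with hF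
  set U := eLpNorm u p (volume.restrict (ball x0 R)) with hU
  set G := eLpNorm (fun x => S4.Wc α β c x * u x) p (volume.restrict (ball x0 (3 * R / 4))) with hG
  let A : ℝ → ℝ := fun r => (eLpNorm (lap u) p (volume.restrict (ball x0 r))).toReal
  have eA : ∀ r, eLpNorm (lap u) p (volume.restrict (ball x0 r)) = ENNReal.ofReal (A r) :=
    fun r => (ENNReal.ofReal_toReal (fl r)).symm
  have hA0 : ∀ r, 0 ≤ A r := fun r => ENNReal.toReal_nonneg
  obtain ⟨F', hF0, eF⟩ : ∃ F' : ℝ, 0 ≤ F' ∧ F = ENNReal.ofReal F' :=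
    ⟨_, ENNReal.toReal_nonneg, (ENNReal.ofReal_toReal fA).symm⟩
  obtain ⟨U', hU0, eU⟩ : ∃ F' : ℝ, 0 ≤ F' ∧ U = ENNReal.ofReal F' :=
    ⟨_, ENNReal.toReal_nonneg, (ENNReal.ofReal_toReal fu).symm⟩
  obtain ⟨G', hG0, eG⟩ : ∃ F' : ℝ, 0 ≤ F' ∧ G = ENNReal.ofReal F' :=
    ⟨_, ENNReal.toReal_nonneg, (ENNReal.ofReal_toReal fW).symm⟩
  have hGle : G' ≤ K' * (F' + U') := by
    rw [eG, eF, eU, ← ENNReal.ofReal_add hF0 hU0, ← ENNReal.ofReal_mul hK'.le,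
      ENNReal.ofReal_le_ofReal_iff (by positivity)] at henR
    exact henR
  have stepR : ∀ r s : ℝ, 0 < s → r + s ≤ R / 2 + 1 / 4 →
      A r ≤ (F' + G') + M * (s * A (r + s) + U' / s) := by
    intro r s hs hrs
    have h := stepE r s hs hrs
    have h0 := hA0 (r + s)
    rw [eA, eA, eF, eG, eU, ← ENNReal.ofReal_add hF0 hG0,
      ← ENNReal.ofReal_mul (by positivity), ← ENNReal.ofReal_mul (by positivity),
      ← ENNReal.ofReal_add (by positivity) (by positivity),
      ← ENNReal.ofReal_mul (by positivity), ← ENNReal.ofReal_natCast,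
      ← ENNReal.ofReal_mul (by positivity),
      ← ENNReal.ofReal_add (by positivity) (by positivity),
      ENNReal.ofReal_le_ofReal_iff (by positivity)] at h
    refine h.trans (le_of_eq ?_)
    rw [hM]; ring
  have fin := S4.absorb hA0 (by positivity : 0 ≤ F' + G') hM0 hU0
    (T := A (R / 2 + 1 / 4))
    (fun r hr => ENNReal.toReal_mono (fl _) (mono _ _ _ hr)) stepR
  have e1 : R / 2 + 1 / 4 - 1 / 4 = R / 2 := by ring
  rw [e1] at fin
  change eLpNorm (lap u) p (volume.restrict (ball x0 (R / 2))) ≤ _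
  rw [eA, eF, eU, ← ENNReal.ofReal_add hF0 hU0]
  change _ ≤ ENNReal.ofReal _ * _
  rw [← ENNReal.ofReal_mul hCpos.le]
  refine ENNReal.ofReal_le_ofReal (fin.trans ?_)
  have hm : 0 ≤ 2 * (M + 1) * M := by positivity
  nlinarith [mul_nonneg hm hF0]
end

section
/- Assume β > α. For every 1 < p < ∞ there exists a constant C > 0 such that for every u ∈ C_c^∞(ℝ^N; ℝ): ‖Δu‖_{L^p(ℝ^N)} ≤ C ( ‖Ãu‖_{L^p(ℝ^N)} + ‖u‖_{L^p(ℝ^N)} ), where Ãu(x) = Δu(x) + b |x|^{α−2} (1+|x|^α)^{−1} x·∇u(x) − c |x|^β (1+|x|^α)^{−1} u(x). -/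
open Real MeasureTheory Metric
open scoped ENNReal NNReal

lemma aux_mink {X Y : Type*} [MeasurableSpace X] [MeasurableSpace Y] (μ : Measure X) (ν : Measure Y)
    [SFinite μ] [SFinite ν] (p : ℝ) (hp : 1 < p) (k : Y → ℝ≥0∞) (hk : Measurable k)
    (H : X → Y → ℝ≥0∞) (hH : Measurable (Function.uncurry H)) (A : ℝ≥0∞)
    (hA : ∀ y, ∫⁻ x, H x y ^ p ∂μ ≤ A) :
    ∫⁻ x, (∫⁻ y, k y * H x y ∂ν) ^ p ∂μ ≤ (∫⁻ y, k y ∂ν) ^ p * A := by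
  have hpq : p.HolderConjugate (p / (p - 1)) := Real.HolderConjugate.conjExponent hp
  have hp0 : 0 < p := by linarith
  have key : ∀ x, (∫⁻ y, k y * H x y ∂ν) ^ p ≤
      (∫⁻ y, k y ∂ν) ^ (p - 1) * ∫⁻ y, k y * H x y ^ p ∂ν := by
    intro x
    have hm : Measurable (H x) := hH.comp measurable_prodMk_left
    have h1 := ENNReal.lintegral_mul_le_Lp_mul_Lq (ν.withDensity k) hpq (f := H x) (g := fun _ => 1)
      hm.aemeasurable aemeasurable_const
    simp only [Pi.mul_apply, mul_one, ENNReal.one_rpow] at h1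
    rw [lintegral_withDensity_eq_lintegral_mul _ hk hm,
      lintegral_withDensity_eq_lintegral_mul _ hk (hm.pow_const p),
      lintegral_withDensity_eq_lintegral_mul _ hk measurable_const] at h1
    simp only [Pi.mul_apply, mul_one] at h1
    calc (∫⁻ y, k y * H x y ∂ν) ^ p ≤ _ := ENNReal.rpow_le_rpow h1 hp0.le
      _ = _ := by
        rw [ENNReal.mul_rpow_of_nonneg _ _ hp0.le, ← ENNReal.rpow_mul, ← ENNReal.rpow_mul, mul_comm]
        congr 1
        · congr 1
          field_simp
        · rw [one_div_mul_cancel hp0.ne', ENNReal.rpow_one]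
  calc ∫⁻ x, (∫⁻ y, k y * H x y ∂ν) ^ p ∂μ
      ≤ ∫⁻ x, (∫⁻ y, k y ∂ν) ^ (p - 1) * ∫⁻ y, k y * H x y ^ p ∂ν ∂μ := lintegral_mono key
    _ = (∫⁻ y, k y ∂ν) ^ (p - 1) * ∫⁻ x, ∫⁻ y, k y * H x y ^ p ∂ν ∂μ := by
        rw [lintegral_const_mul]
        apply Measurable.lintegral_prod_right
        exact (hk.comp measurable_snd).mul (hH.pow_const p)
    _ = (∫⁻ y, k y ∂ν) ^ (p - 1) * ∫⁻ y, ∫⁻ x, k y * H x y ^ p ∂μ ∂ν := by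
        rw [lintegral_lintegral_swap]
        exact ((hk.comp measurable_snd).mul (hH.pow_const p)).aemeasurable
    _ ≤ (∫⁻ y, k y ∂ν) ^ (p - 1) * ∫⁻ y, k y * A ∂ν := by
        gcongr with y
        rw [lintegral_const_mul]
        · gcongr; exact hA y
        · exact (hH.comp measurable_prodMk_right).pow_const p
    _ = (∫⁻ y, k y ∂ν) ^ p * A := by
        rw [lintegral_mul_const _ hk, ← mul_assoc]
        congr 1
        conv_lhs => rw [← ENNReal.rpow_one (∫⁻ y, k y ∂ν), ← ENNReal.rpow_mul, ← ENNReal.rpow_add_of_nonneg _ _ (by linarith) (by linarith)]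
        congr 1; ring

lemma aux_trans {N : ℕ} (p : ℝ) (w : EuclideanSpace ℝ (Fin N) → ℝ) (v : EuclideanSpace ℝ (Fin N)) :
    ∫⁻ x, ‖w (x - v)‖ₑ ^ p = ∫⁻ x, ‖w x‖ₑ ^ p :=
  by
  simpa [sub_eq_add_neg] using lintegral_add_right_eq_self (μ := volume) (fun x => ‖w x‖ₑ ^ p) (-v)

lemma aux_ibp {N : ℕ} (v : EuclideanSpace ℝ (Fin N) → ℝ) (g : EuclideanSpace ℝ (Fin N) → ℝ)
    (hv : ContDiff ℝ 1 v) (hvc : HasCompactSupport v) (hg : ContDiff ℝ 1 g) (i : Fin N) :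
    ∫ x, g x * pd v i x = - ∫ x, pd g i x * v x := by
  unfold pd
  have c1 : Continuous (fun x => fderiv ℝ v x (EuclideanSpace.single i 1)) :=
    (hv.continuous_fderiv (by simp)).clm_apply continuous_const
  have c2 : Continuous (fun x => fderiv ℝ g x (EuclideanSpace.single i 1)) :=
    (hg.continuous_fderiv (by simp)).clm_apply continuous_const
  have hc1 : HasCompactSupport (fun x => fderiv ℝ v x (EuclideanSpace.single i 1)) :=
    hvc.fderiv_apply ℝ _
  apply integral_mul_fderiv_eq_neg_fderiv_mul_of_integrable
  · exact (c2.mul hv.continuous).integrable_of_hasCompactSupport hvc.mul_left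
  · exact (hg.continuous.mul c1).integrable_of_hasCompactSupport hc1.mul_left
  · exact (hg.continuous.mul hv.continuous).integrable_of_hasCompactSupport hvc.mul_left
  · intro x _; exact hg.differentiable (by simp) x
  · intro x _; exact hv.differentiable (by simp) x

lemma aux_pd_contDiff {N : ℕ} (u : EuclideanSpace ℝ (Fin N) → ℝ) (n : ℕ)
    (hu : ContDiff ℝ (n + 1 : ℕ) u) (i : Fin N) : ContDiff ℝ n (pd u i) := by
  unfold pd
  exact (hu.fderiv_right (m := n) (by norm_cast)).clm_apply contDiff_const

lemma aux_pd_supp {N : ℕ} (u : EuclideanSpace ℝ (Fin N) → ℝ) 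
    (hu : HasCompactSupport u) (i : Fin N) : HasCompactSupport (pd u i) :=
  hu.fderiv_apply ℝ _

lemma aux_pd_comm {N : ℕ} (u : EuclideanSpace ℝ (Fin N) → ℝ)
    (hu : ContDiff ℝ 2 u) (i j : Fin N) : pd (pd u i) j = pd (pd u j) i := by
  funext x
  have h : ∀ i j, pd (pd u i) j x = fderiv ℝ (fderiv ℝ u) x (EuclideanSpace.single j 1) (EuclideanSpace.single i 1) := by
    intro i j
    have hd : DifferentiableAt ℝ (fderiv ℝ u) x :=
      (hu.fderiv_right (m := 1) (by norm_num)).differentiable (by simp) x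
    have : HasFDerivAt (pd u i) ((fderiv ℝ (fderiv ℝ u) x).flip (EuclideanSpace.single i 1)) x := by
      have := hd.hasFDerivAt.clm_apply (hasFDerivAt_const (EuclideanSpace.single i (1:ℝ)) x)
      have e : pd u i = fun y => (fderiv ℝ u y) (EuclideanSpace.single i 1) := rfl
      rw [e]
      exact this.congr_fderiv (by ext; simp)
    conv_lhs => unfold pd
    change fderiv ℝ (pd u i) x _ = _
    rw [this.fderiv]; rfl
  rw [h, h]
  have hs : IsSymmSndFDerivAt ℝ u x := hu.contDiffAt.isSymmSndFDerivAt (by simp)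
  exact hs _ _

lemma aux_fderiv_sum {N : ℕ} (u : EuclideanSpace ℝ (Fin N) → ℝ) (x z : EuclideanSpace ℝ (Fin N)) :
    fderiv ℝ u x z = ∑ j, z j * pd u j x := by
  have : z = ∑ j, z j • EuclideanSpace.single j (1:ℝ) := by
    ext k
    simp [Pi.single_apply]
  conv_lhs => rw [this]
  simp [pd]

/-- Gaussian weight. -/
noncomputable def gs {N : ℕ} (z : EuclideanSpace ℝ (Fin N)) : ℝ := Real.exp (-‖z‖ ^ 2)

lemma gs_pos {N : ℕ} (z : EuclideanSpace ℝ (Fin N)) : 0 < gs z := Real.exp_pos _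

lemma gs_contDiff {N : ℕ} : ContDiff ℝ 1 (gs (N := N)) := by
  unfold gs
  exact ((contDiff_norm_sq ℝ).neg).exp

lemma gs_pd {N : ℕ} (j : Fin N) (z : EuclideanSpace ℝ (Fin N)) :
    pd gs j z = -2 * z j * gs z := by
  unfold pd
  have h := ((hasStrictFDerivAt_norm_sq z).hasFDerivAt.neg).exp
  have h3 : fderiv ℝ (gs (N := N)) z = _ := h.fderiv
  rw [h3]
  simp [gs, EuclideanSpace.inner_single_right]
  ring

lemma gs_integrable_aux {N : ℕ} (a : ℝ) (ha : 0 < a) :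
    Integrable (fun z : EuclideanSpace ℝ (Fin N) => Real.exp (-a * ‖z‖ ^ 2)) := by
  have := (GaussianFourier.integrable_cexp_neg_mul_sq_norm_add (V := EuclideanSpace ℝ (Fin N)) (b := (a:ℂ)) (by simpa using ha) 0 0).re
  refine this.congr (Filter.Eventually.of_forall fun z => ?_)
  have e : (-(a:ℂ) * (‖z‖:ℂ) ^ 2 + 0 * ((inner ℝ (0: EuclideanSpace ℝ (Fin N)) z : ℝ) : ℂ)) = ((-a * ‖z‖ ^ 2 : ℝ) : ℂ) := by
    push_cast; ring
  change (Complex.exp (-(a:ℂ) * (‖z‖:ℂ) ^ 2 + 0 * ((inner ℝ (0: EuclideanSpace ℝ (Fin N)) z : ℝ) : ℂ))).re = _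
  rw [e, ← Complex.ofReal_exp, Complex.ofReal_re]

lemma gs_integrable {N : ℕ} : Integrable (gs (N := N)) := by
  have := gs_integrable_aux (N := N) 1 one_pos
  refine this.congr (Filter.Eventually.of_forall fun z => ?_)
  simp [gs]

lemma gs_norm_integrable {N : ℕ} :
    Integrable (fun z : EuclideanSpace ℝ (Fin N) => ‖z‖ * gs z) := by
  refine (gs_integrable_aux (N := N) (1/2) (by norm_num)).mono'
    (continuous_norm.mul gs_contDiff.continuous).aestronglyMeasurable
    (Filter.Eventually.of_forall fun z => ?_)
  rw [Real.norm_of_nonneg (mul_nonneg (norm_nonneg _) (gs_pos z).le)]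
  have h1 : ‖z‖ ≤ Real.exp (1/2 * ‖z‖ ^ 2) := by
    have := Real.add_one_le_exp (1/2 * ‖z‖ ^ 2)
    nlinarith [sq_nonneg (‖z‖ - 1)]
  calc ‖z‖ * gs z ≤ Real.exp (1/2 * ‖z‖ ^ 2) * gs z := by gcongr; exact (gs_pos z).le
    _ = _ := by
      unfold gs
      rw [← Real.exp_add]; congr 1; ring

lemma gs_pd_cont {N : ℕ} (j : Fin N) : Continuous (pd (gs (N := N)) j) :=
  (gs_contDiff.continuous_fderiv (by simp)).clm_apply continuous_const

lemma aux_coord {N : ℕ} (z : EuclideanSpace ℝ (Fin N)) (j : Fin N) : |z j| ≤ ‖z‖ := by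
  simpa using PiLp.norm_apply_le z j

lemma gs_pd_integrable {N : ℕ} (j : Fin N) : Integrable (pd (gs (N := N)) j) := by
  refine (gs_norm_integrable.const_mul 2).mono' (gs_pd_cont j).aestronglyMeasurable
    (Filter.Eventually.of_forall fun z => ?_)
  rw [gs_pd, Real.norm_eq_abs, abs_mul, abs_mul, abs_of_pos (gs_pos z)]
  have := mul_le_mul_of_nonneg_right (aux_coord z j) (gs_pos z).le
  norm_num
  linarith

lemma aux_bdd {N : ℕ} (v : EuclideanSpace ℝ (Fin N) → ℝ) (hv : Continuous v)
    (hvc : HasCompactSupport v) : ∃ M, ∀ x, |v x| ≤ M := by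
  obtain ⟨M, hM⟩ := hvc.exists_bound_of_continuous hv
  exact ⟨M, hM⟩

lemma aux_int_mul {N : ℕ} (k v : EuclideanSpace ℝ (Fin N) → ℝ) (hk : Integrable k) (hv : Continuous v)
    (hvc : HasCompactSupport v) (x : EuclideanSpace ℝ (Fin N)) (s : ℝ) :
    Integrable (fun z => k z * v (x - s • z)) := by
  obtain ⟨M, hM⟩ := aux_bdd v hv hvc
  exact hk.mul_bdd (c := M) (by fun_prop) (Filter.Eventually.of_forall fun z => hM _)

lemma aux_ibp2 {N : ℕ} (v : EuclideanSpace ℝ (Fin N) → ℝ) (hv : ContDiff ℝ 1 v)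
    (hvc : HasCompactSupport v) (i : Fin N) (x : EuclideanSpace ℝ (Fin N)) (s : ℝ) (hs : s ≠ 0) :
    s * ∫ z, gs z * pd v i (x - s • z) = ∫ z, pd gs i z * v (x - s • z) := by
  have hpd : ∀ z, pd (fun z => v (x - s • z)) i z = - s * pd v i (x - s • z) := by
    intro z
    unfold pd
    have h1 : HasFDerivAt (fun z : EuclideanSpace ℝ (Fin N) => x - s • z)
        (-(s • ContinuousLinearMap.id ℝ (EuclideanSpace ℝ (Fin N)))) z :=
      ((hasFDerivAt_id z).const_smul s).const_sub x
    have h2 := (hv.differentiable (by simp) (x - s • z)).hasFDerivAt.comp z h1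
    have h3 : fderiv ℝ (fun z => v (x - s • z)) z = _ := h2.fderiv
    rw [h3]
    simp
  have hcs : HasCompactSupport (fun z => v (x - s • z)) := by
    have := hvc.comp_homeomorph ((Homeomorph.smulOfNeZero s hs).trans (Homeomorph.subLeft x))
    exact this
  have hcd : ContDiff ℝ 1 (fun z => v (x - s • z)) := by fun_prop
  have := aux_ibp (fun z => v (x - s • z)) gs hcd hcs gs_contDiff i
  simp_rw [hpd] at this
  rw [← neg_inj, ← this, ← integral_const_mul, ← integral_neg]
  congr 1; funext z; ring

lemma aux_lap_contDiff {N : ℕ} (u : EuclideanSpace ℝ (Fin N) → ℝ) (n : ℕ)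
    (hu : ContDiff ℝ (n + 1 + 1 : ℕ) u) : ContDiff ℝ n (lap u) := by
  unfold lap
  exact ContDiff.sum fun i _ => aux_pd_contDiff _ _ (aux_pd_contDiff _ _ hu i) i

lemma aux_lap_supp {N : ℕ} (u : EuclideanSpace ℝ (Fin N) → ℝ)
    (hu : HasCompactSupport u) : HasCompactSupport (lap u) := by
  refine hu.of_isClosed_subset (isClosed_tsupport _) ?_
  apply closure_minimal _ (isClosed_tsupport _)
  intro x hx
  by_contra hxu
  apply hx
  unfold lap
  refine Finset.sum_eq_zero fun i _ => ?_
  have h1 : tsupport (pd (pd u i) i) ⊆ tsupport u :=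
    (tsupport_fderiv_apply_subset ℝ _).trans (tsupport_fderiv_apply_subset ℝ _)
  exact image_eq_zero_of_notMem_tsupport fun h => hxu (h1 h)

lemma aux_lap_comm {N : ℕ} (u : EuclideanSpace ℝ (Fin N) → ℝ)
    (hu : ContDiff ℝ 3 u) (i : Fin N) (y : EuclideanSpace ℝ (Fin N)) :
    lap (pd u i) y = pd (lap u) i y := by
  have h2 : ∀ j, ContDiff ℝ 2 (pd u j) := fun j => aux_pd_contDiff u 2 hu j
  have h1 : ∀ j, ContDiff ℝ 1 (pd (pd u j) j) := fun j => aux_pd_contDiff _ 1 (h2 j) j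
  have e : pd (lap u) i y = ∑ j, pd (pd (pd u j) j) i y := by
    unfold lap
    conv_lhs => unfold pd
    change fderiv ℝ (fun x => ∑ j, pd (pd u j) j x) y _ = _
    rw [fderiv_fun_sum (fun j _ => (h1 j).differentiable (by simp) y)]
    simp [pd]
  rw [e]
  unfold lap
  refine Finset.sum_congr rfl fun j _ => ?_
  rw [aux_pd_comm u (hu.of_le (by norm_num)) i j, aux_pd_comm _ (h2 j) i j]

lemma aux_deriv {N : ℕ} (u : EuclideanSpace ℝ (Fin N) → ℝ)
    (hu : ContDiff ℝ 3 u) (huc : HasCompactSupport u) (i : Fin N) (x : EuclideanSpace ℝ (Fin N))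
    (s : ℝ) (hs : s ≠ 0) :
    HasDerivAt (fun s : ℝ => ∫ z, gs z * pd u i (x - s • z))
      (1 / 2 * ∫ z, pd gs i z * lap u (x - s • z)) s := by
  have hv : ContDiff ℝ 2 (pd u i) := aux_pd_contDiff u 2 hu i
  have hvc := aux_pd_supp u huc i
  set v := pd u i with hvdef
  have hv1 : ContDiff ℝ 1 v := hv.of_le (by norm_num)
  have hfd : Continuous (fderiv ℝ v) := hv.continuous_fderiv (by simp)
  obtain ⟨M, hM⟩ := (hvc.fderiv (𝕜 := ℝ)).exists_bound_of_continuous hfd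
  have hgc : Continuous (gs (N := N)) := gs_contDiff.continuous
  have hvcont : Continuous v := hv.continuous
  have key := (hasDerivAt_integral_of_dominated_loc_of_deriv_le (μ := volume) (x₀ := s) (s := Set.univ)
    (F := fun s z => gs z * v (x - s • z))
    (F' := fun s z => gs z * fderiv ℝ v (x - s • z) (-z))
    (bound := fun z => M * (‖z‖ * gs z)) Filter.univ_mem
    (Filter.Eventually.of_forall fun s => by fun_prop)
    (aux_int_mul gs v gs_integrable hv.continuous hvc x s)
    (Continuous.aestronglyMeasurable (by fun_prop))
    (Filter.Eventually.of_forall fun z s _ => ?_)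
    (gs_norm_integrable.const_mul M)
    (Filter.Eventually.of_forall fun z s _ => ?_)).2
  · refine key.congr_deriv (Eq.symm ?_)
    have e1 : ∀ z, gs z * fderiv ℝ v (x - s • z) (-z) =
        ∑ j, 1 / 2 * (pd gs j z * pd v j (x - s • z)) := by
      intro z
      rw [aux_fderiv_sum, Finset.mul_sum]
      refine Finset.sum_congr rfl fun j _ => ?_
      rw [gs_pd]; simp; ring
    change _ = ∫ z, gs z * fderiv ℝ v (x - s • z) (-z)
    rw [show (fun z => gs z * fderiv ℝ v (x - s • z) (-z)) = _ from funext e1]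
    have hp1 : ∀ j, ContDiff ℝ 1 (pd v j) := fun j => aux_pd_contDiff v 1 hv j
    have hp1c : ∀ j, HasCompactSupport (pd v j) := fun j => aux_pd_supp v hvc j
    rw [integral_finsetSum _ (fun j _ => (aux_int_mul _ _ (gs_pd_integrable j)
      (hp1 j).continuous (hp1c j) x s).const_mul _)]
    simp_rw [integral_const_mul]
    rw [← Finset.mul_sum]
    congr 1
    have e2 : ∀ j, ∫ z, pd gs j z * pd v j (x - s • z) = s * ∫ z, gs z * pd (pd v j) j (x - s • z) :=
      fun j => (aux_ibp2 _ (hp1 j) (hp1c j) j x s hs).symm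
    simp_rw [e2]
    rw [← Finset.mul_sum, ← integral_finsetSum _ (fun j _ => (aux_int_mul _ _ gs_integrable
      (aux_pd_contDiff _ 0 (hp1 j) j).continuous (aux_pd_supp _ (hp1c j) j) x s))]
    rw [← aux_ibp2 (lap u) (aux_lap_contDiff u 1 hu) (aux_lap_supp u huc) i x s hs]
    congr 1
    congr 1
    funext z
    rw [← Finset.mul_sum, ← aux_lap_comm u hu i]
    rfl
  · rw [norm_mul, Real.norm_of_nonneg (gs_pos z).le]
    have h1 := (fderiv ℝ v (x - s • z)).le_opNorm (-z)
    rw [norm_neg] at h1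
    have h2 := mul_le_mul_of_nonneg_right (hM (x - s • z)) (norm_nonneg z)
    have h3 := mul_le_mul_of_nonneg_left (h1.trans h2) (gs_pos z).le
    linarith
  · apply HasDerivAt.const_mul
    have h1 : HasDerivAt (fun s : ℝ => x - s • z) (-z) s := by
      simpa using ((hasDerivAt_id s).smul_const z).const_sub x
    exact (hv1.differentiable (by simp) (x - s • z)).hasFDerivAt.comp_hasDerivAt s h1

lemma aux_cont_conv {N : ℕ} (k v : EuclideanSpace ℝ (Fin N) → ℝ) (hk : Integrable k) (hv : Continuous v)
    (hvc : HasCompactSupport v) (x : EuclideanSpace ℝ (Fin N)) :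
    Continuous (fun s : ℝ => ∫ z, k z * v (x - s • z)) := by
  obtain ⟨M, hM⟩ := aux_bdd v hv hvc
  refine continuous_of_dominated (bound := fun z => |k z| * M)
    (fun s => (aux_int_mul k v hk hv hvc x s).aestronglyMeasurable)
    (fun s => Filter.Eventually.of_forall fun z => ?_) (hk.abs.mul_const M)
    (Filter.Eventually.of_forall fun z => by fun_prop)
  rw [norm_mul, Real.norm_eq_abs, Real.norm_eq_abs]
  gcongr
  exact hM _

lemma aux_repr {N : ℕ} (u : EuclideanSpace ℝ (Fin N) → ℝ)
    (hu : ContDiff ℝ 3 u) (huc : HasCompactSupport u) (i : Fin N) (x : EuclideanSpace ℝ (Fin N))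
    (t : ℝ) (ht : 0 < t) :
    (∫ z, gs (N := N) z) * pd u i x = t⁻¹ * (∫ z, pd gs i z * u (x - t • z))
      - ∫ s in (0:ℝ)..t, (1 / 2 * ∫ z, pd gs i z * lap u (x - s • z)) := by
  have h1 : ContDiff ℝ 1 u := hu.of_le (by norm_num)
  have hpd := aux_pd_contDiff u 2 hu i
  rw [intervalIntegral.integral_eq_sub_of_hasDerivAt_of_le ht.le
    (aux_cont_conv gs (pd u i) gs_integrable hpd.continuous (aux_pd_supp u huc i) x).continuousOn
    (fun s hs => aux_deriv u hu huc i x s hs.1.ne')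
    ((continuous_const.mul (aux_cont_conv _ _ (gs_pd_integrable i)
      (aux_lap_contDiff u 1 hu).continuous (aux_lap_supp u huc) x)).intervalIntegrable _ _)]
  rw [← aux_ibp2 u h1 huc i x t ht.ne']
  simp only [zero_smul, sub_zero]
  rw [integral_mul_const]
  field_simp
  ring

lemma aux_grad {N : ℕ} (p : ℝ) (hp : 1 < p) (i : Fin N) :
    ∃ K : ℝ≥0, ∀ u : EuclideanSpace ℝ (Fin N) → ℝ, ContDiff ℝ 3 u → HasCompactSupport u →
      ∀ t : ℝ≥0, 0 < t →
      (∫⁻ x, ‖pd u i x‖ₑ ^ p) ^ (1 / p) ≤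
        ((K * t⁻¹ : ℝ≥0) : ℝ≥0∞) * (∫⁻ x, ‖u x‖ₑ ^ p) ^ (1 / p) +
        ((K * t : ℝ≥0) : ℝ≥0∞) * (∫⁻ x, ‖lap u x‖ₑ ^ p) ^ (1 / p) := by
  have hp0 : 0 < p := by linarith
  set Z : ℝ := ∫ z, gs (N := N) z with hZ
  have hZpos : 0 < Z := by
    rw [hZ, integral_pos_iff_support_of_nonneg (fun z => (gs_pos z).le) gs_integrable]
    have : Function.support (gs (N := N)) = Set.univ := by
      ext z; simp [(gs_pos z).ne']
    rw [this]
    exact Measure.measure_univ_pos.2 (NeZero.ne _)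
  set k : EuclideanSpace ℝ (Fin N) → ℝ≥0∞ := fun z => ‖pd gs i z‖ₑ with hk
  have hkm : Measurable k := (gs_pd_cont i).measurable.enorm
  have hkfin : ∫⁻ z, k z ≠ ⊤ := (gs_pd_integrable i).2.ne
  set K0 : ℝ≥0 := (∫⁻ z, k z).toNNReal with hK0
  have hK0e : ∫⁻ z, k z = (K0 : ℝ≥0∞) := (ENNReal.coe_toNNReal hkfin).symm
  set Zn : ℝ≥0 := Z.toNNReal with hZn
  have hZnpos : 0 < Zn := Real.toNNReal_pos.2 hZpos
  refine ⟨Zn⁻¹ * K0, fun u hu huc t ht => ?_⟩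
  have huC : Continuous u := hu.continuous
  have hlC : Continuous (lap u) := (aux_lap_contDiff u 1 hu).continuous
  have hlc : HasCompactSupport (lap u) := aux_lap_supp u huc
  set A : EuclideanSpace ℝ (Fin N) → ℝ≥0∞ := fun x => ∫⁻ z, k z * ‖u (x - (t:ℝ) • z)‖ₑ with hA
  set ν : Measure (ℝ × EuclideanSpace ℝ (Fin N)) := (volume.restrict (Set.Ioc (0:ℝ) t)).prod volume with hν
  set B : EuclideanSpace ℝ (Fin N) → ℝ≥0∞ := fun x => ∫⁻ y, k y.2 * ‖lap u (x - y.1 • y.2)‖ₑ ∂ν with hB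
  have hmA : Measurable (Function.uncurry fun (x z : EuclideanSpace ℝ (Fin N)) => ‖u (x - (t:ℝ) • z)‖ₑ) := by
    apply Measurable.enorm
    apply Continuous.measurable
    fun_prop
  have hmB : Measurable (Function.uncurry fun (x : EuclideanSpace ℝ (Fin N)) (y : ℝ × EuclideanSpace ℝ (Fin N)) => ‖lap u (x - y.1 • y.2)‖ₑ) := by
    apply Measurable.enorm
    apply Continuous.measurable
    fun_prop
  have hkm2 : Measurable (fun y : ℝ × EuclideanSpace ℝ (Fin N) => k y.2) := hkm.comp measurable_snd
  have hAm : Measurable A := by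
    apply Measurable.lintegral_prod_right
    exact (hkm.comp measurable_snd).mul hmA
  have hBm : Measurable B := by
    apply Measurable.lintegral_prod_right
    exact (hkm2.comp measurable_snd).mul hmB
  have hpt : ∀ x, (Zn : ℝ≥0∞) * ‖pd u i x‖ₑ ≤ ((t⁻¹ : ℝ≥0) : ℝ≥0∞) * A x + B x := by
    intro x
    have h := aux_repr u hu huc i x t (by exact_mod_cast ht)
    have e1 : (Zn : ℝ≥0∞) * ‖pd u i x‖ₑ = ‖Z * pd u i x‖ₑ := by
      rw [enorm_mul]
      congr 1
      rw [Real.enorm_of_nonneg hZpos.le]; rfl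
    rw [e1, h]
    refine (enorm_sub_le).trans ?_
    gcongr
    · rw [enorm_mul]
      gcongr
      · rw [Real.enorm_of_nonneg (by positivity), ENNReal.ofReal, Real.toNNReal_inv, Real.toNNReal_coe]
      · refine (enorm_integral_le_lintegral_enorm _).trans (le_of_eq ?_)
        simp [hA, hk, enorm_mul]
    · rw [intervalIntegral.integral_of_le (NNReal.coe_nonneg t)]
      refine (enorm_integral_le_lintegral_enorm _).trans ?_
      rw [hB]
      simp only []
      rw [hν, lintegral_prod]
      · gcongr with s
        rw [enorm_mul]
        calc _ ≤ 1 * ‖∫ z, pd gs i z * lap u (x - s • z)‖ₑ := by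
              gcongr
              rw [Real.enorm_of_nonneg (by norm_num)]
              rw [← ENNReal.ofReal_one]
              exact ENNReal.ofReal_le_ofReal (by norm_num)
          _ ≤ _ := by
              rw [one_mul]
              refine (enorm_integral_le_lintegral_enorm _).trans (le_of_eq ?_)
              simp [hk, enorm_mul]
      · exact (hkm2.mul (hmB.comp measurable_prodMk_left)).aemeasurable
  have hAp : (∫⁻ x, A x ^ p) ^ (1 / p) ≤ (K0 : ℝ≥0∞) * (∫⁻ x, ‖u x‖ₑ ^ p) ^ (1 / p) := by
    have := aux_mink volume volume p hp k hkm (fun x z => ‖u (x - (t:ℝ) • z)‖ₑ) hmA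
      (∫⁻ x, ‖u x‖ₑ ^ p) (fun z => (aux_trans p u _).le)
    rw [hK0e] at this
    refine (ENNReal.rpow_le_rpow this (by positivity)).trans (le_of_eq ?_)
    rw [ENNReal.mul_rpow_of_nonneg _ _ (by positivity), ← ENNReal.rpow_mul, mul_one_div_cancel hp0.ne',
      ENNReal.rpow_one]
  have hνk : ∫⁻ y, k y.2 ∂ν = ((K0 * t : ℝ≥0) : ℝ≥0∞) := by
    rw [hν, lintegral_prod _ hkm2.aemeasurable]
    simp [hK0e]
  have hBp : (∫⁻ x, B x ^ p) ^ (1 / p) ≤ ((K0 * t : ℝ≥0) : ℝ≥0∞) * (∫⁻ x, ‖lap u x‖ₑ ^ p) ^ (1 / p) := by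
    have := aux_mink volume ν p hp (fun y => k y.2) hkm2 (fun x y => ‖lap u (x - y.1 • y.2)‖ₑ) hmB
      (∫⁻ x, ‖lap u x‖ₑ ^ p) (fun z => (aux_trans p (lap u) _).le)
    rw [hνk] at this
    refine (ENNReal.rpow_le_rpow this (by positivity)).trans (le_of_eq ?_)
    rw [ENNReal.mul_rpow_of_nonneg _ _ (by positivity), ← ENNReal.rpow_mul, mul_one_div_cancel hp0.ne',
      ENNReal.rpow_one]
  have hcm : ∀ (c : ℝ≥0) (f : EuclideanSpace ℝ (Fin N) → ℝ≥0∞), Measurable f →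
      (∫⁻ x, ((c : ℝ≥0∞) * f x) ^ p) ^ (1 / p) = c * (∫⁻ x, f x ^ p) ^ (1 / p) := by
    intro c f hf
    simp_rw [ENNReal.mul_rpow_of_nonneg _ _ hp0.le]
    rw [lintegral_const_mul _ (hf.pow_const p), ENNReal.mul_rpow_of_nonneg _ _ (by positivity),
      ← ENNReal.rpow_mul, mul_one_div_cancel hp0.ne', ENNReal.rpow_one]
  have main : (Zn : ℝ≥0∞) * (∫⁻ x, ‖pd u i x‖ₑ ^ p) ^ (1 / p) ≤
      ((t⁻¹ : ℝ≥0) : ℝ≥0∞) * ((K0 : ℝ≥0∞) * (∫⁻ x, ‖u x‖ₑ ^ p) ^ (1 / p)) +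
      ((K0 * t : ℝ≥0) : ℝ≥0∞) * (∫⁻ x, ‖lap u x‖ₑ ^ p) ^ (1 / p) := by
    rw [← hcm Zn _ (aux_pd_contDiff u 2 hu i).continuous.measurable.enorm]
    calc _ ≤ (∫⁻ x, (((t⁻¹ : ℝ≥0) : ℝ≥0∞) * A x + B x) ^ p) ^ (1 / p) := by
          gcongr with x
          exact hpt x
      _ ≤ (∫⁻ x, (((t⁻¹ : ℝ≥0) : ℝ≥0∞) * A x) ^ p) ^ (1 / p) + (∫⁻ x, B x ^ p) ^ (1 / p) :=
          ENNReal.lintegral_Lp_add_le (hAm.const_mul _).aemeasurable hBm.aemeasurable hp.le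
      _ ≤ _ := by
          rw [hcm _ _ hAm]
          gcongr
  have hZ1 : ((Zn⁻¹ : ℝ≥0) : ℝ≥0∞) * (Zn : ℝ≥0∞) = 1 := by
    rw [← ENNReal.coe_mul, inv_mul_cancel₀ hZnpos.ne', ENNReal.coe_one]
  calc (∫⁻ x, ‖pd u i x‖ₑ ^ p) ^ (1 / p)
      = ((Zn⁻¹ : ℝ≥0) : ℝ≥0∞) * ((Zn : ℝ≥0∞) * (∫⁻ x, ‖pd u i x‖ₑ ^ p) ^ (1 / p)) := by
        rw [← mul_assoc, hZ1, one_mul]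
    _ ≤ _ := mul_le_mul' le_rfl main
    _ = _ := by
        push_cast
        ring

lemma aux_green {N : ℕ} (u Ψ : EuclideanSpace ℝ (Fin N) → ℝ) (hu : ContDiff ℝ 2 u)
    (huc : HasCompactSupport u) (hΨ : ContDiff ℝ 1 Ψ) :
    Integrable (fun x => lap u x * Ψ x + ∑ i, pd u i x * pd Ψ i x) ∧
    ∫ x, (lap u x * Ψ x + ∑ i, pd u i x * pd Ψ i x) = 0 := by
  have h1 : ∀ i, ContDiff ℝ 1 (pd u i) := fun i => aux_pd_contDiff u 1 hu i
  have h1c : ∀ i, HasCompactSupport (pd u i) := fun i => aux_pd_supp u huc i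
  have h2 : ∀ i, Continuous (pd (pd u i) i) := fun i => (aux_pd_contDiff _ 0 (h1 i) i).continuous
  have h2c : ∀ i, HasCompactSupport (pd (pd u i) i) := fun i => aux_pd_supp _ (h1c i) i
  have h3 : ∀ i, Continuous (pd Ψ i) := fun i => (aux_pd_contDiff Ψ 0 hΨ i).continuous
  have e : ∀ x, lap u x * Ψ x + ∑ i, pd u i x * pd Ψ i x =
      ∑ i, (Ψ x * pd (pd u i) i x + pd Ψ i x * pd u i x) := by
    intro x
    unfold lap
    rw [Finset.sum_mul, ← Finset.sum_add_distrib]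
    refine Finset.sum_congr rfl fun i _ => by ring
  have i1 : ∀ i, Integrable (fun x => Ψ x * pd (pd u i) i x) := fun i =>
    (hΨ.continuous.mul (h2 i)).integrable_of_hasCompactSupport (h2c i).mul_left
  have i2 : ∀ i, Integrable (fun x => pd Ψ i x * pd u i x) := fun i =>
    ((h3 i).mul (h1 i).continuous).integrable_of_hasCompactSupport (h1c i).mul_left
  simp_rw [e]
  have i12 : ∀ i, Integrable (fun x => Ψ x * pd (pd u i) i x + pd Ψ i x * pd u i x) :=
    fun i => (i1 i).add (i2 i)
  refine ⟨integrable_finsetSum _ fun i _ => i12 i, ?_⟩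
  rw [integral_finsetSum _ fun i _ => i12 i]
  refine Finset.sum_eq_zero fun i _ => ?_
  rw [integral_add (i1 i) (i2 i), aux_ibp (pd u i) Ψ (h1 i) (h1c i) hΨ i]
  ring

/-- Test function. -/
noncomputable def tst {N : ℕ} (κ r ε : ℝ) (u : EuclideanSpace ℝ (Fin N) → ℝ)
    (x : EuclideanSpace ℝ (Fin N)) : ℝ :=
  (1 + ‖x‖ ^ 2) ^ κ * ((u x ^ 2 + ε) ^ r * u x)

lemma tst_contDiff {N : ℕ} (κ r ε : ℝ) (hε : 0 < ε) (u : EuclideanSpace ℝ (Fin N) → ℝ)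
    (hu : ContDiff ℝ 1 u) : ContDiff ℝ 1 (tst κ r ε u) := by
  unfold tst
  apply ContDiff.mul
  · exact (contDiff_const.add (contDiff_norm_sq ℝ)).rpow_const_of_ne (fun x => by positivity)
  · exact (((hu.pow 2).add contDiff_const).rpow_const_of_ne (fun x => by positivity)).mul hu

lemma tst_pd {N : ℕ} (κ r ε : ℝ) (hε : 0 < ε) (u : EuclideanSpace ℝ (Fin N) → ℝ)
    (hu : ContDiff ℝ 1 u) (i : Fin N) (x : EuclideanSpace ℝ (Fin N)) :
    pd (tst κ r ε u) i x = (1 + ‖x‖ ^ 2) ^ κ *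
      ((u x ^ 2 + ε) ^ (r - 1) * ((2 * r + 1) * u x ^ 2 + ε) * pd u i x
        + 2 * κ / (1 + ‖x‖ ^ 2) * ((u x ^ 2 + ε) ^ r * u x) * x i) := by
  have hw : (0:ℝ) < 1 + ‖x‖ ^ 2 := by positivity
  have hq : 0 < u x ^ 2 + ε := by positivity
  have h1 := ((hasStrictFDerivAt_norm_sq x).hasFDerivAt.const_add 1).rpow_const (p := κ) (Or.inl hw.ne')
  have hu' := (hu.differentiable (by simp) x).hasFDerivAt
  have h2 := (((hu'.pow 2).add_const ε).rpow_const (p := r) (Or.inl hq.ne')).mul hu'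
  have h3 := h1.mul h2
  have h4 : fderiv ℝ (tst κ r ε u) x = _ := h3.fderiv
  unfold pd
  rw [h4]
  simp [EuclideanSpace.inner_single_right]
  rw [Real.rpow_sub_one hw.ne', Real.rpow_sub_one hq.ne']
  field_simp
  ring

lemma aux_pointwise (ω q m hd G2 S f V u D' M K : ℝ) (hω : 0 ≤ ω) (hq : 0 ≤ q) (hm : 0 < m)
    (hM : 0 < M) (hG : 0 ≤ G2) (hhd : m * q ≤ hd) (hT : (D' * S) ^ 2 ≤ M ^ 2 * G2)
    (hK : K = M ^ 2 / (4 * m)) :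
    ω * (q * |u|) * ((V - K) * |u| - |f|) ≤
      ω * q * (f * u + V * u ^ 2 - D' * S * u) + ω * hd * G2 := by
  have h1 : ω * (m * q) * G2 ≤ ω * hd * G2 := by gcongr
  have h2 : -(|f| * |u|) ≤ f * u := by rw [← abs_mul]; exact neg_abs_le _
  have h3 : D' * S * u ≤ m * G2 + K * u ^ 2 := by
    have a : m * (D' * S) ^ 2 / M ^ 2 ≤ m * G2 := by
      rw [div_le_iff₀ (by positivity)]
      nlinarith
    have b : D' * S * u ≤ m * (D' * S) ^ 2 / M ^ 2 + M ^ 2 / (4 * m) * u ^ 2 := by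
      have : m * (D' * S) ^ 2 / M ^ 2 + M ^ 2 / (4 * m) * u ^ 2 - D' * S * u
          = (2 * m * (D' * S) - M ^ 2 * u) ^ 2 / (4 * m * M ^ 2) := by
        field_simp; ring
      have h0 : 0 ≤ (2 * m * (D' * S) - M ^ 2 * u) ^ 2 / (4 * m * M ^ 2) := by positivity
      linarith
    rw [hK]; linarith
  have h4 : |u| * |u| = u ^ 2 := by rw [abs_mul_abs_self]; ring
  have h5 : ω * (q * |u|) * ((V - K) * |u| - |f|) = ω * q * ((V - K) * u ^ 2 - |f| * |u|) := by
    rw [← h4]; ring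
  rw [h5]
  have h6 : ω * q * ((V - K) * u ^ 2 - |f| * |u|) ≤
      ω * q * (f * u + V * u ^ 2 - D' * S * u + m * G2) := by
    apply mul_le_mul_of_nonneg_left _ (mul_nonneg hω hq)
    linarith
  linarith

lemma aux_rpow_drift (r α : ℝ) (hr : 0 ≤ r) (hα : 2 < α) : r ^ (α - 2) * r ≤ 1 + r ^ α := by
  rcases le_or_gt r 1 with h | h
  · have h1 : r ^ (α - 2) ≤ 1 := Real.rpow_le_one hr h (by linarith)
    have h2 : 0 ≤ r ^ α := Real.rpow_nonneg hr _
    have h3 : 0 ≤ r ^ (α - 2) := Real.rpow_nonneg hr _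
    nlinarith
  · have : r ^ (α - 2) * r = r ^ (α - 1) := by
      rw [← Real.rpow_add_one (by linarith)]; congr 1; ring
    rw [this]
    have := Real.rpow_le_rpow_of_exponent_le h.le (show α - 1 ≤ α by linarith)
    linarith

lemma aux_drift_coeff (r α b : ℝ) (hr : 0 ≤ r) (hα : 2 < α) :
    |b * r ^ (α - 2) * (1 + r ^ α)⁻¹| * r ≤ |b| := by
  have h2 : 0 ≤ r ^ α := Real.rpow_nonneg hr _
  have h3 : 0 ≤ r ^ (α - 2) := Real.rpow_nonneg hr _
  rw [abs_mul, abs_mul, abs_of_nonneg h3, abs_of_nonneg (by positivity : 0 ≤ (1 + r ^ α)⁻¹)]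
  have : |b| * r ^ (α - 2) * (1 + r ^ α)⁻¹ * r = |b| * ((r ^ (α - 2) * r) / (1 + r ^ α)) := by
    field_simp
  rw [this]
  apply mul_le_of_le_one_right (abs_nonneg _)
  rw [div_le_one (by positivity)]
  exact aux_rpow_drift r α hr hα

lemma aux_opcont {N : ℕ} (α β b c : ℝ) (hα : 2 < α) (hβ : α < β) (u : EuclideanSpace ℝ (Fin N) → ℝ)
    (hu : ContDiff ℝ 2 u) (huc : HasCompactSupport u) :
    Continuous (opAtilde α β b c u) ∧ HasCompactSupport (opAtilde α β b c u) := by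
  have hr : ∀ a : ℝ, 0 ≤ a → Continuous (fun x : EuclideanSpace ℝ (Fin N) => ‖x‖ ^ a) :=
    fun a ha => continuous_norm.rpow_const fun x => Or.inr ha
  have hi : Continuous (fun x : EuclideanSpace ℝ (Fin N) => (1 + ‖x‖ ^ α)⁻¹) :=
    (continuous_const.add (hr α (by linarith))).inv₀ fun x =>
      (add_pos_of_pos_of_nonneg one_pos (Real.rpow_nonneg (norm_nonneg x) α)).ne'
  have hp : ∀ i, Continuous (pd u i) := fun i => (aux_pd_contDiff u 1 hu i).continuous
  constructor
  · unfold opAtilde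
    have h1 := (aux_lap_contDiff u 0 hu).continuous
    have h2 := hr (α - 2) (by linarith)
    have h3 := hr β (by linarith)
    have h4 := hu.continuous
    fun_prop
  · refine huc.of_isClosed_subset (isClosed_tsupport _) ?_
    apply closure_minimal _ (isClosed_tsupport _)
    intro x hx
    by_contra hxu
    apply hx
    have e1 : u x = 0 := image_eq_zero_of_notMem_tsupport hxu
    have e2 : ∀ i, pd u i x = 0 := fun i =>
      image_eq_zero_of_notMem_tsupport fun h => hxu (tsupport_fderiv_apply_subset ℝ _ h)
    have e3 : lap u x = 0 := by
      unfold lap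
      refine Finset.sum_eq_zero fun i _ => ?_
      have h1 : tsupport (pd (pd u i) i) ⊆ tsupport u :=
        (tsupport_fderiv_apply_subset ℝ _).trans (tsupport_fderiv_apply_subset ℝ _)
      exact image_eq_zero_of_notMem_tsupport fun h => hxu (h1 h)
    simp [opAtilde, e1, e2, e3]

lemma aux_Vcont {N : ℕ} (α β c : ℝ) (hα : 2 < α) (hβ : α < β) :
    Continuous (fun x : EuclideanSpace ℝ (Fin N) => c * ‖x‖ ^ β * (1 + ‖x‖ ^ α)⁻¹) := by
  have hr : ∀ a : ℝ, 0 ≤ a → Continuous (fun x : EuclideanSpace ℝ (Fin N) => ‖x‖ ^ a) :=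
    fun a ha => continuous_norm.rpow_const fun x => Or.inr ha
  have hi : Continuous (fun x : EuclideanSpace ℝ (Fin N) => (1 + ‖x‖ ^ α)⁻¹) :=
    (continuous_const.add (hr α (by linarith))).inv₀ fun x =>
      (add_pos_of_pos_of_nonneg one_pos (Real.rpow_nonneg (norm_nonneg x) α)).ne'
  have h3 := hr β (by linarith)
  fun_prop

lemma aux_energy_eps {N : ℕ} (α β b c : ℝ) (hα : 2 < α) (hβ : α < β) (P κ m M K : ℝ)
    (hκ : 0 ≤ κ) (hm : 0 < m) (hm1 : m ≤ 1) (hmP : m ≤ P - 1) (hM : M = |b| + 2 * κ + 1)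
    (hK : K = M ^ 2 / (4 * m))
    (u : EuclideanSpace ℝ (Fin N) → ℝ)
    (hu : ContDiff ℝ 2 u) (huc : HasCompactSupport u) (ε : ℝ) (hε : 0 < ε) :
    ∫ x, (1 + ‖x‖ ^ 2) ^ κ * ((u x ^ 2 + ε) ^ ((P - 2) / 2) * |u x|) *
      ((c * ‖x‖ ^ β * (1 + ‖x‖ ^ α)⁻¹ - K) * |u x| - |opAtilde α β b c u x|) ≤ 0 := by
  have hu1 : ContDiff ℝ 1 u := hu.of_le (by norm_num)
  obtain ⟨hint, hzero⟩ := aux_green u (tst κ ((P - 2) / 2) ε u) hu huc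
    (tst_contDiff κ _ ε hε u hu1)
  rw [← hzero]
  obtain ⟨hfc, hfs⟩ := aux_opcont α β b c hα hβ u hu huc
  have hMpos : 0 < M := by rw [hM]; positivity
  refine integral_mono ?_ hint fun x => ?_
  · apply Continuous.integrable_of_hasCompactSupport
    · have hV := aux_Vcont (N := N) α β c hα hβ
      have hw : Continuous (fun x : EuclideanSpace ℝ (Fin N) => (1 + ‖x‖ ^ 2) ^ κ) :=
        Continuous.rpow_const (by fun_prop) fun x => Or.inr hκ
      have hq : Continuous (fun x : EuclideanSpace ℝ (Fin N) => (u x ^ 2 + ε) ^ ((P - 2) / 2)) :=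
        Continuous.rpow_const (by have := hu.continuous; fun_prop) fun x => Or.inl (by positivity)
      exact (hw.mul (hq.mul hu.continuous.abs)).mul (((hV.sub continuous_const).mul hu.continuous.abs).sub hfc.abs)
    · have : HasCompactSupport (fun x => |u x|) := huc.abs
      exact (this.mul_left.mul_left).mul_right
  · simp only []
    set w : ℝ := 1 + ‖x‖ ^ 2 with hw
    have hwpos : 0 < w := by positivity
    have hq0 : 0 < u x ^ 2 + ε := by positivity
    set r := (P - 2) / 2 with hr
    set S := ∑ i, x i * pd u i x with hS
    set G2 := ∑ i, pd u i x ^ 2 with hG2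
    set D := b * ‖x‖ ^ (α - 2) * (1 + ‖x‖ ^ α)⁻¹ with hD
    set V := c * ‖x‖ ^ β * (1 + ‖x‖ ^ α)⁻¹ with hV
    have hf : opAtilde α β b c u x = lap u x + D * S - V * u x := rfl
    set hd := (u x ^ 2 + ε) ^ (r - 1) * ((2 * r + 1) * u x ^ 2 + ε) with hhd
    have hcs : S ^ 2 ≤ ‖x‖ ^ 2 * G2 := by
      rw [hS, hG2, EuclideanSpace.real_norm_sq_eq]
      exact Finset.sum_mul_sq_le_sq_mul_sq _ _ _
    have hD' : |D - 2 * κ / w| * ‖x‖ ≤ M := by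
      have h1 := aux_drift_coeff ‖x‖ α b (norm_nonneg _) hα
      rw [← hD] at h1
      have h2 : |2 * κ / w| * ‖x‖ ≤ 2 * κ := by
        rw [abs_of_nonneg (by positivity), div_mul_eq_mul_div, div_le_iff₀ hwpos]
        apply mul_le_mul_of_nonneg_left _ (by positivity)
        nlinarith [sq_nonneg (‖x‖ - 1)]
      have h3 : |D - 2 * κ / w| * ‖x‖ ≤ (|D| + |2 * κ / w|) * ‖x‖ :=
        mul_le_mul_of_nonneg_right (abs_sub _ _) (norm_nonneg _)
      rw [hM]; linarith
    have hG0 : 0 ≤ G2 := Finset.sum_nonneg fun i _ => sq_nonneg _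
    have hT : ((D - 2 * κ / w) * S) ^ 2 ≤ M ^ 2 * G2 := by
      have h1 : (|D - 2 * κ / w| * ‖x‖) ^ 2 ≤ M ^ 2 := by gcongr
      rw [mul_pow, sq_abs] at h1
      calc ((D - 2 * κ / w) * S) ^ 2 = (D - 2 * κ / w) ^ 2 * S ^ 2 := by ring
        _ ≤ (D - 2 * κ / w) ^ 2 * (‖x‖ ^ 2 * G2) := by gcongr
        _ = (D - 2 * κ / w) ^ 2 * ‖x‖ ^ 2 * G2 := by ring
        _ ≤ _ := by gcongr
    have hhdm : m * (u x ^ 2 + ε) ^ r ≤ hd := by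
      have : (u x ^ 2 + ε) ^ r = (u x ^ 2 + ε) ^ (r - 1) * (u x ^ 2 + ε) := by
        rw [← Real.rpow_add_one hq0.ne']; congr 1; ring
      rw [hhd, this]
      have h1 : 0 ≤ (u x ^ 2 + ε) ^ (r - 1) := by positivity
      have h2 : m * (u x ^ 2 + ε) ≤ (2 * r + 1) * u x ^ 2 + ε := by
        have : 2 * r + 1 = P - 1 := by rw [hr]; ring
        rw [this]
        nlinarith [sq_nonneg (u x)]
      calc _ = (u x ^ 2 + ε) ^ (r - 1) * (m * (u x ^ 2 + ε)) := by ring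
        _ ≤ _ := by gcongr
    have hsum : ∑ i, pd u i x * pd (tst κ r ε u) i x =
        w ^ κ * (hd * G2 + 2 * κ / w * ((u x ^ 2 + ε) ^ r * u x) * S) := by
      simp_rw [tst_pd κ r ε hε u hu1]
      rw [hG2, hS, Finset.mul_sum, Finset.mul_sum, ← Finset.sum_add_distrib, Finset.mul_sum]
      refine Finset.sum_congr rfl fun i _ => ?_
      rw [hhd]; ring
    rw [hsum]
    have hp := aux_pointwise (w ^ κ) ((u x ^ 2 + ε) ^ r) m hd G2 S (opAtilde α β b c u x) V (u x)
      (D - 2 * κ / w) M K (by positivity) (by positivity) hm hMpos hG0 hhdm hT hK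
    refine hp.trans (le_of_eq ?_)
    rw [hf]
    unfold tst
    rw [← hw]
    ring

lemma aux_energy {N : ℕ} (α β b c : ℝ) (hα : 2 < α) (hβ : α < β) (P κ m M K : ℝ) (hP : 1 < P)
    (hκ : 0 ≤ κ) (hm : 0 < m) (hm1 : m ≤ 1) (hmP : m ≤ P - 1) (hM : M = |b| + 2 * κ + 1)
    (hK : K = M ^ 2 / (4 * m))
    (u : EuclideanSpace ℝ (Fin N) → ℝ)
    (hu : ContDiff ℝ 2 u) (huc : HasCompactSupport u) :
    ∫ x, (1 + ‖x‖ ^ 2) ^ κ * |u x| ^ (P - 1) *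
      ((c * ‖x‖ ^ β * (1 + ‖x‖ ^ α)⁻¹ - K) * |u x| - |opAtilde α β b c u x|) ≤ 0 := by
  obtain ⟨hfc, hfs⟩ := aux_opcont α β b c hα hβ u hu huc
  have hV := aux_Vcont (N := N) α β c hα hβ
  have hw : Continuous (fun x : EuclideanSpace ℝ (Fin N) => (1 + ‖x‖ ^ 2) ^ κ) :=
    Continuous.rpow_const (by fun_prop) fun x => Or.inr hκ
  have huC := hu.continuous
  have hqc : ∀ (ε : ℝ) (a : ℝ), 0 < ε → Continuous (fun x : EuclideanSpace ℝ (Fin N) => (u x ^ 2 + ε) ^ a) :=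
    fun ε a hε => Continuous.rpow_const (by fun_prop) fun x => Or.inl (by positivity)
  have hlast : Continuous (fun x => (c * ‖x‖ ^ β * (1 + ‖x‖ ^ α)⁻¹ - K) * |u x| - |opAtilde α β b c u x|) :=
    ((hV.sub continuous_const).mul huC.abs).sub hfc.abs
  have hlastc : HasCompactSupport (fun x => (c * ‖x‖ ^ β * (1 + ‖x‖ ^ α)⁻¹ - K) * |u x| - |opAtilde α β b c u x|) := by
    have h1 : HasCompactSupport (fun x => |u x|) := huc.abs
    have h2 : HasCompactSupport (fun x => |opAtilde α β b c u x|) := hfs.abs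
    exact (h1.mul_left (f := fun x => (c * ‖x‖ ^ β * (1 + ‖x‖ ^ α)⁻¹ - K))).sub h2
  have key := tendsto_integral_of_dominated_convergence (μ := (volume : Measure (EuclideanSpace ℝ (Fin N))))
    (F := fun (n : ℕ) x => (1 + ‖x‖ ^ 2) ^ κ * ((u x ^ 2 + 1 / ((n:ℝ) + 1)) ^ ((P - 2) / 2) * |u x|) *
      ((c * ‖x‖ ^ β * (1 + ‖x‖ ^ α)⁻¹ - K) * |u x| - |opAtilde α β b c u x|))
    (f := fun x => (1 + ‖x‖ ^ 2) ^ κ * |u x| ^ (P - 1) *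
      ((c * ‖x‖ ^ β * (1 + ‖x‖ ^ α)⁻¹ - K) * |u x| - |opAtilde α β b c u x|))
    (fun x => (1 + ‖x‖ ^ 2) ^ κ * (u x ^ 2 + 1) ^ ((P - 1) / 2) *
      |((c * ‖x‖ ^ β * (1 + ‖x‖ ^ α)⁻¹ - K) * |u x| - |opAtilde α β b c u x|)|)
    (fun n => ((hw.mul ((hqc _ _ (by positivity)).mul huC.abs)).mul hlast).aestronglyMeasurable)
    (((hw.mul (hqc 1 _ one_pos)).mul hlast.abs).integrable_of_hasCompactSupport
      (HasCompactSupport.mul_left (hlastc.abs)))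
    (fun n => Filter.Eventually.of_forall fun x => ?_)
    (Filter.Eventually.of_forall fun x => ?_)
  · refine le_of_tendsto key (Filter.Eventually.of_forall fun n => ?_)
    exact aux_energy_eps α β b c hα hβ P κ m M K hκ hm hm1 hmP hM hK u hu huc _ (by positivity)
  · rw [norm_mul, Real.norm_eq_abs, Real.norm_eq_abs]
    apply mul_le_mul_of_nonneg_right _ (abs_nonneg _)
    rw [abs_of_nonneg (by positivity)]
    apply mul_le_mul_of_nonneg_left _ (by positivity)
    set ε : ℝ := 1 / ((n:ℝ) + 1) with hε
    have hε0 : 0 < ε := by positivity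
    have hε1 : ε ≤ 1 := by
      rw [hε, div_le_one (by positivity)]
      have : (0:ℝ) ≤ n := Nat.cast_nonneg n
      linarith
    have hq0 : 0 < u x ^ 2 + ε := by positivity
    have h1 : |u x| ≤ (u x ^ 2 + ε) ^ ((1:ℝ) / 2) := by
      rw [← Real.sqrt_eq_rpow]
      exact Real.abs_le_sqrt (by linarith)
    calc (u x ^ 2 + ε) ^ ((P - 2) / 2) * |u x|
        ≤ (u x ^ 2 + ε) ^ ((P - 2) / 2) * (u x ^ 2 + ε) ^ ((1:ℝ) / 2) := by gcongr
      _ = (u x ^ 2 + ε) ^ ((P - 1) / 2) := by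
          rw [← Real.rpow_add hq0]; congr 1; ring
      _ ≤ _ := Real.rpow_le_rpow hq0.le (by linarith) (by linarith)
  · apply Filter.Tendsto.mul_const
    apply Filter.Tendsto.const_mul
    by_cases h : u x = 0
    · simp [h, Real.zero_rpow (by linarith : P - 1 ≠ 0)]
    · have hpos : 0 < |u x| := abs_pos.2 h
      have e : |u x| ^ (P - 1) = (u x ^ 2 + 0) ^ ((P - 2) / 2) * |u x| := by
        rw [add_zero, ← sq_abs, ← Real.rpow_natCast, ← Real.rpow_mul hpos.le,
          ← Real.rpow_add_one hpos.ne']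
        congr 1; push_cast; ring
      rw [e]
      apply Filter.Tendsto.mul_const
      apply Filter.Tendsto.rpow_const
      · exact tendsto_const_nhds.add tendsto_one_div_add_atTop_nhds_zero_nat
      · left; positivity

lemma aux_young (P δ y z : ℝ) (hP : 1 < P) (hδ : 0 < δ) (hy : 0 ≤ y) (hz : 0 ≤ z) :
    z * y ^ (P - 1) ≤ δ * y ^ P + (δ⁻¹) ^ (P - 1) * z ^ P := by
  have e : ∀ t : ℝ, 0 ≤ t → t ^ P = t * t ^ (P - 1) := by
    intro t ht
    have := Real.rpow_one_add' ht (y := P - 1) (by linarith)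
    rw [← this]; congr 1; ring
  rcases le_total z (δ * y) with h | h
  · have h1 : z * y ^ (P - 1) ≤ δ * y * y ^ (P - 1) := by gcongr
    have h2 : 0 ≤ (δ⁻¹) ^ (P - 1) * z ^ P := by positivity
    rw [e y hy]; linarith
  · have h1 : y ≤ δ⁻¹ * z := by
      rw [inv_mul_eq_div, le_div_iff₀ hδ]; linarith
    have h2 : y ^ (P - 1) ≤ (δ⁻¹ * z) ^ (P - 1) := Real.rpow_le_rpow hy h1 (by linarith)
    rw [Real.mul_rpow (by positivity) hz] at h2
    have h3 : z * y ^ (P - 1) ≤ z * ((δ⁻¹) ^ (P - 1) * z ^ (P - 1)) := by gcongr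
    have h4 : 0 ≤ δ * y ^ P := by positivity
    rw [e z hz]; linarith

lemma aux_Vlow (r α β c : ℝ) (hr : 0 ≤ r) (hα : 2 < α) (hβ : α < β) (hc : 0 < c) :
    (c / 2 * (2⁻¹) ^ ((β - α) / 2)) * (1 + r ^ 2) ^ ((β - α) / 2) - c / 2
      ≤ c * r ^ β * (1 + r ^ α)⁻¹ := by
  have hg : 0 ≤ (β - α) / 2 := by linarith
  have hra : 0 ≤ r ^ α := Real.rpow_nonneg hr _
  rw [mul_assoc, ← Real.mul_rpow (by norm_num) (by positivity)]
  rcases le_or_gt r 1 with h | h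
  · have h1 : (2⁻¹ * (1 + r ^ 2)) ^ ((β - α) / 2) ≤ 1 :=
      Real.rpow_le_one (by positivity) (by nlinarith) hg
    have h2 : 0 ≤ c * r ^ β * (1 + r ^ α)⁻¹ := by
      have := Real.rpow_nonneg hr β
      positivity
    nlinarith
  · have hr0 : 0 < r := by linarith
    have h1 : (2⁻¹ * (1 + r ^ 2)) ^ ((β - α) / 2) ≤ (r ^ 2) ^ ((β - α) / 2) :=
      Real.rpow_le_rpow (by positivity) (by nlinarith) hg
    have h2 : (r ^ 2) ^ ((β - α) / 2) = r ^ (β - α) := by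
      rw [← Real.rpow_natCast, ← Real.rpow_mul hr]; congr 1; push_cast; ring
    rw [h2] at h1
    have h3 : r ^ β = r ^ (β - α) * r ^ α := by
      rw [← Real.rpow_add hr0]; congr 1; ring
    have h4 : 1 ≤ r ^ α := Real.one_le_rpow h.le (by linarith)
    have h5 : (1:ℝ) / 2 ≤ r ^ α * (1 + r ^ α)⁻¹ := by
      rw [← div_eq_mul_inv, div_le_div_iff₀ (by norm_num) (by positivity)]
      linarith
    have h6 : 0 ≤ r ^ (β - α) := by positivity
    calc _ ≤ c / 2 * r ^ (β - α) := by nlinarith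
      _ = c * r ^ (β - α) * (1 / 2) := by ring
      _ ≤ c * r ^ (β - α) * (r ^ α * (1 + r ^ α)⁻¹) := by gcongr
      _ = _ := by rw [h3]; ring

lemma aux_Vup (r α β c : ℝ) (hr : 0 ≤ r) (hα : 2 < α) (hβ : α < β) (hc : 0 < c) :
    c * r ^ β * (1 + r ^ α)⁻¹ ≤ c * (1 + r ^ 2) ^ ((β - α) / 2) := by
  have hra : 0 ≤ r ^ α := Real.rpow_nonneg hr _
  have h2 : (r ^ 2) ^ ((β - α) / 2) = r ^ (β - α) := by
    rw [← Real.rpow_natCast, ← Real.rpow_mul hr]; congr 1; push_cast; ring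
  have h3 : r ^ β = r ^ (β - α) * r ^ α := by
    rw [← Real.rpow_add' hr (by linarith)]; congr 1; ring
  have h1 : r ^ (β - α) ≤ (1 + r ^ 2) ^ ((β - α) / 2) := by
    rw [← h2]
    exact Real.rpow_le_rpow (by positivity) (by linarith) (by linarith)
  have h5 : r ^ α * (1 + r ^ α)⁻¹ ≤ 1 := by
    rw [← div_eq_mul_inv, div_le_one (by positivity)]
    linarith
  have h6 : 0 ≤ r ^ (β - α) := Real.rpow_nonneg hr _
  calc _ = c * (r ^ (β - α) * (r ^ α * (1 + r ^ α)⁻¹)) := by rw [h3]; ring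
    _ ≤ c * (r ^ (β - α) * 1) := by gcongr
    _ ≤ _ := by rw [mul_one]; gcongr

lemma aux_lint {N : ℕ} (g : EuclideanSpace ℝ (Fin N) → ℝ) (hg : Continuous g)
    (hgc : HasCompactSupport g) (P : ℝ) (hP : 0 < P) :
    Integrable (fun x => |g x| ^ P) ∧ ∫⁻ x, ‖g x‖ₑ ^ P = ENNReal.ofReal (∫ x, |g x| ^ P) := by
  have hi : Integrable (fun x => |g x| ^ P) := by
    apply Continuous.integrable_of_hasCompactSupport
    · exact hg.abs.rpow_const fun x => Or.inr hP.le
    · exact hgc.comp_left (g := fun t : ℝ => |t| ^ P) (by simp [Real.zero_rpow hP.ne'])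
  refine ⟨hi, ?_⟩
  rw [ofReal_integral_eq_lintegral_ofReal hi (Filter.Eventually.of_forall fun x => by positivity)]
  congr 1
  funext x
  rw [← ENNReal.ofReal_rpow_of_nonneg (abs_nonneg _) hP.le, ← Real.enorm_eq_ofReal_abs]

lemma aux_wpt (α β c P K : ℝ) (hα : 2 < α) (hβ : α < β) (hc : 0 < c) (hP : 1 < P) (hK : 0 ≤ K) :
    ∃ d A : ℝ, 0 < d ∧ 0 ≤ A ∧ ∀ r a f : ℝ, 0 ≤ r → 0 ≤ a → 0 ≤ f →
      d * ((1 + r ^ 2) ^ ((β - α) / 2) * a) ^ P - A * (f ^ P + a ^ P) ≤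
      (1 + r ^ 2) ^ ((β - α) / 2 * (P - 1)) * a ^ (P - 1) *
        ((c * r ^ β * (1 + r ^ α)⁻¹ - K) * a - f) := by
  obtain ⟨c1, hc1⟩ : ∃ c1 : ℝ, c1 = c / 2 * (2⁻¹) ^ ((β - α) / 2) := ⟨_, rfl⟩
  have hc10 : 0 < c1 := by rw [hc1]; positivity
  obtain ⟨C0, hC0⟩ : ∃ C0 : ℝ, C0 = c / 2 + K := ⟨_, rfl⟩
  have hC00 : 0 ≤ C0 := by rw [hC0]; positivity
  obtain ⟨δ, hδ⟩ : ∃ δ : ℝ, δ = c1 / 4 := ⟨_, rfl⟩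
  have hδ0 : 0 < δ := by rw [hδ]; positivity
  obtain ⟨A, hA⟩ : ∃ A : ℝ, A = (δ⁻¹) ^ (P - 1) := ⟨_, rfl⟩
  have hA0 : 0 ≤ A := by rw [hA]; positivity
  have hCP : 0 ≤ C0 ^ P := by positivity
  refine ⟨c1 / 2, A + A * C0 ^ P, by positivity, by positivity, fun r a f hr ha0 hf0 => ?_⟩
  have hV := aux_Vlow r α β c hr hα hβ hc
  rw [← hc1] at hV
  obtain ⟨W, hW⟩ : ∃ W : ℝ, W = (1 + r ^ 2) ^ ((β - α) / 2) := ⟨_, rfl⟩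
  have hW0 : 0 ≤ W := by rw [hW]; positivity
  rw [Real.rpow_mul (by positivity)]
  rw [← hW] at hV ⊢
  rw [← Real.mul_rpow hW0 ha0]
  obtain ⟨y, hy⟩ : ∃ y : ℝ, y = W * a := ⟨_, rfl⟩
  have hy0 : 0 ≤ y := by rw [hy]; exact mul_nonneg hW0 ha0
  rw [← hy]
  have hyP : y ^ P = y * y ^ (P - 1) := by
    have := Real.rpow_one_add' hy0 (y := P - 1) (by linarith)
    rw [← this]; congr 1; ring
  have y1 := aux_young P δ y f hP hδ0 hy0 hf0
  have y2 := aux_young P δ y (C0 * a) hP hδ0 hy0 (by positivity)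
  rw [Real.mul_rpow hC00 ha0, ← hA] at y2
  rw [← hA] at y1
  have hyp : 0 ≤ y ^ (P - 1) := by positivity
  have h1 : c1 * y - C0 * a - f ≤ (c * r ^ β * (1 + r ^ α)⁻¹ - K) * a - f := by
    have := mul_le_mul_of_nonneg_right hV ha0
    rw [hy, hC0]
    linarith
  have h2 := mul_le_mul_of_nonneg_left h1 hyp
  refine le_trans ?_ h2
  have h3 : y ^ (P - 1) * (c1 * y - C0 * a - f) =
    c1 * y ^ P - C0 * a * y ^ (P - 1) - f * y ^ (P - 1) := by rw [hyP]; ring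
  rw [h3]
  have h4 : c1 * y ^ P = 2 * (δ * y ^ P) + c1 / 2 * y ^ P := by rw [hδ]; ring
  have h5 : 0 ≤ A * a ^ P := by positivity
  have h6 : 0 ≤ A * C0 ^ P * f ^ P := by positivity
  linarith

lemma aux_weighted {N : ℕ} (α β b c : ℝ) (hα : 2 < α) (hβ : α < β) (hc : 0 < c) (P : ℝ) (hP : 1 < P) :
    ∃ C : ℝ≥0, ∀ u : EuclideanSpace ℝ (Fin N) → ℝ, ContDiff ℝ 2 u → HasCompactSupport u →
      (∫⁻ x, ‖(1 + ‖x‖ ^ 2) ^ ((β - α) / 2) * u x‖ₑ ^ P) ^ (1 / P) ≤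
        (C : ℝ≥0∞) * ((∫⁻ x, ‖opAtilde α β b c u x‖ₑ ^ P) ^ (1 / P)
          + (∫⁻ x, ‖u x‖ₑ ^ P) ^ (1 / P)) := by
  have hP0 : 0 < P := by linarith
  have hγ0 : 0 < (β - α) / 2 := by linarith
  obtain ⟨κ, hκ⟩ : ∃ κ : ℝ, κ = (β - α) / 2 * (P - 1) := ⟨_, rfl⟩
  have hκ0 : 0 ≤ κ := by rw [hκ]; exact mul_nonneg hγ0.le (by linarith)
  obtain ⟨m, hm⟩ : ∃ m : ℝ, m = min 1 (P - 1) := ⟨_, rfl⟩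
  have hm0 : 0 < m := by rw [hm]; exact lt_min one_pos (by linarith)
  obtain ⟨M, hM⟩ : ∃ M : ℝ, M = |b| + 2 * κ + 1 := ⟨_, rfl⟩
  obtain ⟨K, hK⟩ : ∃ K : ℝ, K = M ^ 2 / (4 * m) := ⟨_, rfl⟩
  have hK0 : 0 ≤ K := by rw [hK]; positivity
  obtain ⟨d, A, hd, hA, hwpt⟩ := aux_wpt α β c P K hα hβ hc hP hK0
  refine ⟨((d⁻¹ * A) ^ (1 / P)).toNNReal, fun u hu huc => ?_⟩
  obtain ⟨hfc, hfs⟩ := aux_opcont α β b c hα hβ u hu huc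
  have hE := aux_energy α β b c hα hβ P κ m M K hP hκ0 hm0 (by rw [hm]; exact min_le_left _ _)
    (by rw [hm]; exact min_le_right _ _) hM hK u hu huc
  have hWc : ∀ s : ℝ, 0 ≤ s → Continuous (fun x : EuclideanSpace ℝ (Fin N) => (1 + ‖x‖ ^ 2) ^ s) :=
    fun s hs => Continuous.rpow_const (by fun_prop) fun x => Or.inr hs
  have hV := aux_Vcont (N := N) α β c hα hβ
  generalize opAtilde α β b c u = f at hfc hfs hE ⊢
  have hWs : HasCompactSupport
      (fun x : EuclideanSpace ℝ (Fin N) => (1 + ‖x‖ ^ 2) ^ ((β - α) / 2) * u x) :=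
    HasCompactSupport.mul_left
      (f := fun x : EuclideanSpace ℝ (Fin N) => (1 + ‖x‖ ^ 2) ^ ((β - α) / 2)) huc
  have hWuc : Continuous
      (fun x : EuclideanSpace ℝ (Fin N) => (1 + ‖x‖ ^ 2) ^ ((β - α) / 2) * u x) :=
    (hWc _ hγ0.le).mul hu.continuous
  obtain ⟨i1, e1⟩ := aux_lint
    (fun x : EuclideanSpace ℝ (Fin N) => (1 + ‖x‖ ^ 2) ^ ((β - α) / 2) * u x) hWuc hWs P hP0
  obtain ⟨i2, e2⟩ := aux_lint f hfc hfs P hP0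
  obtain ⟨i3, e3⟩ := aux_lint u hu.continuous huc P hP0
  have hreal : ∫ x, |(1 + ‖x‖ ^ 2) ^ ((β - α) / 2) * u x| ^ P ≤
      (d⁻¹ * A) * ((∫ x, |f x| ^ P) + ∫ x, |u x| ^ P) := by
    have hint2 : Integrable (fun x => d * |(1 + ‖x‖ ^ 2) ^ ((β - α) / 2) * u x| ^ P
        - A * (|f x| ^ P + |u x| ^ P)) := (i1.const_mul d).sub ((i2.add i3).const_mul A)
    have hle : ∫ x, (d * |(1 + ‖x‖ ^ 2) ^ ((β - α) / 2) * u x| ^ P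
        - A * (|f x| ^ P + |u x| ^ P)) ≤ 0 := by
      refine le_trans (integral_mono hint2 ?_ fun x => ?_) hE
      · apply Continuous.integrable_of_hasCompactSupport
        · exact ((hWc κ hκ0).mul (hu.continuous.abs.rpow_const fun x => Or.inr (by linarith))).mul
            (((hV.sub continuous_const).mul hu.continuous.abs).sub hfc.abs)
        · have h1 : HasCompactSupport (fun x => |u x|) := huc.abs
          have h2 : HasCompactSupport (fun x => |f x|) := hfs.abs
          exact ((h1.mul_left (f := fun x => (c * ‖x‖ ^ β * (1 + ‖x‖ ^ α)⁻¹ - K))).sub h2).mul_left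
      · have := hwpt ‖x‖ |u x| |f x| (norm_nonneg _) (abs_nonneg _) (abs_nonneg _)
        rw [← hκ] at this
        beta_reduce
        rw [abs_mul, abs_of_nonneg (by positivity : (0:ℝ) ≤ (1 + ‖x‖ ^ 2) ^ ((β - α) / 2))]
        exact this
    have i23 : Integrable (fun x => A * (|f x| ^ P + |u x| ^ P)) := (i2.add i3).const_mul A
    rw [integral_sub (i1.const_mul d) i23, integral_const_mul, integral_const_mul,
      integral_add i2 i3] at hle
    rw [mul_assoc, inv_mul_eq_div, le_div_iff₀ hd]
    linarith
  have hn2 : 0 ≤ ∫ x, |f x| ^ P := integral_nonneg fun x => by positivity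
  have hn3 : 0 ≤ ∫ x, |u x| ^ P := integral_nonneg fun x => by positivity
  have hdA : 0 ≤ d⁻¹ * A := by positivity
  have h1 : ∫⁻ x, ‖(1 + ‖x‖ ^ 2) ^ ((β - α) / 2) * u x‖ₑ ^ P ≤
      ENNReal.ofReal (d⁻¹ * A) * ((∫⁻ x, ‖f x‖ₑ ^ P) + ∫⁻ x, ‖u x‖ₑ ^ P) := by
    rw [e1, e2, e3, ← ENNReal.ofReal_add hn2 hn3, ← ENNReal.ofReal_mul hdA]
    exact ENNReal.ofReal_le_ofReal hreal
  have hP1 : 0 ≤ 1 / P := by positivity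
  calc _ ≤ (ENNReal.ofReal (d⁻¹ * A) * ((∫⁻ x, ‖f x‖ₑ ^ P) + ∫⁻ x, ‖u x‖ₑ ^ P)) ^ (1 / P) :=
        ENNReal.rpow_le_rpow h1 hP1
    _ = ENNReal.ofReal ((d⁻¹ * A) ^ (1 / P)) *
        ((∫⁻ x, ‖f x‖ₑ ^ P) + ∫⁻ x, ‖u x‖ₑ ^ P) ^ (1 / P) := by
        rw [ENNReal.mul_rpow_of_nonneg _ _ hP1, ENNReal.ofReal_rpow_of_nonneg hdA hP1]
    _ ≤ _ := by
        apply mul_le_mul' le_rfl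
        exact ENNReal.rpow_add_le_add_rpow _ _ hP1 (by rw [div_le_one hP0]; exact hP.le)
lemma aux_absorb_s5 {N : ℕ} (L F U B c C : ℝ≥0) (K : Fin N → ℝ≥0) (t : ℝ≥0)
    (ht : t = (2 * (B * ∑ i, K i + 1))⁻¹)
    (h : L ≤ F + ∑ i, B * (K i * t⁻¹ * U + K i * t * L) + c * (C * (F + U))) :
    L ≤ (2 * (1 + c * C + B * (∑ i, K i) * t⁻¹)) * (F + U) := by
  obtain ⟨S, hS⟩ : ∃ S : ℝ≥0, S = ∑ i, K i := ⟨_, rfl⟩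
  have e : ∑ i, B * (K i * t⁻¹ * U + K i * t * L) = B * S * t⁻¹ * U + (B * S * t) * L := by
    rw [hS, ← Finset.mul_sum, Finset.sum_add_distrib, ← Finset.sum_mul, ← Finset.sum_mul,
      ← Finset.sum_mul, ← Finset.sum_mul]
    ring
  rw [e] at h
  rw [← hS] at ht ⊢
  have h2 : B * S * t ≤ 1 / 2 := by
    rw [ht, ← div_eq_mul_inv, div_le_div_iff₀ (by positivity) (by norm_num)]
    have : B * S ≤ B * S + 1 := le_self_add
    nlinarith
  have h3 : (B * S * t) * L ≤ 1 / 2 * L := by gcongr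
  obtain ⟨X, hX⟩ : ∃ X : ℝ≥0, X = B * S * t⁻¹ := ⟨_, rfl⟩
  rw [← hX] at h ⊢
  obtain ⟨Y, hY⟩ : ∃ Y : ℝ≥0, Y = c * C := ⟨_, rfl⟩
  rw [← mul_assoc, ← hY] at h
  rw [← hY]
  have h4 : L ≤ F + (X * U + 1 / 2 * L) + Y * (F + U) :=
    h.trans (by gcongr)
  rw [← NNReal.coe_le_coe] at h4 ⊢
  push_cast at h4 ⊢
  have := mul_nonneg X.2 F.2
  have := U.2
  have := F.2
  simp only [NNReal.val_eq_coe] at *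
  nlinarith

/-- global estimate. Assume `β > α`. For every `1 < p < ∞` there is a
constant `C > 0` such that for every `u ∈ C_c^∞(ℝ^N)`:
`‖Δu‖_{L^p(ℝ^N)} ≤ C (‖Ãu‖_{L^p(ℝ^N)} + ‖u‖_{L^p(ℝ^N)})`. -/
theorem stmt5 (N : ℕ) (hN : 2 < N) (α β b c : ℝ) (hα : 2 < α) (hβ : α < β) (hc : 0 < c)
    (p : ℝ≥0∞) (hp1 : 1 < p) (hp2 : p ≠ ⊤) :
    ∃ C : ℝ≥0, 0 < C ∧
      ∀ u : EuclideanSpace ℝ (Fin N) → ℝ, ContDiff ℝ (⊤ : ℕ∞) u → HasCompactSupport u →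
        eLpNorm (fun x => lap u x) p volume ≤
          (C : ℝ≥0∞) * (eLpNorm (fun x => opAtilde α β b c u x) p volume
            + eLpNorm u p volume) := by
  have hp0 : p ≠ 0 := (zero_lt_one.trans hp1).ne'
  have hP : 1 < p.toReal := by
    have := (ENNReal.toReal_lt_toReal ENNReal.one_ne_top hp2).2 hp1
    simpa using this
  have hγ0 : 0 ≤ (β - α) / 2 := by linarith
  choose K hK using fun i : Fin N => aux_grad (N := N) p.toReal hP i
  obtain ⟨Cw, hCw⟩ := aux_weighted (N := N) α β b c hα hβ hc p.toReal hP
  obtain ⟨B, hB⟩ : ∃ B : ℝ≥0, (B : ℝ) = |b| := ⟨⟨|b|, abs_nonneg b⟩, rfl⟩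
  obtain ⟨c', hc'⟩ : ∃ c' : ℝ≥0, (c' : ℝ) = c := ⟨⟨c, hc.le⟩, rfl⟩
  obtain ⟨t, ht⟩ : ∃ t : ℝ≥0, t = (2 * (B * ∑ i, K i + 1))⁻¹ := ⟨_, rfl⟩
  have ht0 : 0 < t := by rw [ht]; positivity
  refine ⟨2 * (1 + c' * Cw + B * (∑ i, K i) * t⁻¹), by positivity, fun u hu huc => ?_⟩
  have hu3 : ContDiff ℝ 3 u := contDiff_infty.1 hu 3
  have hu2 : ContDiff ℝ 2 u := contDiff_infty.1 hu 2
  obtain ⟨hfc, hfs⟩ := aux_opcont α β b c hα hβ u hu2 huc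
  have hlc : Continuous (lap u) := (aux_lap_contDiff u 0 hu2).continuous
  have hls : HasCompactSupport (lap u) := aux_lap_supp u huc
  have hpc : ∀ i, Continuous (pd u i) := fun i => (aux_pd_contDiff u 1 hu2 i).continuous
  have hWc : Continuous (fun x : EuclideanSpace ℝ (Fin N) => (1 + ‖x‖ ^ 2) ^ ((β - α) / 2)) :=
    Continuous.rpow_const (by fun_prop) fun x => Or.inr hγ0
  have hWu : Continuous (fun x : EuclideanSpace ℝ (Fin N) =>
      (1 + ‖x‖ ^ 2) ^ ((β - α) / 2) * u x) := hWc.mul hu2.continuous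
  -- finiteness
  have fL : eLpNorm (lap u) p volume ≠ ⊤ := (hlc.memLp_of_hasCompactSupport hls).2.ne
  have fF : eLpNorm (opAtilde α β b c u) p volume ≠ ⊤ :=
    (hfc.memLp_of_hasCompactSupport hfs).2.ne
  have fU : eLpNorm u p volume ≠ ⊤ := (hu2.continuous.memLp_of_hasCompactSupport huc).2.ne
  -- pointwise bound
  have hpt : ∀ x, ‖lap u x‖ ≤ ‖((fun x => |opAtilde α β b c u x|)
      + (∑ i, fun x => |b| * |pd u i x|)
      + (fun x => c * |(1 + ‖x‖ ^ 2) ^ ((β - α) / 2) * u x|)) x‖ := by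
    intro x
    have e : lap u x = opAtilde α β b c u x
        - ∑ i, (b * ‖x‖ ^ (α - 2) * (1 + ‖x‖ ^ α)⁻¹ * x i) * pd u i x
        + c * ‖x‖ ^ β * (1 + ‖x‖ ^ α)⁻¹ * u x := by
      have : ∑ i, (b * ‖x‖ ^ (α - 2) * (1 + ‖x‖ ^ α)⁻¹ * x i) * pd u i x
          = b * ‖x‖ ^ (α - 2) * (1 + ‖x‖ ^ α)⁻¹ * ∑ i, x i * pd u i x := by
        rw [Finset.mul_sum]
        exact Finset.sum_congr rfl fun i _ => by ring
      rw [this, opAtilde]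
      ring
    refine le_trans ?_ (Real.le_norm_self _)
    simp only [Pi.add_apply, Finset.sum_apply]
    rw [Real.norm_eq_abs, e]
    have hs : |∑ i, (b * ‖x‖ ^ (α - 2) * (1 + ‖x‖ ^ α)⁻¹ * x i) * pd u i x|
        ≤ ∑ i, |b| * |pd u i x| := by
      refine (Finset.abs_sum_le_sum_abs _ _).trans (Finset.sum_le_sum fun i _ => ?_)
      rw [abs_mul]
      refine mul_le_mul_of_nonneg_right ?_ (abs_nonneg _)
      rw [abs_mul]
      refine le_trans (mul_le_mul_of_nonneg_left (aux_coord x i) (abs_nonneg _)) ?_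
      exact aux_drift_coeff ‖x‖ α b (norm_nonneg x) hα
    have hv : |c * ‖x‖ ^ β * (1 + ‖x‖ ^ α)⁻¹ * u x|
        ≤ c * |(1 + ‖x‖ ^ 2) ^ ((β - α) / 2) * u x| := by
      rw [abs_mul, abs_mul _ (u x), abs_of_nonneg (by positivity : (0:ℝ) ≤ c * ‖x‖ ^ β * (1 + ‖x‖ ^ α)⁻¹),
        abs_of_nonneg (by positivity : (0:ℝ) ≤ (1 + ‖x‖ ^ 2) ^ ((β - α) / 2)), ← mul_assoc]
      exact mul_le_mul_of_nonneg_right (aux_Vup ‖x‖ α β c (norm_nonneg x) hα hβ hc) (abs_nonneg _)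
    refine (abs_add_le _ _).trans (add_le_add ((abs_sub _ _).trans (add_le_add le_rfl hs)) hv)
  have m1 : AEStronglyMeasurable (fun x => |opAtilde α β b c u x|) volume :=
    hfc.abs.aestronglyMeasurable
  have m2 : ∀ i, AEStronglyMeasurable (fun x => |b| * |pd u i x|) volume :=
    fun i => (continuous_const.mul (hpc i).abs).aestronglyMeasurable
  have m3 : AEStronglyMeasurable (fun x : EuclideanSpace ℝ (Fin N) =>
      c * |(1 + ‖x‖ ^ 2) ^ ((β - α) / 2) * u x|) volume :=
    (continuous_const.mul hWu.abs).aestronglyMeasurable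
  have m2s : AEStronglyMeasurable (∑ i, fun x => |b| * |pd u i x|) volume :=
    Finset.aestronglyMeasurable_sum _ fun i _ => m2 i
  have n1 : eLpNorm (fun x => |opAtilde α β b c u x|) p volume
      ≤ eLpNorm (opAtilde α β b c u) p volume :=
    eLpNorm_mono fun x => by simp
  have n2 : ∀ i, eLpNorm (fun x => |b| * |pd u i x|) p volume ≤
      (B : ℝ≥0∞) * (((K i * t⁻¹ : ℝ≥0) : ℝ≥0∞) * eLpNorm u p volume
        + ((K i * t : ℝ≥0) : ℝ≥0∞) * eLpNorm (lap u) p volume) := by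
    intro i
    refine (eLpNorm_le_mul_eLpNorm_of_ae_le_mul (g := pd u i) (c := |b|)
      (Filter.Eventually.of_forall fun x => by simp) p).trans ?_
    rw [← hB, ENNReal.ofReal_coe_nnreal]
    have := hK i u hu3 huc t ht0
    rw [← eLpNorm_eq_lintegral_rpow_enorm_toReal hp0 hp2,
      ← eLpNorm_eq_lintegral_rpow_enorm_toReal hp0 hp2,
      ← eLpNorm_eq_lintegral_rpow_enorm_toReal hp0 hp2] at this
    exact mul_le_mul' le_rfl this
  have n3 : eLpNorm (fun x : EuclideanSpace ℝ (Fin N) =>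
      c * |(1 + ‖x‖ ^ 2) ^ ((β - α) / 2) * u x|) p volume ≤
      (c' : ℝ≥0∞) * ((Cw : ℝ≥0∞) * (eLpNorm (opAtilde α β b c u) p volume
        + eLpNorm u p volume)) := by
    refine (eLpNorm_le_mul_eLpNorm_of_ae_le_mul (c := c)
      (g := fun x : EuclideanSpace ℝ (Fin N) => (1 + ‖x‖ ^ 2) ^ ((β - α) / 2) * u x)
      (Filter.Eventually.of_forall fun x => by
        rw [Real.norm_eq_abs, Real.norm_eq_abs, abs_mul, abs_abs, abs_of_pos hc]) p).trans ?_
    rw [← hc', ENNReal.ofReal_coe_nnreal, hc']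
    have := hCw u hu2 huc
    rw [← eLpNorm_eq_lintegral_rpow_enorm_toReal hp0 hp2,
      ← eLpNorm_eq_lintegral_rpow_enorm_toReal hp0 hp2,
      ← eLpNorm_eq_lintegral_rpow_enorm_toReal hp0 hp2] at this
    exact mul_le_mul' le_rfl this
  have main : eLpNorm (lap u) p volume ≤ eLpNorm (opAtilde α β b c u) p volume
      + ∑ i, (B : ℝ≥0∞) * (((K i * t⁻¹ : ℝ≥0) : ℝ≥0∞) * eLpNorm u p volume
        + ((K i * t : ℝ≥0) : ℝ≥0∞) * eLpNorm (lap u) p volume)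
      + (c' : ℝ≥0∞) * ((Cw : ℝ≥0∞) * (eLpNorm (opAtilde α β b c u) p volume
        + eLpNorm u p volume)) := by
    refine (eLpNorm_mono hpt).trans ((eLpNorm_add_le (m1.add m2s) m3 hp1.le).trans ?_)
    refine add_le_add ((eLpNorm_add_le m1 m2s hp1.le).trans (add_le_add n1 ?_)) n3
    exact (eLpNorm_sum_le (fun i _ => m2 i) hp1.le).trans (Finset.sum_le_sum fun i _ => n2 i)
  change eLpNorm (lap u) p volume ≤ _ * (eLpNorm (opAtilde α β b c u) p volume + _)
  generalize eLpNorm (lap u) p volume = L at *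
  generalize eLpNorm (opAtilde α β b c u) p volume = F at *
  generalize eLpNorm u p volume = U at *
  lift L to ℝ≥0 using fL
  lift F to ℝ≥0 using fF
  lift U to ℝ≥0 using fU
  have main' : L ≤ F + ∑ i, B * (K i * t⁻¹ * U + K i * t * L) + c' * (Cw * (F + U)) := by
    exact_mod_cast main
  exact_mod_cast aux_absorb_s5 L F U B c' Cw K t ht main'
end
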